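/- Let H be a Tonelli Hamiltonian on the flat torus 𝕋ⁿ and B a magnetic field on 𝕋ⁿ. Set e₀(H) := sup_{q∈ℝⁿ} inf_{p∈ℝⁿ} H(q,p). Then for Lebesgue-almost every k with inf H < k < e₀(H) there exist T > 0 and a nonconstant smooth T-periodic curve (q,p) : ℝ → ℝⁿ × ℝⁿ solving q̇ = ∇_p H(q,p), ṗ = −∇_q H(q,p) − B(q)∇_p H(q,p), and satisfying H(q(t),p(t)) = k for all t. -/

import Mathlib

namespace Torb
open MeasureTheory Set Metric

/-- Universal interpolation weights for `det (1 + A)`. -/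
theorem det_interp (V : Type*) [NormedAddCommGroup V] [NormedSpace ℝ V] [FiniteDimensional ℝ V]
    (t0 : ℝ) (ht0 : 0 < t0) :
    ∃ (s : Finset ℕ) (v w : ℕ → ℝ), (∀ i ∈ s, 0 < v i ∧ v i < t0) ∧ (∑ i ∈ s, w i = 1) ∧
      ∀ A : V →L[ℝ] V, (1 + A).det = ∑ i ∈ s, w i * (1 + v i • A).det := by
  classical
  set d := Module.finrank ℝ V
  let b := Module.finBasis ℝ V
  let v : ℕ → ℝ := fun i => t0 / (i + 2)
  have hv : Function.Injective v := by
    intro i j h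
    simp only [v] at h
    rw [div_eq_div_iff (by positivity) (by positivity)] at h
    have := mul_left_cancel₀ ht0.ne' h
    exact_mod_cast (by linarith : (i : ℝ) = j)
  let s := Finset.range (d + 1)
  let w : ℕ → ℝ := fun i => (Lagrange.basis s v i).eval 1
  have key : ∀ f : Polynomial ℝ, f.natDegree ≤ d → f.eval 1 = ∑ i ∈ s, w i * f.eval (v i) := by
    intro f hf
    have h := Lagrange.eq_interpolate (s := s) (v := v) (f := f) hv.injOn (by
      refine (Polynomial.degree_le_natDegree).trans_lt ?_
      simp only [s, Finset.card_range]
      exact_mod_cast Nat.lt_succ_of_le hf)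
    conv_lhs => rw [h]
    rw [Lagrange.interpolate_apply, Polynomial.eval_finsetSum]
    refine Finset.sum_congr rfl fun i _ => ?_
    simp [w, mul_comm]
  refine ⟨s, v, w, fun i _ => ⟨by positivity, ?_⟩, ?_, ?_⟩
  · simp only [v]
    rw [div_lt_iff₀ (by positivity)]
    have : (0:ℝ) ≤ i := by positivity
    nlinarith
  · have := key 1 (by simp)
    simpa using this.symm
  · intro A
    let M := LinearMap.toMatrix b b (A : V →ₗ[ℝ] V)
    let f : Polynomial ℝ := Matrix.det ((Polynomial.X : Polynomial ℝ) • M.map Polynomial.C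
      + (1 : Matrix _ _ ℝ).map Polynomial.C)
    have hf : f.natDegree ≤ d := by
      have := Polynomial.natDegree_det_X_add_C_le M 1
      simpa [f, d] using this
    have hev : ∀ t : ℝ, f.eval t = (1 + t • A).det := by
      intro t
      have h1 : (1 + t • A).det = Matrix.det (1 + t • M) := by
        rw [ContinuousLinearMap.det, ← LinearMap.det_toMatrix b]
        congr 1
        have : ((1 + t • A : V →L[ℝ] V) : V →ₗ[ℝ] V) = LinearMap.id + t • (A : V →ₗ[ℝ] V) := by
          ext; simp
        rw [this, map_add, LinearMap.toMatrix_id, map_smul]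
      rw [h1]
      simp only [f]
      rw [← Polynomial.coe_evalRingHom, RingHom.map_det]
      congr 1
      ext i j
      by_cases hij : i = j
      · subst hij; simp [mul_comm t, add_comm _ (1:ℝ)]
      · simp [Matrix.one_apply, hij, mul_comm t]
    have := key f hf
    simp only [hev] at this
    simpa using this


/-- `id + t (r - id)` maps the open ball bijectively onto itself for small `t`. -/
theorem no_retraction {V : Type*} [NormedAddCommGroup V] [InnerProductSpace ℝ V]
    [FiniteDimensional ℝ V] [MeasurableSpace V] [BorelSpace V] (r : V → V)
    (ρ : ℝ) (hρ : 0 < ρ) (hr : ContDiff ℝ 1 r) (hn : ∀ x, ‖r x‖ = ρ)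
    (hb : ∀ x, ‖x‖ = ρ → r x = x) : False := by
  have hdiff : Differentiable ℝ r := hr.differentiable (by norm_num)
  have hcd : Continuous (fderiv ℝ r) := hr.continuous_fderiv (by norm_num)
  let A : V → V →L[ℝ] V := fun x => fderiv ℝ r x - 1
  have hA : Continuous A := hcd.sub continuous_const
  obtain ⟨C, hC⟩ := (isCompact_closedBall (0 : V) ρ).exists_bound_of_continuousOn hA.continuousOn
  let C' : ℝ := |C| + 1
  have hC'pos : 0 < C' := by positivity
  have hAC : ∀ x ∈ closedBall (0 : V) ρ, ‖A x‖ ≤ C' := fun x hx =>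
    (hC x hx).trans ((le_abs_self C).trans (by simp [C']))
  let g : V → V := fun x => r x - x
  have hg : ∀ x, HasFDerivAt g (A x) x := fun x =>
    ((hdiff x).hasFDerivAt).sub (hasFDerivAt_id x)
  have hglip : ∀ x ∈ closedBall (0 : V) ρ, ∀ y ∈ closedBall (0 : V) ρ,
      ‖g y - g x‖ ≤ C' * ‖y - x‖ := fun x hx y hy =>
    (convex_closedBall (0 : V) ρ).norm_image_sub_le_of_norm_hasFDerivWithin_le
      (fun z _ => (hg z).hasFDerivWithinAt) hAC hx hy
  let t0 : ℝ := min 1 (1 / C')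
  have ht0 : 0 < t0 := by positivity
  let f : ℝ → V → V := fun t x => x + t • g x
  have hfd : ∀ t x, HasFDerivAt (f t) (1 + t • A x) x := fun t x =>
    (hasFDerivAt_id x).add ((hg x).const_smul t)
  have hdetpos : ∀ t, 0 < t → t < t0 → ∀ x ∈ ball (0 : V) ρ, 0 < (1 + t • A x).det := by
    intro t ht htt x hx
    have hlt : ‖t • A x‖ < 1 := by
      rw [norm_smul, Real.norm_eq_abs, abs_of_pos ht]
      have h3 := hAC x (ball_subset_closedBall hx)
      have := htt.trans_le (min_le_right _ _)
      rw [lt_div_iff₀ hC'pos] at this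
      nlinarith
    have hne : ∀ s ∈ Icc (0:ℝ) 1, (1 + s • t • A x).det ≠ 0 := by
      intro s hs h0
      have hker := (LinearMap.bot_lt_ker_of_det_eq_zero (f := ((1 + s • t • A x : V →L[ℝ] V) : V →ₗ[ℝ] V)) h0)
      obtain ⟨y, hy, hy0⟩ := (Submodule.ne_bot_iff _).1 hker.ne'
      have hy1 : y + s • (t • A x) y = 0 := by simpa using hy
      have hy2 : ‖y‖ ≤ ‖t • A x‖ * ‖y‖ := by
        calc ‖y‖ = ‖s • (t • A x) y‖ := by
              rw [eq_neg_of_add_eq_zero_left hy1, norm_neg, ← eq_neg_of_add_eq_zero_left hy1]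
          _ = |s| * ‖(t • A x) y‖ := by rw [norm_smul, Real.norm_eq_abs]
          _ ≤ 1 * ‖(t • A x) y‖ := by
              gcongr
              rw [abs_of_nonneg hs.1]; exact hs.2
          _ ≤ _ := by rw [one_mul]; exact (t • A x).le_opNorm y
      have : 0 < ‖y‖ := norm_pos_iff.2 hy0
      nlinarith
    have hcont : Continuous fun s : ℝ => (1 + s • t • A x).det :=
      ContinuousLinearMap.continuous_det.comp (by fun_prop)
    by_contra hneg
    push Not at hneg
    have h01 := intermediate_value_Icc' (zero_le_one (α := ℝ)) hcont.continuousOn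
    obtain ⟨s, hs, h0⟩ := h01 (show (0:ℝ) ∈ _ from ⟨by simpa using hneg, by
      simp [ContinuousLinearMap.det]⟩)
    exact hne s hs h0
  have hinj : ∀ t, 0 < t → t < t0 → InjOn (f t) (closedBall 0 ρ) := by
    intro t ht htt x hx y hy hxy
    by_contra hne
    have h1 : x - y = t • (g y - g x) := by
      simp only [f] at hxy
      rw [smul_sub, sub_eq_sub_iff_add_eq_add, hxy]; abel
    have h2 : ‖x - y‖ ≤ t * (C' * ‖y - x‖) := by
      conv_lhs => rw [h1]
      rw [norm_smul, Real.norm_eq_abs, abs_of_pos ht]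
      exact mul_le_mul_of_nonneg_left (hglip x hx y hy) ht.le
    rw [norm_sub_rev y x] at h2
    have h3 : 0 < ‖x - y‖ := norm_pos_iff.2 (sub_ne_zero.2 hne)
    have h4 : t * C' < 1 := by
      have := htt.trans_le (min_le_right _ _)
      rwa [lt_div_iff₀ hC'pos] at this
    nlinarith
  have himg : ∀ t, 0 < t → t < t0 → f t '' (ball 0 ρ) = ball 0 ρ := by
    intro t ht htt
    have ht1 : t < 1 := htt.trans_le (min_le_left _ _)
    have hfx : ∀ x, f t x = (1 - t) • x + t • r x := fun x => by
      simp only [f, g]; module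
    have hnf : ∀ x ∈ ball (0 : V) ρ, f t x ∈ ball (0 : V) ρ := by
      intro x hx
      rw [mem_ball_zero_iff] at hx ⊢
      rw [hfx]
      refine (norm_add_le _ _).trans_lt ?_
      rw [norm_smul, norm_smul, hn, Real.norm_eq_abs, Real.norm_eq_abs, abs_of_pos ht,
        abs_of_pos (by linarith)]
      nlinarith
    have hcf : Continuous (f t) := by
      rw [continuous_iff_continuousAt]; exact fun x => (hfd t x).continuousAt
    have hcd1 : ContDiff ℝ 1 (f t) := by
      simp only [f, g]; fun_prop
    have hopen : IsOpen (f t '' ball 0 ρ) := by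
      rw [isOpen_iff_mem_nhds]
      rintro _ ⟨x, hx, rfl⟩
      have hd := (hdetpos t ht htt x hx).ne'
      let e := ContinuousLinearMap.toContinuousLinearEquivOfDetNeZero _ hd
      have hst : HasStrictFDerivAt (f t) (e : V →L[ℝ] V) x := by
        have := hcd1.contDiffAt.hasStrictFDerivAt' (hfd t x) (by norm_num)
        rwa [ContinuousLinearMap.coe_toContinuousLinearEquivOfDetNeZero]
      rw [← hst.map_nhds_eq_of_equiv]
      exact Filter.image_mem_map (isOpen_ball.mem_nhds hx)
    have hclosed : f t '' ball 0 ρ = f t '' closedBall 0 ρ ∩ ball 0 ρ := by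
      ext y; constructor
      · rintro ⟨x, hx, rfl⟩; exact ⟨⟨x, ball_subset_closedBall hx, rfl⟩, hnf x hx⟩
      · rintro ⟨⟨x, hx, rfl⟩, hy⟩
        refine ⟨x, ?_, rfl⟩
        rw [mem_closedBall_zero_iff] at hx
        rcases hx.lt_or_eq with h | h
        · simpa using h
        · exfalso
          rw [hfx, hb x h, ← add_smul] at hy
          simp [h] at hy
    have hpre : IsPreconnected (ball (0:V) ρ) := (convex_ball 0 ρ).isPreconnected
    refine Subset.antisymm (fun y hy => by obtain ⟨x, hx, rfl⟩ := hy; exact hnf x hx) ?_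
    have hcc : IsClosed (f t '' closedBall 0 ρ) := ((isCompact_closedBall 0 ρ).image hcf).isClosed
    by_contra hnot
    obtain ⟨y, hy, hyn⟩ := not_subset.1 hnot
    have := hpre _ _ hopen hcc.isOpen_compl (by
      intro z hz
      by_cases hzz : z ∈ f t '' closedBall 0 ρ
      · left; rw [hclosed]; exact ⟨hzz, hz⟩
      · right; exact hzz) ⟨f t 0, hnf 0 (by simpa), 0, by simpa, rfl⟩
      ⟨y, hy, fun h => hyn (by rw [hclosed]; exact ⟨h, hy⟩)⟩
    obtain ⟨z, _, h1, h2⟩ := this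
    exact h2 (image_mono ball_subset_closedBall h1)
  have hvol : ∀ t, 0 < t → t < t0 →
      ∫ x in ball (0 : V) ρ, (1 + t • A x).det = (volume (ball (0 : V) ρ)).toReal := by
    intro t ht htt
    have h := integral_image_eq_integral_abs_det_fderiv_smul volume (s := ball (0 : V) ρ)
      (f := f t) (f' := fun x => 1 + t • A x) measurableSet_ball
      (fun x _ => (hfd t x).hasFDerivWithinAt) ((hinj t ht htt).mono ball_subset_closedBall)
      (fun _ => (1 : ℝ))
    rw [himg t ht htt] at h
    simp only [smul_eq_mul, mul_one, integral_const, measureReal_restrict_apply_univ] at h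
    rw [← measureReal_def, h]
    refine setIntegral_congr_fun measurableSet_ball fun x hx => ?_
    exact (abs_of_pos (hdetpos t ht htt x hx)).symm
  obtain ⟨s, v, w, hv, hw, hdet⟩ := det_interp V t0 ht0
  have hdetcont : ∀ t : ℝ, Continuous fun x => (1 + t • A x).det := fun t =>
    ContinuousLinearMap.continuous_det.comp (continuous_const.add (hA.const_smul t))
  have hintg : ∀ t : ℝ, IntegrableOn (fun x => (1 + t • A x).det) (ball (0 : V) ρ) := fun t =>
    ((hdetcont t).continuousOn.integrableOn_compact (isCompact_closedBall 0 ρ)).mono_set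
      ball_subset_closedBall
  have h1 : ∫ x in ball (0 : V) ρ, (1 + A x).det = (volume (ball (0 : V) ρ)).toReal := by
    rw [show (fun x => (1 + A x).det) = fun x => ∑ i ∈ s, w i * (1 + v i • A x).det
      from funext fun x => hdet (A x)]
    rw [integral_finsetSum _ (fun i _ => (hintg (v i)).const_mul _)]
    simp only [integral_const_mul]
    rw [Finset.sum_congr rfl (fun i hi => by rw [hvol (v i) (hv i hi).1 (hv i hi).2]),
      ← Finset.sum_mul, hw, one_mul]
  have h2 : ∀ x : V, (1 + A x).det = 0 := by
    intro x
    have hAx : 1 + A x = fderiv ℝ r x := by simp [A]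
    rw [hAx]
    by_contra hne
    have hsurj : Function.Surjective (fderiv ℝ r x) := by
      exact (LinearMap.equivOfDetNeZero (fderiv ℝ r x : V →ₗ[ℝ] V) hne).surjective
    obtain ⟨u, hu⟩ := hsurj (r x)
    have hc : HasFDerivAt (fun y => inner ℝ (r y) (r y)) _ x :=
      ((hdiff x).hasFDerivAt).inner ℝ ((hdiff x).hasFDerivAt)
    have hconst : (fun y => inner ℝ (r y) (r y)) = fun _ => ρ ^ 2 := by
      funext y; rw [real_inner_self_eq_norm_sq, hn]
    rw [hconst] at hc
    have := congrArg (fun l => l u) (hc.unique (hasFDerivAt_const _ _))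
    simp [fderivInnerCLM_apply, hu, hn] at this
    exact hρ.ne' this
  simp only [h2, integral_zero] at h1
  have : 0 < volume (ball (0 : V) ρ) := measure_ball_pos _ _ hρ
  have h3 := ENNReal.toReal_pos this.ne' measure_ball_lt_top.ne
  linarith

theorem brouwer_inner {V : Type*} [NormedAddCommGroup V] [InnerProductSpace ℝ V]
    [FiniteDimensional ℝ V] (f : V → V) (hf : Continuous f) (C : ℝ)
    (hC : ∀ x, ‖f x‖ ≤ C) : ∃ x, f x = x := by
  letI : MeasurableSpace V := borel V
  haveI : BorelSpace V := ⟨rfl⟩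
  by_contra hno
  push Not at hno
  have hC0 : 0 ≤ C := (norm_nonneg _).trans (hC 0)
  let φ : V → ℝ := fun x => max 0 (min 1 (C + 2 - ‖x‖))
  have hφ : Continuous φ := by fun_prop
  have hφ1 : ∀ x, φ x ≤ 1 := fun x => max_le zero_le_one (min_le_left _ _)
  have hφ0 : ∀ x, 0 ≤ φ x := fun x => le_max_left _ _
  let f' : V → V := fun x => φ x • f x
  have hf' : Continuous f' := by fun_prop
  have hno' : ∀ x, f' x ≠ x := by
    intro x hx
    have h1 : ‖x‖ ≤ C := by
      rw [← hx]
      simp only [f']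
      rw [norm_smul, Real.norm_eq_abs, abs_of_nonneg (hφ0 x)]
      nlinarith [hφ1 x, hC x, hφ0 x, norm_nonneg (f x)]
    have h2 : φ x = 1 := by
      simp only [φ]
      rw [min_eq_left (by linarith), max_eq_right zero_le_one]
    simp only [f', h2, one_smul] at hx
    exact hno x hx
  obtain ⟨g, hg, hgf, hgs⟩ := hf'.exists_contDiff_approx 1 (ε := fun x => ‖x - f' x‖)
    (by fun_prop) (fun x => norm_pos_iff.2 (sub_ne_zero.2 (hno' x).symm))
  have hG0 : ∀ x, x - g x ≠ 0 := by
    intro x hx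
    have h1 := hgf x
    rw [← sub_eq_zero.1 hx, dist_eq_norm] at h1
    exact lt_irrefl _ h1
  have hgz : ∀ x, ‖x‖ = C + 2 → g x = 0 := by
    intro x hx
    by_contra h
    have h1 : f' x ≠ 0 := hgs h
    apply h1
    simp [f', φ, hx]
  have hGd : ContDiff ℝ 1 (fun x => x - g x) := contDiff_id.sub hg
  refine no_retraction (fun x => ((C + 2) / ‖x - g x‖) • (x - g x)) (C + 2) (by linarith) ?_ ?_ ?_
  · exact (contDiff_const.div (hGd.norm ℝ hG0) (fun x => norm_ne_zero_iff.2 (hG0 x))).smul hGd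
  · intro x
    have := norm_ne_zero_iff.2 (hG0 x)
    rw [norm_smul, norm_div, norm_norm, div_mul_cancel₀ _ this, Real.norm_eq_abs,
      abs_of_pos (by linarith)]
  · intro x hx
    simp only [hgz x hx, sub_zero, hx]
    rw [div_self (by linarith), one_smul]

theorem brouwer {W : Type*} [NormedAddCommGroup W] [NormedSpace ℝ W]
    [FiniteDimensional ℝ W] (f : W → W) (hf : Continuous f) (C : ℝ)
    (hC : ∀ x, ‖f x‖ ≤ C) : ∃ x, f x = x := by
  let e := toEuclidean (E := W)
  obtain ⟨x, hx⟩ := brouwer_inner (fun y => e (f (e.symm y))) (by fun_prop)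
    (‖(e : W →L[ℝ] EuclideanSpace ℝ (Fin (Module.finrank ℝ W)))‖ * C) (fun y =>
      (ContinuousLinearMap.le_opNorm (e : W →L[ℝ] EuclideanSpace ℝ (Fin (Module.finrank ℝ W))) _).trans
        (mul_le_mul_of_nonneg_left (hC _) (norm_nonneg _)))
  exact ⟨e.symm x, by rw [e.eq_symm_apply]; exact hx⟩

/-- Linking lemma. -/
theorem linking {E : Type*} [NormedAddCommGroup E] [NormedSpace ℝ E] [FiniteDimensional ℝ E]
    (x0 : E → ℝ → E) (σ : E → ℝ → ℝ)
    (hx0 : ContinuousOn (fun z : E × ℝ => x0 z.1 z.2) (univ ×ˢ Icc 0 1))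
    (hσ : ContinuousOn (fun z : E × ℝ => σ z.1 z.2) (univ ×ˢ Icc 0 1))
    (C : ℝ) (hC : ∀ q, ∀ s ∈ Icc (0:ℝ) 1, ‖x0 q s - q‖ ≤ C) (q0 : E) (s' : ℝ)
    (h0 : ∀ q, σ q 0 < s') (h1 : ∀ q, s' < σ q 1) :
    ∃ q, ∃ s ∈ Icc (0:ℝ) 1, x0 q s = q0 ∧ σ q s = s' := by
  let P : ℝ → ℝ := fun s => max 0 (min 1 s)
  have hP : Continuous P := by fun_prop
  have hPm : ∀ s, P s ∈ Icc (0:ℝ) 1 := fun s =>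
    ⟨le_max_left _ _, max_le zero_le_one (min_le_left _ _)⟩
  have hPid : ∀ s ∈ Icc (0:ℝ) 1, P s = s := fun s hs => by
    simp only [P]; rw [min_eq_right hs.2, max_eq_right hs.1]
  have hx0' : Continuous fun z : E × ℝ => x0 z.1 (P z.2) :=
    hx0.comp_continuous (f := fun z : E × ℝ => (z.1, P z.2)) (by fun_prop)
      (fun z => ⟨mem_univ _, hPm _⟩)
  have hσ' : Continuous fun z : E × ℝ => σ z.1 (P z.2) :=
    hσ.comp_continuous (f := fun z : E × ℝ => (z.1, P z.2)) (by fun_prop)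
      (fun z => ⟨mem_univ _, hPm _⟩)
  obtain ⟨z, hz⟩ := brouwer (W := E × ℝ)
    (fun z => (z.1 - x0 z.1 (P z.2) + q0, P (P z.2 - (σ z.1 (P z.2) - s'))))
    (((continuous_fst.sub hx0').add continuous_const).prodMk
      (hP.comp ((hP.comp continuous_snd).sub (hσ'.sub continuous_const))))
    (max (C + ‖q0‖) 1) (fun z => by
      rw [Prod.norm_def]
      refine max_le_max ?_ ?_
      · refine (norm_add_le _ _).trans ?_
        have := hC z.1 _ (hPm z.2)
        rw [norm_sub_rev] at this
        gcongr
      · have := hPm (P z.2 - (σ z.1 (P z.2) - s'))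
        rw [Real.norm_eq_abs, abs_of_nonneg this.1]; exact this.2)
  have hz1 : z.1 - x0 z.1 (P z.2) + q0 = z.1 := congrArg Prod.fst hz
  have hz2 : P (P z.2 - (σ z.1 (P z.2) - s')) = z.2 := congrArg Prod.snd hz
  have hzm : z.2 ∈ Icc (0:ℝ) 1 := by rw [← hz2]; exact hPm _
  rw [hPid _ hzm] at hz1 hz2
  refine ⟨z.1, z.2, hzm, ?_, ?_⟩
  · have : q0 = x0 z.1 z.2 := by
      have h : q0 - x0 z.1 z.2 = 0 := by
        calc q0 - x0 z.1 z.2 = (z.1 - x0 z.1 z.2 + q0) - z.1 := by abel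
          _ = 0 := by rw [hz1, sub_self]
      exact sub_eq_zero.1 h
    exact this.symm
  · rcases hzm.1.eq_or_lt with h | hp
    · exfalso
      have ha := h0 z.1
      rw [h] at ha
      have : 0 < P (z.2 - (σ z.1 z.2 - s')) := by
        simp only [P]; refine lt_max_of_lt_right (lt_min one_pos ?_); linarith
      linarith
    rcases hzm.2.eq_or_lt with h | hl
    · exfalso
      have ha := h1 z.1
      rw [← h] at ha
      have : P (z.2 - (σ z.1 z.2 - s')) < 1 := by
        simp only [P]; refine max_lt one_pos (min_lt_of_right_lt ?_); linarith
      linarith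
    · simp only [P] at hz2
      rcases max_cases 0 (min 1 (z.2 - (σ z.1 z.2 - s'))) with h | h <;>
      rcases min_cases 1 (z.2 - (σ z.1 z.2 - s')) with h' | h' <;> linarith

end Torb

namespace Torb
open MeasureTheory Set Metric Filter Topology
open scoped RealInnerProductSpace

abbrev Eu (n : ℕ) := EuclideanSpace ℝ (Fin n)

/-- lattice vectors -/
noncomputable def lat {n : ℕ} (m : Fin n → ℤ) : Eu n :=
  (EuclideanSpace.equiv (Fin n) ℝ).symm (fun i => (m i : ℝ))

/-- A modified Hamiltonian: strongly convex with quadratic growth. -/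
structure Ham (n : ℕ) where
  H : Eu n × Eu n → ℝ
  Hq : Eu n × Eu n → Eu n
  Hp : Eu n × Eu n → Eu n
  hd : ∀ q p, HasFDerivAt H ((innerSL ℝ (Hq (q, p))).comp (ContinuousLinearMap.fst ℝ _ _) +
    (innerSL ℝ (Hp (q, p))).comp (ContinuousLinearMap.snd ℝ _ _)) (q, p)
  cq : Continuous Hq
  cp : Continuous Hp
  perH : ∀ m q p, H (q + lat m, p) = H (q, p)
  perHq : ∀ m q p, Hq (q + lat m, p) = Hq (q, p)
  perHp : ∀ m q p, Hp (q + lat m, p) = Hp (q, p)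
  c : ℝ
  C : ℝ
  c_pos : 0 < c
  C_pos : 0 < C
  mono : ∀ q p p', c * ‖p - p'‖ ^ 2 ≤ ⟪Hp (q, p) - Hp (q, p'), p - p'⟫
  Hq_le : ∀ q p, ‖Hq (q, p)‖ ≤ C
  Hp_le : ∀ q p, ‖Hp (q, p)‖ ≤ C * (1 + ‖p‖)
  low : ∀ q p, c * ‖p‖ ^ 2 - C ≤ H (q, p)
  up : ∀ q p, H (q, p) ≤ C * (1 + ‖p‖ ^ 2)

namespace Ham
variable {n : ℕ} (S : Ham n)

theorem cH : Continuous S.H :=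
  continuous_iff_continuousAt.2 fun z => (S.hd z.1 z.2).continuousAt

/-- derivative along `p`-lines -/
theorem hasDerivAt_p (q p w : Eu n) (t : ℝ) :
    HasDerivAt (fun t : ℝ => S.H (q, p + t • w)) ⟪S.Hp (q, p + t • w), w⟫ t := by
  have h1 : HasDerivAt (fun t : ℝ => ((q, p + t • w) : Eu n × Eu n)) (0, w) t := by
    refine (hasDerivAt_const t q).prodMk ?_
    simpa using ((hasDerivAt_id t).smul_const w).const_add p
  exact ((S.hd q (p + t • w)).comp_hasDerivAt t h1).congr_deriv (by simp)

theorem hasDerivAt_q (q p w : Eu n) (t : ℝ) :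
    HasDerivAt (fun t : ℝ => S.H (q + t • w, p)) ⟪S.Hq (q + t • w, p), w⟫ t := by
  have h1 : HasDerivAt (fun t : ℝ => ((q + t • w, p) : Eu n × Eu n)) (w, 0) t := by
    refine HasDerivAt.prodMk ?_ (hasDerivAt_const t p)
    simpa using ((hasDerivAt_id t).smul_const w).const_add q
  exact ((S.hd (q + t • w) p).comp_hasDerivAt t h1).congr_deriv (by simp)

/-- convexity inequality -/
theorem convex_ineq (q p p' : Eu n) :
    S.H (q, p) + ⟪S.Hp (q, p), p' - p⟫ ≤ S.H (q, p') := by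
  set w := p' - p
  have hmono : MonotoneOn (fun t : ℝ => S.H (q, p + t • w) - t * ⟪S.Hp (q, p), w⟫) (Icc 0 1) := by
    have hder : ∀ t : ℝ, HasDerivAt (fun t : ℝ => S.H (q, p + t • w) - t * ⟪S.Hp (q, p), w⟫)
        (⟪S.Hp (q, p + t • w), w⟫ - ⟪S.Hp (q, p), w⟫) t := fun t => by
      exact ((S.hasDerivAt_p q p w t).sub
        ((hasDerivAt_id t).mul_const ⟪S.Hp (q, p), w⟫)).congr_deriv (by simp)
    refine monotoneOn_of_deriv_nonneg (convex_Icc 0 1)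
      (fun t _ => (hder t).continuousAt.continuousWithinAt)
      (fun t _ => (hder t).differentiableAt.differentiableWithinAt) ?_
    intro t ht
    rw [interior_Icc] at ht
    rw [(hder t).deriv, ← inner_sub_left]
    have h := S.mono q (p + t • w) p
    have h2 : (p + t • w) - p = t • w := by abel
    rw [h2, inner_smul_right] at h
    have h3 : 0 ≤ t * ⟪S.Hp (q, p + t • w) - S.Hp (q, p), w⟫ :=
      le_trans (by have := S.c_pos; positivity) h
    exact nonneg_of_mul_nonneg_right (by linarith) ht.1
  have := hmono (left_mem_Icc.2 zero_le_one) (right_mem_Icc.2 zero_le_one) zero_le_one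
  simp only [zero_smul, add_zero, zero_mul, sub_zero, one_smul, one_mul] at this
  have hw : p + w = p' := by simp [w]
  rw [hw] at this
  linarith

/-- coercivity of `Hp` -/
theorem dist_le (q p p' : Eu n) : S.c * ‖p - p'‖ ≤ ‖S.Hp (q, p) - S.Hp (q, p')‖ := by
  rcases eq_or_ne p p' with rfl | h
  · simp
  · have h0 : 0 < ‖p - p'‖ := norm_pos_iff.2 (sub_ne_zero.2 h)
    have h1 := (S.mono q p p').trans (real_inner_le_norm _ _)
    have h2 : (S.c * ‖p - p'‖) * ‖p - p'‖ ≤ ‖S.Hp (q, p) - S.Hp (q, p')‖ * ‖p - p'‖ := by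
      nlinarith
    exact le_of_mul_le_mul_right h2 h0

theorem exists_P (q v : Eu n) : ∃ p, S.Hp (q, p) = v := by
  have hcont : Continuous fun p => S.H (q, p) - ⟪p, v⟫ := by
    have := S.cH
    fun_prop
  have hcoer : Tendsto (fun p => S.H (q, p) - ⟪p, v⟫) (cocompact (Eu n)) atTop := by
    have h1 : Tendsto (fun p : Eu n => S.c * ‖p‖ ^ 2 - S.C - ‖p‖ * ‖v‖) (cocompact (Eu n)) atTop := by
      have h2 : Tendsto (fun s : ℝ => s * (S.c * s - ‖v‖) + (- S.C)) atTop atTop := by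
        refine tendsto_atTop_add_const_right _ _ (tendsto_id.atTop_mul_atTop₀ ?_)
        exact tendsto_atTop_add_const_right _ _ (tendsto_id.const_mul_atTop S.c_pos)
      refine (h2.comp (tendsto_norm_cocompact_atTop (E := Eu n))).congr fun p => ?_
      simp only [Function.comp]; ring
    refine tendsto_atTop_mono (fun p => ?_) h1
    have := real_inner_le_norm p v
    have := S.low q p
    linarith
  obtain ⟨p, hp⟩ := hcont.exists_forall_le hcoer
  refine ⟨p, ?_⟩
  have key : ∀ w, ⟪S.Hp (q, p) - v, w⟫ = 0 := by
    intro w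
    have hder : HasDerivAt (fun t : ℝ => S.H (q, p + t • w) - ⟪p + t • w, v⟫)
        (⟪S.Hp (q, p + (0:ℝ) • w), w⟫ - ⟪w, v⟫) 0 := by
      refine (S.hasDerivAt_p q p w 0).sub ?_
      have : (fun t : ℝ => ⟪p + t • w, v⟫) = fun t => ⟪p, v⟫ + t * ⟪w, v⟫ := by
        funext t; rw [inner_add_left, real_inner_smul_left]
      rw [this]
      simpa using ((hasDerivAt_id (0:ℝ)).mul_const ⟪w, v⟫).const_add ⟪p, v⟫
    have hmin : IsLocalMin (fun t : ℝ => S.H (q, p + t • w) - ⟪p + t • w, v⟫) 0 :=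
      Filter.Eventually.of_forall fun t => by simpa using hp (p + t • w)
    have := hmin.hasDerivAt_eq_zero hder
    rw [inner_sub_left, real_inner_comm w v]
    simpa using this
  have := key (S.Hp (q, p) - v)
  exact sub_eq_zero.1 (inner_self_eq_zero.1 this)

/-- Legendre momentum -/
noncomputable def P (z : Eu n × Eu n) : Eu n := (S.exists_P z.1 z.2).choose

theorem Hp_P (q v : Eu n) : S.Hp (q, S.P (q, v)) = v := (S.exists_P q v).choose_spec

theorem P_dist (q v p : Eu n) : S.c * ‖S.P (q, v) - p‖ ≤ ‖v - S.Hp (q, p)‖ := by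
  simpa [S.Hp_P] using S.dist_le q (S.P (q, v)) p

theorem P_eq (q v p : Eu n) (h : S.Hp (q, p) = v) : S.P (q, v) = p := by
  have := S.P_dist q v p
  rw [h, sub_self, norm_zero] at this
  have h1 : ‖S.P (q, v) - p‖ ≤ 0 := by
    by_contra h; push Not at h; nlinarith [S.c_pos]
  exact sub_eq_zero.1 (norm_le_zero_iff.1 h1)

theorem cP : Continuous S.P := by
  rw [continuous_iff_continuousAt]
  rintro ⟨q, v⟩
  rw [ContinuousAt, tendsto_iff_norm_sub_tendsto_zero]
  have h1 : Tendsto (fun z : Eu n × Eu n => S.c⁻¹ * ‖z.2 - S.Hp (z.1, S.P (q, v))‖) (𝓝 (q, v)) (𝓝 0) := by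
    have : Continuous (fun z : Eu n × Eu n => S.c⁻¹ * ‖z.2 - S.Hp (z.1, S.P (q, v))‖) := by
      have := S.cp
      fun_prop
    have h := this.tendsto (q, v)
    simpa [S.Hp_P] using h
  refine squeeze_zero (fun _ => norm_nonneg _) (fun z => ?_) h1
  have := S.P_dist z.1 z.2 (S.P (q, v))
  rw [le_inv_mul_iff₀ S.c_pos]
  exact this

theorem perP (m q v) : S.P (q + lat m, v) = S.P (q, v) :=
  S.P_eq _ _ _ (by rw [S.perHp, S.Hp_P])

theorem P_le (q v : Eu n) : S.c * ‖S.P (q, v)‖ ≤ ‖v‖ + S.C := by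
  have h := S.P_dist q v 0
  have h2 := S.Hp_le q 0
  simp only [sub_zero, norm_zero, add_zero, mul_one] at h h2
  linarith [norm_sub_le v (S.Hp (q, 0))]

theorem le_P (q v : Eu n) : ‖v‖ ≤ S.C * (1 + ‖S.P (q, v)‖) := by
  have h2 := S.Hp_le q (S.P (q, v))
  rwa [S.Hp_P] at h2

/-- the Lagrangian -/
noncomputable def L (z : Eu n × Eu n) : ℝ := ⟪S.P z, z.2⟫ - S.H (z.1, S.P z)

theorem L_ge (q v p : Eu n) : ⟪p, v⟫ - S.H (q, p) ≤ S.L (q, v) := by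
  have := S.convex_ineq q (S.P (q, v)) p
  rw [S.Hp_P, inner_sub_right, real_inner_comm p, real_inner_comm (S.P (q, v))] at this
  simp only [L]
  linarith

theorem perL (m q v) : S.L (q + lat m, v) = S.L (q, v) := by
  simp only [L, S.perP, S.perH]

theorem cL : Continuous S.L := by
  have := S.cH; have := S.cP
  unfold L; fun_prop

/-- Danskin: derivative of the Lagrangian. -/
theorem hasFDerivAt_L (q v : Eu n) : HasFDerivAt S.L
    ((-innerSL ℝ (S.Hq (q, S.P (q, v)))).comp (ContinuousLinearMap.fst ℝ _ _) +
    (innerSL ℝ (S.P (q, v))).comp (ContinuousLinearMap.snd ℝ _ _)) (q, v) := by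
  rw [hasFDerivAt_iff_isLittleO, Asymptotics.isLittleO_iff]
  intro ε hε
  -- continuity of `Hq` near `(q, P(q,v))`
  have hc1 : ∀ᶠ z in 𝓝 (q, S.P (q, v)), ‖S.Hq z - S.Hq (q, S.P (q, v))‖ < ε / 2 := by
    have : Tendsto (fun z => ‖S.Hq z - S.Hq (q, S.P (q, v))‖) (𝓝 (q, S.P (q, v))) (𝓝 0) := by
      rw [← tendsto_iff_norm_sub_tendsto_zero]; exact S.cq.tendsto _
    exact this.eventually (gt_mem_nhds (by positivity))
  obtain ⟨r, hr, hball⟩ := Metric.eventually_nhds_iff_ball.1 hc1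
  have hPc : ∀ᶠ z in 𝓝 (q, v), ‖S.P z - S.P (q, v)‖ < min r (ε / 2) := by
    have : Tendsto (fun z => ‖S.P z - S.P (q, v)‖) (𝓝 (q, v)) (𝓝 0) := by
      rw [← tendsto_iff_norm_sub_tendsto_zero]; exact S.cP.tendsto _
    exact this.eventually (gt_mem_nhds (by positivity))
  have hdc : ∀ᶠ z in 𝓝 (q, v), dist z (q, v) < r := Metric.eventually_nhds_iff.2 ⟨r, hr, fun {y} h => h⟩
  -- mean value estimate for `H` in the `q` direction
  have mv : ∀ q' p', ‖q' - q‖ < r → ‖p' - S.P (q, v)‖ < r →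
      |S.H (q', p') - S.H (q, p') - ⟪S.Hq (q, S.P (q, v)), q' - q⟫| ≤ ε / 2 * ‖q' - q‖ := by
    intro q' p' hq' hp'
    have h := (convex_Icc (0:ℝ) 1).norm_image_sub_le_of_norm_hasDerivWithin_le
      (f := fun t : ℝ => S.H (q + t • (q' - q), p') - t * ⟪S.Hq (q, S.P (q, v)), q' - q⟫)
      (f' := fun t => ⟪S.Hq (q + t • (q' - q), p'), q' - q⟫ - ⟪S.Hq (q, S.P (q, v)), q' - q⟫)
      (C := ε / 2 * ‖q' - q‖) (fun t _ => by
        refine (HasDerivAt.sub (S.hasDerivAt_q q p' (q' - q) t) ?_).hasDerivWithinAt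
        simpa using (hasDerivAt_id t).mul_const ⟪S.Hq (q, S.P (q, v)), q' - q⟫)
      (fun t ht => by
        rw [← inner_sub_left, Real.norm_eq_abs]
        refine (abs_real_inner_le_norm _ _).trans ?_
        gcongr
        refine (hball (q + t • (q' - q), p') ?_).le
        rw [mem_ball, Prod.dist_eq, dist_eq_norm, dist_eq_norm]
        refine max_lt ?_ hp'
        simp only [add_sub_cancel_left, norm_smul, Real.norm_eq_abs, abs_of_nonneg ht.1]
        nlinarith [norm_nonneg (q' - q), ht.2, ht.1])
      (left_mem_Icc.2 zero_le_one) (right_mem_Icc.2 zero_le_one)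
    simp only [one_smul, add_sub_cancel, one_mul, zero_smul, add_zero, zero_mul, sub_zero,
      norm_one, mul_one, Real.norm_eq_abs] at h
    convert h using 2; ring
  filter_upwards [hPc, hdc] with z hz1 hz2
  obtain ⟨q', v'⟩ := z
  rw [Prod.dist_eq, max_lt_iff, dist_eq_norm, dist_eq_norm] at hz2
  have hqn : ‖q' - q‖ ≤ ‖((q', v') - (q, v) : Eu n × Eu n)‖ := norm_fst_le ((q', v') - (q, v) : Eu n × Eu n)
  have hvn : ‖v' - v‖ ≤ ‖((q', v') - (q, v) : Eu n × Eu n)‖ := norm_snd_le ((q', v') - (q, v) : Eu n × Eu n)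
  set D := ‖((q', v') - (q, v) : Eu n × Eu n)‖
  have low := S.L_ge q' v' (S.P (q, v))
  have upp := S.L_ge q v (S.P (q', v'))
  have m1 := mv q' (S.P (q, v)) hz2.1 (by simpa using hr)
  have m2 := mv q' (S.P (q', v')) hz2.1 (hz1.trans_le (min_le_left _ _))
  have e1 : S.L (q, v) = ⟪S.P (q, v), v⟫ - S.H (q, S.P (q, v)) := rfl
  have e2 : S.L (q', v') = ⟪S.P (q', v'), v'⟫ - S.H (q', S.P (q', v')) := rfl
  have e3 : |⟪S.P (q', v') - S.P (q, v), v' - v⟫| ≤ ε / 2 * D :=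
    (abs_real_inner_le_norm _ _).trans (mul_le_mul (hz1.le.trans (min_le_right _ _)) hvn
      (norm_nonneg _) (by positivity))
  have e4 : ε / 2 * ‖q' - q‖ ≤ ε / 2 * D := by gcongr
  rw [Real.norm_eq_abs]
  simp only [add_apply, ContinuousLinearMap.comp_apply,
    neg_apply, innerSL_apply_apply, ContinuousLinearMap.coe_fst',
    ContinuousLinearMap.coe_snd', Prod.fst_sub, Prod.snd_sub]
  rw [inner_sub_left, inner_sub_right, inner_sub_right] at e3
  rw [inner_sub_right (S.P (q, v))]
  rw [abs_le] at e3 m1 m2 ⊢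
  constructor <;> nlinarith [norm_nonneg (q' - q)]

theorem L_le (q v : Eu n) : S.L (q, v) ≤ (S.C + (1 + S.C) / S.c) * (1 + ‖v‖ ^ 2) := by
  have h1 := real_inner_le_norm (S.P (q, v)) v
  have h2 := S.low q (S.P (q, v))
  have h3 := S.P_le q v
  have hc := S.c_pos
  have hC := S.C_pos
  have h4 : ‖S.P (q, v)‖ ≤ (‖v‖ + S.C) / S.c := by rw [le_div_iff₀ hc]; linarith
  have h5 : ‖S.P (q, v)‖ * ‖v‖ ≤ (‖v‖ + S.C) / S.c * ‖v‖ := by gcongr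
  have h6 : (‖v‖ + S.C) / S.c * ‖v‖ ≤ (1 + S.C) / S.c * (1 + ‖v‖ ^ 2) := by
    rw [div_mul_eq_mul_div, div_mul_eq_mul_div]
    refine div_le_div_of_nonneg_right ?_ hc.le
    nlinarith [mul_nonneg hC.le (sq_nonneg (‖v‖ - 1)), mul_nonneg hC.le (sq_nonneg ‖v‖)]
  have : S.L (q, v) = ⟪S.P (q, v), v⟫ - S.H (q, S.P (q, v)) := rfl
  nlinarith [sq_nonneg ‖v‖, sq_nonneg ‖S.P (q, v)‖]

theorem L_low (q v : Eu n) : (1 / (4 * S.C)) * ‖v‖ ^ 2 - S.C ≤ S.L (q, v) := by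
  have h := S.L_ge q v ((1 / (2 * S.C)) • v)
  have h2 := S.up q ((1 / (2 * S.C)) • v)
  have hC := S.C_pos
  rw [real_inner_smul_left, real_inner_self_eq_norm_sq] at h
  rw [norm_smul, Real.norm_eq_abs, abs_of_pos (by positivity), mul_pow] at h2
  have e : S.C * (1 + (1 / (2 * S.C)) ^ 2 * ‖v‖ ^ 2) = S.C + 1 / (4 * S.C) * ‖v‖ ^ 2 := by
    field_simp; ring
  have e2 : 1 / (2 * S.C) * ‖v‖ ^ 2 = 2 * (1 / (4 * S.C) * ‖v‖ ^ 2) := by field_simp; ring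
  linarith

/-- energy as function of velocity -/
noncomputable def En (z : Eu n × Eu n) : ℝ := S.H (z.1, S.P z)

theorem En_low (q v : Eu n) : S.c / (2 * S.C ^ 2) * ‖v‖ ^ 2 - (S.c + S.C) ≤ S.En (q, v) := by
  have h2 := S.low q (S.P (q, v))
  have h3 := S.le_P q v
  have hc := S.c_pos
  have hC := S.C_pos
  have h4 : ‖v‖ ^ 2 ≤ S.C ^ 2 * (2 + 2 * ‖S.P (q, v)‖ ^ 2) := by
    have : ‖v‖ ^ 2 ≤ (S.C * (1 + ‖S.P (q, v)‖)) ^ 2 := by gcongr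
    nlinarith [sq_nonneg (1 - ‖S.P (q, v)‖), sq_nonneg S.C,
      mul_nonneg (sq_nonneg S.C) (sq_nonneg (1 - ‖S.P (q, v)‖))]
  have h5 : S.c / (2 * S.C ^ 2) * ‖v‖ ^ 2 ≤ S.c / (2 * S.C ^ 2) * (S.C ^ 2 * (2 + 2 * ‖S.P (q, v)‖ ^ 2)) := by
    gcongr
  have h6 : S.c / (2 * S.C ^ 2) * (S.C ^ 2 * (2 + 2 * ‖S.P (q, v)‖ ^ 2)) = S.c + S.c * ‖S.P (q, v)‖ ^ 2 := by
    field_simp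
  simp only [En]
  linarith

end Ham
end Torb

namespace Torb
open MeasureTheory Set Metric Filter Topology
open scoped RealInnerProductSpace ContDiff

theorem lat_apply {n : ℕ} (m : Fin n → ℤ) (i : Fin n) : (lat m : Eu n) i = m i := by
  simp [lat]

theorem lat_reduce (n : ℕ) : ∃ ρ : ℝ, 0 < ρ ∧ ∀ q : Eu n, ∃ m : Fin n → ℤ, ‖q + lat m‖ ≤ ρ := by
  refine ⟨Real.sqrt n + 1, by positivity, fun q => ⟨fun i => -⌊q i⌋, ?_⟩⟩
  rw [EuclideanSpace.norm_eq]
  refine le_trans (Real.sqrt_le_sqrt (y := (n : ℝ)) ?_) (by linarith)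
  calc ∑ i, ‖(q + lat fun i => -⌊q i⌋) i‖ ^ 2 ≤ ∑ i : Fin n, (1 : ℝ) := by
        refine Finset.sum_le_sum fun i _ => ?_
        rw [PiLp.add_apply, lat_apply, Real.norm_eq_abs, sq_abs]
        push_cast
        have h1 := Int.floor_le (q i)
        have h2 := Int.lt_floor_add_one (q i)
        nlinarith
    _ = n := by simp

theorem bdd_of_per {n : ℕ} {F : Type*} [NormedAddCommGroup F] (f : Eu n × Eu n → F) (hf : Continuous f)
    (hper : ∀ m q p, f (q + lat m, p) = f (q, p)) (ρ : ℝ) :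
    ∃ C, 0 < C ∧ ∀ q p, ‖p‖ ≤ ρ → ‖f (q, p)‖ ≤ C := by
  obtain ⟨r, hr, hred⟩ := lat_reduce n
  obtain ⟨C, hC⟩ := ((isCompact_closedBall (0 : Eu n) r).prod
    (isCompact_closedBall (0 : Eu n) ρ)).exists_bound_of_continuousOn hf.continuousOn
  refine ⟨|C| + 1, by positivity, fun q p hp => ?_⟩
  obtain ⟨m, hm⟩ := hred q
  rw [← hper m q p]
  exact (hC (q + lat m, p) ⟨by simpa using hm, by simpa using hp⟩).trans
    ((le_abs_self C).trans (by linarith))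

theorem bdd_of_supp {n : ℕ} {F : Type*} [NormedAddCommGroup F] (f : Eu n × Eu n → F) (hf : Continuous f)
    (hper : ∀ m q p, f (q + lat m, p) = f (q, p)) (ρ : ℝ) (hs : ∀ q p, ρ < ‖p‖ → f (q, p) = 0) :
    ∃ C, 0 < C ∧ ∀ q p, ‖f (q, p)‖ ≤ C := by
  obtain ⟨C, hC0, hC⟩ := bdd_of_per f hf hper ρ
  refine ⟨C, hC0, fun q p => ?_⟩
  rcases le_or_gt ‖p‖ ρ with h | h
  · exact hC q p h
  · rw [hs q p h, norm_zero]; exact hC0.le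

theorem per_fderiv {n : ℕ} {F : Type*} [NormedAddCommGroup F] [NormedSpace ℝ F] (f : Eu n × Eu n → F)
    (hper : ∀ m q p, f (q + lat m, p) = f (q, p)) (m q p) :
    fderiv ℝ f (q + lat m, p) = fderiv ℝ f (q, p) := by
  have h : (fun z => f (z + ((lat m, 0) : Eu n × Eu n))) = f := by
    funext z
    have : z + ((lat m, 0) : Eu n × Eu n) = (z.1 + lat m, z.2) := by ext <;> simp
    rw [this, hper]
  have h2 := fderiv_comp_add_right (𝕜 := ℝ) (f := f) (x := ((q, p) : Eu n × Eu n)) ((lat m, 0) : Eu n × Eu n)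
  rw [h] at h2
  rw [h2]
  congr 1
  simp

theorem supp_fderiv {n : ℕ} {F : Type*} [NormedAddCommGroup F] [NormedSpace ℝ F] (f : Eu n × Eu n → F)
    (ρ : ℝ) (hs : ∀ q p, ρ < ‖p‖ → f (q, p) = 0) (q p) (hp : ρ < ‖p‖) : fderiv ℝ f (q, p) = 0 := by
  have : f =ᶠ[𝓝 (q, p)] fun _ => 0 := by
    have ho : IsOpen {z : Eu n × Eu n | ρ < ‖z.2‖} := isOpen_lt continuous_const (by fun_prop)
    filter_upwards [ho.mem_nhds hp] with z hz
    exact hs z.1 z.2 hz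
  rw [this.fderiv_eq]; simp

/-- slices: second derivative -/
theorem slice_second {n : ℕ} (H : Eu n × Eu n → ℝ) (hH : ContDiff ℝ ∞ H) (q p v : Eu n) :
    iteratedFDeriv ℝ 2 (fun p' => H (q, p')) p ![v, v] =
      fderiv ℝ (fderiv ℝ H) (q, p) (0, v) (0, v) := by
  have hd : Differentiable ℝ H := hH.differentiable (by simp)
  have hd2 : Differentiable ℝ (fderiv ℝ H) :=
    (hH.fderiv_right (m := 1) (by norm_cast)).differentiable (by simp)
  have hin : ∀ p', HasFDerivAt (fun p' : Eu n => ((q, p') : Eu n × Eu n)) (ContinuousLinearMap.inr ℝ (Eu n) (Eu n)) p' :=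
    fun p' => hasFDerivAt_prodMk_right q p'
  have h1 : fderiv ℝ (fun p' => H (q, p')) = fun p' => (fderiv ℝ H (q, p')).comp (ContinuousLinearMap.inr ℝ (Eu n) (Eu n)) := by
    funext p'
    exact ((hd (q, p')).hasFDerivAt.comp p' (hin p')).fderiv
  rw [iteratedFDeriv_two_apply, h1]
  have h2 : HasFDerivAt (fun p' => (fderiv ℝ H (q, p')).comp (ContinuousLinearMap.inr ℝ (Eu n) (Eu n)))
      _ p := (((hd2 (q, p)).hasFDerivAt.comp p (hin p)).clm_comp (hasFDerivAt_const (ContinuousLinearMap.inr ℝ (Eu n) (Eu n)) p))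
  rw [h2.fderiv]
  simp

/-- uniform convexity on compact sets -/
theorem unif_convex {n : ℕ} (H : Eu n × Eu n → ℝ) (hH : ContDiff ℝ ∞ H)
    (hper : ∀ m q p, H (q + lat m, p) = H (q, p))
    (hconv : ∀ q p v : Eu n, v ≠ 0 → 0 < fderiv ℝ (fderiv ℝ H) (q, p) (0, v) (0, v)) (ρ : ℝ) :
    ∃ c, 0 < c ∧ ∀ q p v : Eu n, ‖p‖ ≤ ρ → c * ‖v‖ ^ 2 ≤ fderiv ℝ (fderiv ℝ H) (q, p) (0, v) (0, v) := by
  have hc2 : Continuous (fderiv ℝ (fderiv ℝ H)) :=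
    (hH.fderiv_right (m := 1) (by norm_cast)).continuous_fderiv (by simp)
  obtain ⟨r, hr, hred⟩ := lat_reduce n
  let K : Set ((Eu n × Eu n) × Eu n) := (closedBall 0 r ×ˢ closedBall 0 ρ) ×ˢ sphere 0 1
  have hK : IsCompact K := ((isCompact_closedBall _ _).prod (isCompact_closedBall _ _)).prod (isCompact_sphere _ _)
  let f : (Eu n × Eu n) × Eu n → ℝ := fun z => fderiv ℝ (fderiv ℝ H) z.1 (0, z.2) (0, z.2)
  have hf : Continuous f := by
    have h0 : Continuous fun z : (Eu n × Eu n) × Eu n => ((0, z.2) : Eu n × Eu n) := by fun_prop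
    exact ((hc2.comp continuous_fst).clm_apply h0).clm_apply h0
  obtain ⟨c, hc, hcK⟩ : ∃ c, 0 < c ∧ ∀ z ∈ K, c ≤ f z := by
    rcases K.eq_empty_or_nonempty with h | h
    · exact ⟨1, one_pos, by simp [h]⟩
    · obtain ⟨z, hz, hmin⟩ := hK.exists_isMinOn h hf.continuousOn
      refine ⟨f z, hconv z.1.1 z.1.2 z.2 ?_, fun w hw => hmin hw⟩
      have : ‖z.2‖ = 1 := by simpa using hz.2
      intro h0; rw [h0] at this; simp at this
  refine ⟨c, hc, fun q p v hp => ?_⟩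
  rcases eq_or_ne v 0 with rfl | hv
  · have : ((0 : Eu n), (0 : Eu n)) = 0 := rfl
    simp [this]
  have hv0 : ‖v‖ ≠ 0 := norm_ne_zero_iff.2 hv
  obtain ⟨m, hm⟩ := hred q
  have h := hcK ((q + lat m, p), ‖v‖⁻¹ • v) ⟨⟨by simpa using hm, by simpa using hp⟩, by
    simp [norm_smul, hv0]⟩
  simp only [f] at h
  rw [per_fderiv _ (fun m q p => per_fderiv H hper m q p)] at h
  have e : ((0, ‖v‖⁻¹ • v) : Eu n × Eu n) = ‖v‖⁻¹ • ((0, v) : Eu n × Eu n) := by simp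
  rw [e] at h
  simp only [map_smul, smul_apply, smul_eq_mul] at h
  have h3 : ‖v‖⁻¹ * (‖v‖⁻¹ * fderiv ℝ (fderiv ℝ H) (q, p) (0, v) (0, v)) = 
    fderiv ℝ (fderiv ℝ H) (q, p) (0, v) (0, v) / ‖v‖ ^ 2 := by field_simp
  rw [h3, le_div_iff₀ (by positivity)] at h
  exact h

end Torb

namespace Torb
open MeasureTheory Set Metric Filter Topology
open scoped RealInnerProductSpace ContDiff

/-- convex cut-off profile -/
theorem exists_profile (R : ℝ) (hR : 0 < R) : ∃ (h η η' : ℝ → ℝ), (∀ s, HasDerivAt h (η s) s) ∧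
    (∀ s, HasDerivAt η (η' s) s) ∧ Continuous η ∧ (∀ s, 0 ≤ η s) ∧ (∀ s, η s ≤ 1) ∧ (∀ s, 0 ≤ η' s) ∧
    (∀ s, 2 * R ^ 2 ≤ s → η s = 1) ∧ (∀ s, s ≤ R ^ 2 → h s = 0) ∧ (∀ s, 0 ≤ h s) ∧
    (∀ s, 0 ≤ s → h s ≤ s) ∧ (∀ s, s - 2 * R ^ 2 ≤ h s) := by
  let η : ℝ → ℝ := fun s => Real.smoothTransition ((s - R ^ 2) / R ^ 2)
  have hR2 : 0 < R ^ 2 := by positivity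
  have hηs : ContDiff ℝ 1 η := Real.smoothTransition.contDiff.comp (by fun_prop)
  have hηc : Continuous η := hηs.continuous
  have hηm : Monotone η := Real.smoothTransition.monotone.comp (fun a b hab => by
    gcongr)
  let h : ℝ → ℝ := fun s => ∫ u in (R ^ 2)..s, η u
  have hd : ∀ s, HasDerivAt h (η s) s := fun s =>
    intervalIntegral.integral_hasDerivAt_right (hηc.intervalIntegrable _ _)
      (hηc.stronglyMeasurableAtFilter _ _) hηc.continuousAt
  have hη0 : ∀ s, 0 ≤ η s := fun s => Real.smoothTransition.nonneg _
  have hη1 : ∀ s, η s ≤ 1 := fun s => Real.smoothTransition.le_one _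
  have hηz : ∀ s, s ≤ R ^ 2 → η s = 0 := fun s hs =>
    Real.smoothTransition.zero_of_nonpos (div_nonpos_of_nonpos_of_nonneg (by linarith) hR2.le)
  have hηo : ∀ s, 2 * R ^ 2 ≤ s → η s = 1 := fun s hs =>
    Real.smoothTransition.one_of_one_le (by rw [le_div_iff₀ hR2]; linarith)
  have hhz : ∀ s, s ≤ R ^ 2 → h s = 0 := fun s hs => by
    simp only [h]
    rw [intervalIntegral.integral_congr (g := fun _ => 0)]
    · simp
    · intro u hu
      rw [uIcc_of_ge hs] at hu
      exact hηz u hu.2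
  have hmono : Monotone h := monotone_of_hasDerivAt_nonneg hd hη0
  have hh0 : ∀ s, 0 ≤ h s := fun s => by
    rcases le_total s (R ^ 2) with h1 | h1
    · rw [hhz s h1]
    · rw [← hhz _ le_rfl]; exact hmono h1
  refine ⟨h, η, deriv η, hd, fun s => (hηs.differentiable (by simp) s).hasDerivAt, hηc, hη0, hη1,
    fun s => hηm.deriv_nonneg, hηo, hhz, hh0, ?_, ?_⟩
  · have hm2 : Monotone fun s => s - h s := monotone_of_hasDerivAt_nonneg
      (fun s => (hasDerivAt_id s).sub (hd s)) (fun s => by simpa using hη1 s)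
    intro s hs
    have := hm2 hs
    simp only [hhz 0 hR2.le] at this
    linarith
  · have hm2 : Monotone fun s => s - h s := monotone_of_hasDerivAt_nonneg
      (fun s => (hasDerivAt_id s).sub (hd s)) (fun s => by simpa using hη1 s)
    intro s
    rcases le_total s (2 * R ^ 2) with h1 | h1
    · linarith [hh0 s]
    · have hconst : ∀ u ∈ Ici (2 * R ^ 2), u - h u = 2 * R ^ 2 - h (2 * R ^ 2) := by
        intro u hu
        refine (convex_Ici (2 * R ^ 2)).is_const_of_fderivWithin_eq_zero (𝕜 := ℝ) (f := fun u => u - h u)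
          (fun u _ => ((hasDerivAt_id u).sub (hd u)).differentiableAt.differentiableWithinAt) ?_ hu self_mem_Ici
        intro u hu
        have hz : HasDerivAt (fun u => u - h u) 0 u :=
          ((hasDerivAt_id u).sub (hd u)).congr_deriv (by simp [hηo u hu])
        have := hz.hasFDerivAt.hasFDerivWithinAt (s := Ici (2 * R ^ 2))
        rw [this.fderivWithin (uniqueDiffOn_Ici _ u hu)]
        ext; simp
      have := hconst s h1
      linarith [hh0 (2 * R ^ 2)]

set_option maxHeartbeats 2000000 in
theorem modify {n : ℕ} (H : Eu n × Eu n → ℝ) (hH : ContDiff ℝ ∞ H)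
    (hper : ∀ m q p, H (q + lat m, p) = H (q, p))
    (hconv : ∀ q p v : Eu n, v ≠ 0 → 0 < fderiv ℝ (fderiv ℝ H) (q, p) (0, v) (0, v))
    (hsup : ∀ A : ℝ, 0 < A → ∃ C : ℝ, ∀ q p, A * ‖p‖ - C ≤ H (q, p)) (b : ℝ) :
    ∃ (S : Ham n) (R : ℝ), 0 < R ∧ (∀ q p, ‖p‖ < R → S.H (q, p) = H (q, p)) ∧
      (∀ q p, S.H (q, p) ≤ b → ‖p‖ < R) ∧ (∀ q p, H (q, p) ≤ b → ‖p‖ < R) := by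
  obtain ⟨C1, hC1⟩ := hsup 1 one_pos
  let R : ℝ := |b + C1| + 1
  have hR : 0 < R := by positivity
  have hbig : ∀ q p, R ≤ ‖p‖ → b < H (q, p) := fun q p hp => by
    have := hC1 q p
    have h2 := le_abs_self (b + C1)
    simp only [R] at hp
    linarith
  let χ : ContDiffBump (0 : Eu n) := ⟨2 * R, 3 * R, by linarith, by linarith⟩
  obtain ⟨h, η, η', hh, hη, hηc, hη0, hη1, hη', hηo, hhz, hh0, hhle, hhge⟩ := exists_profile R hR
  let G : Eu n × Eu n → ℝ := fun z => χ z.2 * H z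
  have hG : ContDiff ℝ ∞ G := (χ.contDiff.comp contDiff_snd).mul hH
  have hGper : ∀ m q p, G (q + lat m, p) = G (q, p) := fun m q p => by simp only [G, hper]
  have hGs : ∀ q p, 3 * R < ‖p‖ → G (q, p) = 0 := fun q p hp => by
    simp only [G]; rw [χ.zero_of_le_dist (by simpa [χ] using hp.le), zero_mul]
  have hd1 : Differentiable ℝ G := hG.differentiable (by simp)
  have hG1 : ContDiff ℝ 1 (fderiv ℝ G) := hG.fderiv_right (m := 1) (by norm_cast)
  have hc1 : Continuous (fderiv ℝ G) := hG1.continuous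
  have hd2 : Differentiable ℝ (fderiv ℝ G) := hG1.differentiable (by simp)
  have hc2 : Continuous (fderiv ℝ (fderiv ℝ G)) := hG1.continuous_fderiv (by simp)
  have hp1 := per_fderiv G hGper
  have hp2 := per_fderiv _ hp1
  have hs1 := supp_fderiv G (3 * R) hGs
  have hs2 := supp_fderiv _ (3 * R) hs1
  obtain ⟨K0, hK0, hGK0⟩ := bdd_of_supp G hG.continuous hGper _ hGs
  obtain ⟨K1, hK1, hGK1⟩ := bdd_of_supp _ hc1 hp1 _ hs1
  obtain ⟨K2, hK2, hGK2⟩ := bdd_of_supp _ hc2 hp2 _ hs2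
  obtain ⟨c0, hc0, hconv0⟩ := unif_convex H hH hper hconv (2 * R)
  let A : ℝ := K2 + 1 + (2 * |b| + 1) / R ^ 2
  have hA1 : 0 < A := by positivity
  have hA2 : 2 * |b| + 1 ≤ A * R ^ 2 := by
    have : (2 * |b| + 1) = (2 * |b| + 1) / R ^ 2 * R ^ 2 := by field_simp
    simp only [A]; nlinarith [sq_nonneg R]
  have hA3 : K2 + 1 ≤ A := by
    have : 0 ≤ (2 * |b| + 1) / R ^ 2 := by positivity
    simp only [A]; linarith
  have hloc : ∀ q p, ‖p‖ < 2 * R → fderiv ℝ (fderiv ℝ G) (q, p) = fderiv ℝ (fderiv ℝ H) (q, p) := by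
    intro q p hp
    have : G =ᶠ[𝓝 (q, p)] H := by
      have ho : IsOpen {z : Eu n × Eu n | ‖z.2‖ < 2 * R} := isOpen_lt (by fun_prop) continuous_const
      filter_upwards [ho.mem_nhds hp] with z hz
      simp only [G]
      rw [χ.one_of_mem_closedBall (by simpa [χ] using (show ‖z.2‖ < 2 * R from hz).le), one_mul]
    exact this.fderiv.fderiv_eq
  let inl := ContinuousLinearMap.inl ℝ (Eu n) (Eu n)
  let inr := ContinuousLinearMap.inr ℝ (Eu n) (Eu n)
  let Dq : Eu n × Eu n → Eu n := fun z => (InnerProductSpace.toDual ℝ (Eu n)).symm ((fderiv ℝ G z).comp inl)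
  let Dp : Eu n × Eu n → Eu n := fun z => (InnerProductSpace.toDual ℝ (Eu n)).symm ((fderiv ℝ G z).comp inr)
  have hDq : ∀ z w, ⟪Dq z, w⟫ = fderiv ℝ G z (w, 0) := fun z w => by
    simp [Dq, inl]
  have hDp : ∀ z w, ⟪Dp z, w⟫ = fderiv ℝ G z (0, w) := fun z w => by
    simp [Dp, inr]
  have hpartial : ∀ z, ‖Dq z‖ ≤ ‖fderiv ℝ G z‖ ∧ ‖Dp z‖ ≤ ‖fderiv ℝ G z‖ := by
    intro z
    constructor
    · simp only [Dq, LinearIsometryEquiv.norm_map]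
      refine (ContinuousLinearMap.opNorm_comp_le _ _).trans ?_
      exact mul_le_of_le_one_right (norm_nonneg _) (ContinuousLinearMap.norm_inl_le_one ℝ _ _)
    · simp only [Dp, LinearIsometryEquiv.norm_map]
      refine (ContinuousLinearMap.opNorm_comp_le _ _).trans ?_
      exact mul_le_of_le_one_right (norm_nonneg _) (ContinuousLinearMap.norm_inr_le_one ℝ _ _)
  let c : ℝ := min c0 1
  have hc : 0 < c := lt_min hc0 one_pos
  let C : ℝ := K0 + K1 + 2 * A + A * (2 * R ^ 2)
  have hC : 0 < C := by positivity
  have hAR : 0 ≤ A * (2 * R ^ 2) := by positivity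
  let S : Ham n :=
    { H := fun z => G z + A * h (‖z.2‖ ^ 2)
      Hq := Dq
      Hp := fun z => Dp z + (2 * A * η (‖z.2‖ ^ 2)) • z.2
      hd := by
        intro q p
        have h1 : HasFDerivAt G (fderiv ℝ G (q, p)) (q, p) := (hd1 _).hasFDerivAt
        have h2 : HasFDerivAt (fun z : Eu n × Eu n => ‖z.2‖ ^ 2) _ (q, p) :=
          (hasFDerivAt_snd (𝕜 := ℝ) (E := Eu n) (F := Eu n) (p := (q, p))).norm_sq
        have h3 := ((hh (‖p‖ ^ 2)).comp_hasFDerivAt (q, p) h2).const_mul A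
        refine (h1.add h3).congr_fderiv ?_
        apply ContinuousLinearMap.ext
        rintro ⟨u, w⟩
        have e : fderiv ℝ G (q, p) (u, w) = ⟪Dq (q, p), u⟫ + ⟪Dp (q, p), w⟫ := by
          rw [hDq, hDp, ← map_add]; simp
        simp [e, inner_add_left, real_inner_smul_left]
        ring
      cq := by
        simp only [Dq]
        exact (LinearIsometryEquiv.continuous _).comp (hc1.clm_comp continuous_const)
      cp := by
        refine Continuous.add ?_ ?_
        · simp only [Dp]
          exact (LinearIsometryEquiv.continuous _).comp (hc1.clm_comp continuous_const)
        · fun_prop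
      perH := fun m q p => by simp only [hGper]
      perHq := fun m q p => by simp only [Dq, hp1]
      perHp := fun m q p => by simp only [Dp, hp1]
      c := c
      C := C
      c_pos := hc
      C_pos := hC
      mono := by
        intro q p p'
        set w := p - p' with hw
        let y : ℝ → Eu n := fun t => p' + t • w
        have hy : ∀ t, HasDerivAt y w t := fun t => by
          simpa [y] using ((hasDerivAt_id t).smul_const w).const_add p'
        have hyp : ∀ t, HasDerivAt (fun t => ((q, y t) : Eu n × Eu n)) (0, w) t := fun t =>
          (hasDerivAt_const t q).prodMk (hy t)
        have hin : ∀ t, HasDerivAt (fun t => ⟪y t, w⟫) (‖w‖ ^ 2) t := fun t => by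
          have := (hy t).inner ℝ (hasDerivAt_const t w)
          refine this.congr_deriv ?_
          simp
        have hsq : ∀ t, HasDerivAt (fun t => ‖y t‖ ^ 2) (2 * ⟪y t, w⟫) t := fun t => (hy t).norm_sq
        have hφ : ∀ t, HasDerivAt (fun t => fderiv ℝ G (q, y t) (0, w) +
            2 * A * (η (‖y t‖ ^ 2) * ⟪y t, w⟫) - t * (c * ‖w‖ ^ 2))
            (fderiv ℝ (fderiv ℝ G) (q, y t) (0, w) (0, w) + 2 * A * (η' (‖y t‖ ^ 2) * (2 * ⟪y t, w⟫) * ⟪y t, w⟫ +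
              η (‖y t‖ ^ 2) * ‖w‖ ^ 2) - 1 * (c * ‖w‖ ^ 2)) t := by
          intro t
          refine HasDerivAt.sub (HasDerivAt.add ?_ ?_) ((hasDerivAt_id t).mul_const _)
          · have := ((hd2 (q, y t)).hasFDerivAt.comp_hasDerivAt t (hyp t)).clm_apply
              (hasDerivAt_const t ((0, w) : Eu n × Eu n))
            exact this.congr_deriv (by simp)
          · exact ((((hη (‖y t‖ ^ 2)).comp t (hsq t)).mul (hin t)).const_mul (2 * A))
        have hmono := monotone_of_hasDerivAt_nonneg hφ (by
          intro t
          simp only [Pi.zero_apply]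
          have h1 : 0 ≤ η' (‖y t‖ ^ 2) * (2 * ⟪y t, w⟫) * ⟪y t, w⟫ := by
            have := mul_nonneg (hη' (‖y t‖ ^ 2)) (sq_nonneg ⟪y t, w⟫)
            nlinarith
          have h2 : 0 ≤ η (‖y t‖ ^ 2) * ‖w‖ ^ 2 := mul_nonneg (hη0 _) (sq_nonneg _)
          rcases lt_or_ge ‖y t‖ (2 * R) with hlt | hge
          · rw [hloc _ _ hlt]
            have h3 := hconv0 q (y t) w hlt.le
            have h4 : c * ‖w‖ ^ 2 ≤ c0 * ‖w‖ ^ 2 := by gcongr; exact min_le_left _ _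
            have h5 : 0 ≤ 2 * A * (η' (‖y t‖ ^ 2) * (2 * ⟪y t, w⟫) * ⟪y t, w⟫ +
              η (‖y t‖ ^ 2) * ‖w‖ ^ 2) := by positivity
            linarith
          · have h3 : η (‖y t‖ ^ 2) = 1 := hηo _ (by nlinarith)
            rw [h3] at h2 ⊢
            have h4 : |fderiv ℝ (fderiv ℝ G) (q, y t) (0, w) (0, w)| ≤ K2 * ‖w‖ ^ 2 := by
              have := ContinuousLinearMap.le_opNorm₂ (fderiv ℝ (fderiv ℝ G) (q, y t)) (0, w) (0, w)
              have hn : ‖((0, w) : Eu n × Eu n)‖ = ‖w‖ := by simp [Prod.norm_def]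
              rw [hn, Real.norm_eq_abs] at this
              refine this.trans ?_
              have := hGK2 q (y t)
              nlinarith [mul_nonneg (norm_nonneg w) (norm_nonneg w)]
            have h5 : c * ‖w‖ ^ 2 ≤ 1 * ‖w‖ ^ 2 := by gcongr; exact min_le_right _ _
            have h6 := (abs_le.1 h4).1
            have h7 : 0 ≤ 2 * A * (η' (‖y t‖ ^ 2) * (2 * ⟪y t, w⟫) * ⟪y t, w⟫) := by positivity
            have h8 := mul_le_mul_of_nonneg_right hA3 (sq_nonneg ‖w‖)
            nlinarith [sq_nonneg ‖w‖])
        have := hmono (zero_le_one (α := ℝ))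
        have y0 : y 0 = p' := by simp [y]
        have y1 : y 1 = p := by simp [y, w]
        simp only [y0, y1] at this
        rw [inner_sub_left, inner_add_left, inner_add_left, hDp, hDp, real_inner_smul_left,
          real_inner_smul_left]
        linarith
      Hq_le := fun q p => by
        refine (hpartial (q, p)).1.trans ((hGK1 q p).trans ?_)
        simp only [C]; linarith
      Hp_le := fun q p => by
        refine (norm_add_le _ _).trans ?_
        have h1 := (hpartial (q, p)).2.trans (hGK1 q p)
        rw [norm_smul, Real.norm_eq_abs, abs_of_nonneg (by have := hη0 (‖p‖ ^ 2); positivity)]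
        have h2 : 2 * A * η (‖p‖ ^ 2) * ‖p‖ ≤ 2 * A * ‖p‖ := by
          have := mul_le_mul_of_nonneg_left (hη1 (‖p‖ ^ 2)) (by positivity : 0 ≤ 2 * A * ‖p‖)
          nlinarith
        have h3 : C * (1 + ‖p‖) = (K0 + K1 + 2 * A + A * (2 * R ^ 2)) + (K0 + K1 + A * (2 * R ^ 2)) * ‖p‖ + 2 * A * ‖p‖ := by
          simp only [C]; ring
        have h4 : 0 ≤ (K0 + K1 + A * (2 * R ^ 2)) * ‖p‖ := by positivity
        rw [h3]
        linarith
      low := fun q p => by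
        have h1 := (abs_le.1 (hGK0 q p)).1
        have h2 := mul_le_mul_of_nonneg_left (hhge (‖p‖ ^ 2)) hA1.le
        have h3 : c * ‖p‖ ^ 2 ≤ A * ‖p‖ ^ 2 := by
          gcongr; exact (min_le_right _ _).trans (by linarith)
        simp only [C]
        linarith
      up := fun q p => by
        have h1 := (abs_le.1 (hGK0 q p)).2
        have h2 := mul_le_mul_of_nonneg_left (hhle (‖p‖ ^ 2) (sq_nonneg _)) hA1.le
        have h3 : A * ‖p‖ ^ 2 ≤ C * ‖p‖ ^ 2 := by
          gcongr; simp only [C]; linarith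
        have h4 : K0 ≤ C := by simp only [C]; linarith
        linarith }
  have hlow : ∀ q p, ‖p‖ ≤ 2 * R → G (q, p) = H (q, p) := fun q p hp => by
    simp only [G]
    rw [χ.one_of_mem_closedBall (by simpa [χ] using hp), one_mul]
  refine ⟨S, R, hR, ?_, ?_, ?_⟩
  · intro q p hp
    change G (q, p) + A * h (‖p‖ ^ 2) = _
    rw [hlow q p (by linarith), hhz _ (by nlinarith [norm_nonneg p])]
    ring
  · intro q p hp
    by_contra hge
    push Not at hge
    change G (q, p) + A * h (‖p‖ ^ 2) ≤ b at hp
    have hb := hbig q p hge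
    rcases le_or_gt ‖p‖ (2 * R) with h1 | h1
    · rw [hlow q p h1] at hp
      have := mul_nonneg hA1.le (hh0 (‖p‖ ^ 2))
      linarith
    · have h2 := hhge (‖p‖ ^ 2)
      have h3 : R ^ 2 ≤ h (‖p‖ ^ 2) := by nlinarith
      have h4 := mul_le_mul_of_nonneg_left h3 hA1.le
      have h5 : -|b| ≤ G (q, p) := by
        simp only [G]
        have h6 : -|b| ≤ H (q, p) := (neg_abs_le b).trans hb.le
        have h7 : (0:ℝ) ≤ χ p := χ.nonneg
        have h8 : χ p ≤ 1 := χ.le_one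
        nlinarith [abs_nonneg b]
      linarith [le_abs_self b, abs_nonneg b]
  · intro q p hp
    by_contra hge
    push Not at hge
    linarith [hbig q p hge]

end Torb

namespace Torb
open MeasureTheory Set Metric Filter Topology
open scoped RealInnerProductSpace ContDiff

/-- Differentiation under the integral sign for jointly `C¹` functions. -/
theorem hasFDerivAt_param {V W : Type*} [NormedAddCommGroup V] [NormedSpace ℝ V] [FiniteDimensional ℝ V]
    [NormedAddCommGroup W] [NormedSpace ℝ W]
    (f : V × ℝ → W) (hf : ContDiff ℝ 1 f) (z : V) :
    HasFDerivAt (fun z => ∫ t in (0:ℝ)..1, f (z, t))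
      (∫ t in (0:ℝ)..1, (fderiv ℝ f (z, t)).comp (ContinuousLinearMap.inl ℝ V ℝ)) z := by
  have hc : Continuous f := hf.continuous
  have hcd : Continuous (fderiv ℝ f) := hf.continuous_fderiv (by simp)
  have hcd' : Continuous fun y : V × ℝ => (fderiv ℝ f y).comp (ContinuousLinearMap.inl ℝ V ℝ) :=
    hcd.clm_comp continuous_const
  obtain ⟨C, hC⟩ := ((isCompact_closedBall z 1).prod (isCompact_Icc (a := (0:ℝ)) (b := 1))).exists_bound_of_continuousOn
    hcd'.continuousOn
  refine intervalIntegral.hasFDerivAt_integral_of_dominated_of_fderiv_le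
    (F := fun z t => f (z, t)) (F' := fun z t => (fderiv ℝ f (z, t)).comp (ContinuousLinearMap.inl ℝ V ℝ))
    (bound := fun _ => C) (closedBall_mem_nhds z one_pos) ?_ ?_ ?_ ?_ ?_ ?_
  · exact Eventually.of_forall fun x => (by fun_prop : Continuous fun t => f (x, t)).aestronglyMeasurable
  · exact (by fun_prop : Continuous fun t => f (z, t)).intervalIntegrable _ _
  · exact (hcd'.comp (by fun_prop : Continuous fun t : ℝ => (z, t))).aestronglyMeasurable
  · refine ae_of_all _ fun t ht x hx => hC (x, t) ⟨hx, ?_⟩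
    rw [uIoc_of_le zero_le_one] at ht
    exact ⟨ht.1.le, ht.2⟩
  · exact continuous_const.intervalIntegrable _ _
  · refine ae_of_all _ fun t _ x _ => ?_
    exact ((hf.differentiable (by simp) (x, t)).hasFDerivAt).comp x (hasFDerivAt_prodMk_left x t)

theorem hasDerivAt_clm {V A W : Type*} [NormedAddCommGroup V] [NormedSpace ℝ V]
    [NormedAddCommGroup A] [NormedSpace ℝ A] [NormedAddCommGroup W] [NormedSpace ℝ W]
    {f : V → A →L[ℝ] W} {f' : V →L[ℝ] A →L[ℝ] W} {x : V} {l : ℝ → V} {l' : V} {a : ℝ → A} {a' : A} {t : ℝ}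
    (hf : HasFDerivAt f f' x) (hl : HasDerivAt l l' t) (hx : l t = x) (ha : HasDerivAt a a' t) :
    HasDerivAt (fun s => f (l s) (a s)) (f' l' (a t) + f x a') t := by
  subst hx
  exact (hf.comp_hasDerivAt t hl).clm_apply ha

theorem hasDerivAt_clm_const {V A W : Type*} [NormedAddCommGroup V] [NormedSpace ℝ V]
    [NormedAddCommGroup A] [NormedSpace ℝ A] [NormedAddCommGroup W] [NormedSpace ℝ W]
    {f : V → A →L[ℝ] W} {f' : V →L[ℝ] A →L[ℝ] W} {x : V} {l : ℝ → V} {l' : V} {t : ℝ}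
    (hf : HasFDerivAt f f' x) (hl : HasDerivAt l l' t) (hx : l t = x) (a : A) :
    HasDerivAt (fun s => f (l s) a) (f' l' a) t := by
  have := hasDerivAt_clm hf hl hx (hasDerivAt_const t a)
  simpa using this

structure Mag (n : ℕ) where
  B : Eu n → Eu n →L[ℝ] Eu n
  smooth : ContDiff ℝ 1 B
  per : ∀ m q, B (q + lat m) = B q
  skew : ∀ q u v, ⟪B q u, v⟫ = -⟪B q v, u⟫
  closed : ∀ q u v w, ⟪(fderiv ℝ B q u) v, w⟫ + ⟪(fderiv ℝ B q v) w, u⟫ + ⟪(fderiv ℝ B q w) u, v⟫ = 0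

namespace Mag
variable {n : ℕ} (S : Mag n)

theorem cB : Continuous S.B := S.smooth.continuous

theorem exists_K : ∃ K, 0 < K ∧ (∀ q, ‖S.B q‖ ≤ K) ∧ (∀ q q', ‖S.B q - S.B q'‖ ≤ K * ‖q - q'‖) := by
  have hcd : Continuous (fderiv ℝ S.B) := S.smooth.continuous_fderiv (by simp)
  have hper : ∀ m q, fderiv ℝ S.B (q + lat m) = fderiv ℝ S.B q := fun m q => by
    have h : (fun z => S.B (z + lat m)) = S.B := funext fun z => S.per m z
    rw [← fderiv_comp_add_right, h]
  obtain ⟨C1, h1, hC1⟩ := bdd_of_per (fun z : Eu n × Eu n => S.B z.1) (S.cB.comp continuous_fst)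
    (fun m q _ => S.per m q) 0
  obtain ⟨C2, h2, hC2⟩ := bdd_of_per (fun z : Eu n × Eu n => fderiv ℝ S.B z.1) (hcd.comp continuous_fst)
    (fun m q _ => hper m q) 0
  refine ⟨C1 + C2, by positivity, fun q => (hC1 q 0 (by simp)).trans (by linarith), fun q q' => ?_⟩
  have := convex_univ.norm_image_sub_le_of_norm_fderiv_le (𝕜 := ℝ) (f := S.B) (C := C2)
    (fun x _ => S.smooth.differentiable (by simp) x) (fun x _ => hC2 x 0 (by simp)) (mem_univ q') (mem_univ q)
  refine this.trans ?_
  gcongr; linarith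

noncomputable def K : ℝ := S.exists_K.choose
theorem K_pos : 0 < S.K := S.exists_K.choose_spec.1
theorem B_le (q) : ‖S.B q‖ ≤ S.K := S.exists_K.choose_spec.2.1 q
theorem B_lip (q q') : ‖S.B q - S.B q'‖ ≤ S.K * ‖q - q'‖ := S.exists_K.choose_spec.2.2 q q'

end Mag

/-- linear interpolation -/
noncomputable def ev (n : ℕ) (t : ℝ) : (Eu n × Eu n) →L[ℝ] Eu n :=
  ContinuousLinearMap.fst ℝ _ _ + t • (ContinuousLinearMap.snd ℝ _ _ - ContinuousLinearMap.fst ℝ _ _)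

theorem ev_apply {n : ℕ} (t : ℝ) (z : Eu n × Eu n) : ev n t z = z.1 + t • (z.2 - z.1) := by
  simp [ev]

namespace Mag
variable {n : ℕ} (S : Mag n)

/-- integrand of the edge form -/
noncomputable def g (y : (Eu n × Eu n) × ℝ) : (Eu n × Eu n) →L[ℝ] ℝ :=
  ((innerSL ℝ (y.1.2 - y.1.1)).comp (S.B (y.1.1 + y.2 • (y.1.2 - y.1.1)))).comp (ev n y.2)

theorem g_apply (z : Eu n × Eu n) (t : ℝ) (ζ : Eu n × Eu n) :
    S.g (z, t) ζ = ⟪z.2 - z.1, S.B (ev n t z) (ev n t ζ)⟫ := by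
  simp only [g, ContinuousLinearMap.comp_apply, innerSL_apply_apply, ev_apply]

theorem g_smooth : ContDiff ℝ 1 S.g := by
  have h1 : ContDiff ℝ 1 fun y : (Eu n × Eu n) × ℝ => innerSL ℝ (y.1.2 - y.1.1) :=
    (innerSL ℝ).contDiff.comp (by fun_prop)
  have h2 : ContDiff ℝ 1 fun y : (Eu n × Eu n) × ℝ => S.B (y.1.1 + y.2 • (y.1.2 - y.1.1)) :=
    S.smooth.comp (by fun_prop)
  have h3 : ContDiff ℝ 1 fun y : (Eu n × Eu n) × ℝ => ev n y.2 := by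
    unfold ev; fun_prop
  exact (h1.clm_comp h2).clm_comp h3

/-- the edge form -/
noncomputable def beta (z : Eu n × Eu n) : (Eu n × Eu n) →L[ℝ] ℝ := ∫ t in (0:ℝ)..1, S.g (z, t)

noncomputable def dbeta (z : Eu n × Eu n) : (Eu n × Eu n) →L[ℝ] (Eu n × Eu n) →L[ℝ] ℝ :=
  ∫ t in (0:ℝ)..1, (fderiv ℝ S.g (z, t)).comp (ContinuousLinearMap.inl ℝ _ ℝ)

theorem hasFDerivAt_beta (z : Eu n × Eu n) : HasFDerivAt S.beta (S.dbeta z) z :=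
  hasFDerivAt_param S.g S.g_smooth z

theorem beta_apply (z ζ : Eu n × Eu n) :
    S.beta z ζ = ∫ t in (0:ℝ)..1, ⟪z.2 - z.1, S.B (ev n t z) (ev n t ζ)⟫ := by
  have hc : Continuous fun t : ℝ => S.g (z, t) := S.g_smooth.continuous.comp (by fun_prop)
  rw [beta, ContinuousLinearMap.intervalIntegral_apply (hc.intervalIntegrable _ _)]
  simp only [g_apply]

theorem slice_deriv (z ζ ζ' : Eu n × Eu n) (t : ℝ) :
    fderiv ℝ S.g (z, t) (ζ', 0) ζ = ⟪ζ'.2 - ζ'.1, S.B (ev n t z) (ev n t ζ)⟫ +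
      ⟪z.2 - z.1, fderiv ℝ S.B (ev n t z) (ev n t ζ') (ev n t ζ)⟫ := by
  have h1 : HasDerivAt (fun s : ℝ => S.g (z + s • ζ', t) ζ) (fderiv ℝ S.g (z, t) (ζ', 0) ζ) 0 := by
    have hl : HasDerivAt (fun s : ℝ => ((z + s • ζ', t) : (Eu n × Eu n) × ℝ)) (ζ', 0) 0 := by
      refine HasDerivAt.prodMk ?_ (hasDerivAt_const _ _)
      simpa using ((hasDerivAt_id (0:ℝ)).smul_const ζ').const_add z
    exact hasDerivAt_clm_const ((S.g_smooth.differentiable (by simp)) (z, t)).hasFDerivAt hl (by simp) ζ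
  have h2 : HasDerivAt (fun s : ℝ => S.g (z + s • ζ', t) ζ) (⟪ζ'.2 - ζ'.1, S.B (ev n t z) (ev n t ζ)⟫ +
      ⟪z.2 - z.1, fderiv ℝ S.B (ev n t z) (ev n t ζ') (ev n t ζ)⟫) 0 := by
    have e : (fun s : ℝ => S.g (z + s • ζ', t) ζ) = fun s =>
        ⟪(z.2 - z.1) + s • (ζ'.2 - ζ'.1), S.B (ev n t z + s • ev n t ζ') (ev n t ζ)⟫ := by
      funext s
      rw [g_apply, map_add, map_smul]
      congr 1
      simp only [Prod.snd_add, Prod.fst_add, Prod.smul_snd, Prod.smul_fst]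
      module
    rw [e]
    have hl : HasDerivAt (fun s : ℝ => (z.2 - z.1) + s • (ζ'.2 - ζ'.1)) (ζ'.2 - ζ'.1) 0 := by
      simpa using ((hasDerivAt_id (0:ℝ)).smul_const (ζ'.2 - ζ'.1)).const_add (z.2 - z.1)
    have hl2 : HasDerivAt (fun s : ℝ => ev n t z + s • ev n t ζ') (ev n t ζ') 0 := by
      simpa using ((hasDerivAt_id (0:ℝ)).smul_const (ev n t ζ')).const_add (ev n t z)
    have h3 := hasDerivAt_clm_const ((S.smooth.differentiable (by simp)) (ev n t z)).hasFDerivAt hl2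
      (by simp) (ev n t ζ)
    exact (hl.inner ℝ h3).congr_deriv (by simp [add_comm])
  exact h1.unique h2

theorem dbeta_apply (z ζ ζ' : Eu n × Eu n) :
    S.dbeta z ζ' ζ = ∫ t in (0:ℝ)..1, fderiv ℝ S.g (z, t) (ζ', 0) ζ := by
  have hcd : Continuous (fderiv ℝ S.g) := S.g_smooth.continuous_fderiv (by simp)
  have hc : Continuous fun t : ℝ => (fderiv ℝ S.g (z, t)).comp (ContinuousLinearMap.inl ℝ _ ℝ) :=
    (hcd.comp (by fun_prop)).clm_comp continuous_const
  rw [dbeta, ContinuousLinearMap.intervalIntegral_apply (hc.intervalIntegrable _ _),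
    ContinuousLinearMap.intervalIntegral_apply]
  · simp
  · exact (hc.clm_apply continuous_const).intervalIntegrable _ _

theorem ev_hasDerivAt (ζ : Eu n × Eu n) (t : ℝ) : HasDerivAt (fun t => ev n t ζ) (ζ.2 - ζ.1) t := by
  simp only [ev_apply]
  simpa using ((hasDerivAt_id t).smul_const (ζ.2 - ζ.1)).const_add ζ.1

theorem sk (q u a b : Eu n) : ⟪fderiv ℝ S.B q u a, b⟫ = -⟪fderiv ℝ S.B q u b, a⟫ := by
  have hl : HasDerivAt (fun s : ℝ => q + s • u) u 0 := by
    simpa using ((hasDerivAt_id (0:ℝ)).smul_const u).const_add q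
  have hh : ∀ a b : Eu n, HasDerivAt (fun s : ℝ => ⟪S.B (q + s • u) a, b⟫) ⟪fderiv ℝ S.B q u a, b⟫ 0 := by
    intro a b
    have h3 := hasDerivAt_clm_const ((S.smooth.differentiable (by simp)) q).hasFDerivAt hl (by simp) a
    exact (h3.inner ℝ (hasDerivAt_const _ b)).congr_deriv (by simp)
  have h1 := hh a b
  have h2 := (hh b a).neg
  have : (fun s : ℝ => ⟪S.B (q + s • u) a, b⟫) = -(fun s : ℝ => ⟪S.B (q + s • u) b, a⟫) :=
    funext fun s => S.skew _ _ _
  rw [this] at h1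
  exact h1.unique h2

theorem dbeta_antisym (z ζ ζ' : Eu n × Eu n) :
    S.dbeta z ζ' ζ - S.dbeta z ζ ζ' = ⟪S.B z.1 ζ'.1, ζ.1⟫ - ⟪S.B z.2 ζ'.2, ζ.2⟫ := by
  have hcd : Continuous (fderiv ℝ S.g) := S.g_smooth.continuous_fderiv (by simp)
  have hc : ∀ ζ ζ' : Eu n × Eu n, Continuous fun t : ℝ => fderiv ℝ S.g (z, t) (ζ', 0) ζ := fun ζ ζ' =>
    ((hcd.comp (by fun_prop)).clm_apply continuous_const).clm_apply continuous_const
  rw [dbeta_apply, dbeta_apply, ← intervalIntegral.integral_sub ((hc _ _).intervalIntegrable _ _)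
    ((hc _ _).intervalIntegrable _ _)]
  have hder : ∀ t ∈ uIcc (0:ℝ) 1, HasDerivAt (fun t => -⟪S.B (ev n t z) (ev n t ζ'), ev n t ζ⟫)
      (fderiv ℝ S.g (z, t) (ζ', 0) ζ - fderiv ℝ S.g (z, t) (ζ, 0) ζ') t := by
    intro t _
    have hB : HasFDerivAt S.B (fderiv ℝ S.B (ev n t z)) (ev n t z) :=
      ((S.smooth.differentiable (by simp)) (ev n t z)).hasFDerivAt
    have h3 := hasDerivAt_clm hB (ev_hasDerivAt z t) rfl (ev_hasDerivAt ζ' t)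
    refine (h3.inner ℝ (ev_hasDerivAt ζ t)).neg.congr_deriv ?_
    rw [slice_deriv, slice_deriv]
    have e1 := S.closed (ev n t z) (ev n t ζ') (ev n t ζ) (z.2 - z.1)
    -- skewness of the derivative
    have e2 := S.sk (ev n t z) (ev n t ζ) (z.2 - z.1) (ev n t ζ')
    have e3 := S.skew (ev n t z) (ev n t ζ) (ζ'.2 - ζ'.1)
    simp only [inner_add_left] at *
    rw [real_inner_comm (S.B (ev n t z) (ev n t ζ)), real_inner_comm (S.B (ev n t z) (ev n t ζ')) (ζ.2 - ζ.1),
      real_inner_comm _ (z.2 - z.1), real_inner_comm _ (z.2 - z.1)]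
    linarith
  rw [intervalIntegral.integral_eq_sub_of_hasDerivAt hder
    (((hc _ _).sub (hc _ _)).intervalIntegrable _ _)]
  simp [ev_apply]; ring

theorem ev_norm_le (t : ℝ) (ht : t ∈ Icc (0:ℝ) 1) (ζ : Eu n × Eu n) : ‖ev n t ζ‖ ≤ ‖ζ‖ := by
  have : ev n t ζ = (1 - t) • ζ.1 + t • ζ.2 := by rw [ev_apply]; module
  rw [this]
  refine (norm_add_le _ _).trans ?_
  rw [norm_smul, norm_smul, Real.norm_eq_abs, Real.norm_eq_abs, abs_of_nonneg ht.1,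
    abs_of_nonneg (by linarith [ht.2])]
  have h1 := norm_fst_le ζ
  have h2 := norm_snd_le ζ
  nlinarith [ht.1, ht.2]

theorem beta_le (z ζ : Eu n × Eu n) : |S.beta z ζ| ≤ S.K * ‖z.2 - z.1‖ * ‖ζ‖ := by
  rw [beta_apply, ← Real.norm_eq_abs]
  have := intervalIntegral.norm_integral_le_of_norm_le_const (a := (0:ℝ)) (b := 1)
    (f := fun t => ⟪z.2 - z.1, S.B (ev n t z) (ev n t ζ)⟫) (C := S.K * ‖z.2 - z.1‖ * ‖ζ‖) (by
      intro t ht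
      rw [uIoc_of_le zero_le_one] at ht
      rw [Real.norm_eq_abs]
      refine (abs_real_inner_le_norm _ _).trans ?_
      have h1 := (S.B (ev n t z)).le_opNorm (ev n t ζ)
      have h2 := ev_norm_le t ⟨ht.1.le, ht.2⟩ ζ
      have h3 := S.B_le (ev n t z)
      have h4 : ‖S.B (ev n t z) (ev n t ζ)‖ ≤ S.K * ‖ζ‖ := h1.trans (by have := S.K_pos; gcongr)
      nlinarith [norm_nonneg (z.2 - z.1)])
  simpa using this

theorem beta_left (a b w : Eu n) :
    |S.beta (a, b) (w, 0) - (1 / 2) * ⟪b - a, S.B a w⟫| ≤ S.K * ‖b - a‖ ^ 2 * ‖w‖ := by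
  have hI : (1 / 2 : ℝ) * ⟪b - a, S.B a w⟫ = ∫ t in (0:ℝ)..1, (1 - t) * ⟪b - a, S.B a w⟫ := by
    rw [intervalIntegral.integral_mul_const, intervalIntegral.integral_sub (by simp) (by simp)]
    norm_num
  have hev : Continuous fun t : ℝ => ev n t (a, b) := by simp only [ev_apply]; fun_prop
  have hev2 : Continuous fun t : ℝ => ev n t (w, (0 : Eu n)) := by simp only [ev_apply]; fun_prop
  have hc : Continuous fun t : ℝ => ⟪b - a, S.B (ev n t (a, b)) (ev n t (w, 0))⟫ :=
    continuous_const.inner ((S.cB.comp hev).clm_apply hev2)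
  rw [beta_apply, hI, ← intervalIntegral.integral_sub (hc.intervalIntegrable _ _)
    ((by fun_prop : Continuous _).intervalIntegrable _ _), ← Real.norm_eq_abs]
  have := intervalIntegral.norm_integral_le_of_norm_le_const (a := (0:ℝ)) (b := 1)
    (f := fun t => ⟪b - a, S.B (ev n t (a, b)) (ev n t (w, 0))⟫ - (1 - t) * ⟪b - a, S.B a w⟫)
    (C := S.K * ‖b - a‖ ^ 2 * ‖w‖) (by
      intro t ht
      rw [uIoc_of_le zero_le_one] at ht
      have e1 : ev n t (w, (0 : Eu n)) = (1 - t) • w := by rw [ev_apply]; module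
      have e2 : ⟪b - a, S.B (ev n t (a, b)) (ev n t (w, 0))⟫ - (1 - t) * ⟪b - a, S.B a w⟫ =
          (1 - t) * ⟪b - a, (S.B (ev n t (a, b)) - S.B a) w⟫ := by
        rw [e1, map_smul, inner_smul_right, sub_apply, inner_sub_right]; ring
      rw [e2, norm_mul, Real.norm_eq_abs, abs_of_nonneg (by linarith [ht.2]), Real.norm_eq_abs]
      have h1 := abs_real_inner_le_norm (b - a) ((S.B (ev n t (a, b)) - S.B a) w)
      have h2 := (S.B (ev n t (a, b)) - S.B a).le_opNorm w
      have h3 := S.B_lip (ev n t (a, b)) a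
      have e3 : ev n t (a, b) - a = t • (b - a) := by rw [ev_apply]; simp
      rw [e3, norm_smul, Real.norm_eq_abs, abs_of_pos ht.1] at h3
      have h4 : S.K * (t * ‖b - a‖) ≤ S.K * (1 * ‖b - a‖) := by
        have := S.K_pos; gcongr; exact ht.2
      have h5 : ‖(S.B (ev n t (a, b)) - S.B a) w‖ ≤ S.K * ‖b - a‖ * ‖w‖ :=
        h2.trans (by have := S.K_pos; gcongr; linarith)
      have h6 : |⟪b - a, (S.B (ev n t (a, b)) - S.B a) w⟫| ≤ S.K * ‖b - a‖ ^ 2 * ‖w‖ := by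
        nlinarith [norm_nonneg (b - a)]
      nlinarith [abs_nonneg ⟪b - a, (S.B (ev n t (a, b)) - S.B a) w⟫, ht.1, ht.2])
  simpa using this

theorem beta_right (a b w : Eu n) :
    |S.beta (a, b) (0, w) - (1 / 2) * ⟪b - a, S.B b w⟫| ≤ S.K * ‖b - a‖ ^ 2 * ‖w‖ := by
  have hI : (1 / 2 : ℝ) * ⟪b - a, S.B b w⟫ = ∫ t in (0:ℝ)..1, t * ⟪b - a, S.B b w⟫ := by
    rw [intervalIntegral.integral_mul_const]
    norm_num
  have hev : Continuous fun t : ℝ => ev n t (a, b) := by simp only [ev_apply]; fun_prop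
  have hev2 : Continuous fun t : ℝ => ev n t ((0 : Eu n), w) := by simp only [ev_apply]; fun_prop
  have hc : Continuous fun t : ℝ => ⟪b - a, S.B (ev n t (a, b)) (ev n t (0, w))⟫ :=
    continuous_const.inner ((S.cB.comp hev).clm_apply hev2)
  rw [beta_apply, hI, ← intervalIntegral.integral_sub (hc.intervalIntegrable _ _)
    ((by fun_prop : Continuous _).intervalIntegrable _ _), ← Real.norm_eq_abs]
  have := intervalIntegral.norm_integral_le_of_norm_le_const (a := (0:ℝ)) (b := 1)
    (f := fun t => ⟪b - a, S.B (ev n t (a, b)) (ev n t (0, w))⟫ - t * ⟪b - a, S.B b w⟫)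
    (C := S.K * ‖b - a‖ ^ 2 * ‖w‖) (by
      intro t ht
      rw [uIoc_of_le zero_le_one] at ht
      have e1 : ev n t ((0 : Eu n), w) = t • w := by rw [ev_apply]; module
      have e2 : ⟪b - a, S.B (ev n t (a, b)) (ev n t (0, w))⟫ - t * ⟪b - a, S.B b w⟫ =
          t * ⟪b - a, (S.B (ev n t (a, b)) - S.B b) w⟫ := by
        rw [e1, map_smul, inner_smul_right, sub_apply, inner_sub_right]; ring
      rw [e2, norm_mul, Real.norm_eq_abs, abs_of_pos ht.1, Real.norm_eq_abs]
      have h1 := abs_real_inner_le_norm (b - a) ((S.B (ev n t (a, b)) - S.B b) w)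
      have h2 := (S.B (ev n t (a, b)) - S.B b).le_opNorm w
      have h3 := S.B_lip (ev n t (a, b)) b
      have e3 : ev n t (a, b) - b = -((1 - t) • (b - a)) := by rw [ev_apply]; module
      rw [e3, norm_neg, norm_smul, Real.norm_eq_abs, abs_of_nonneg (by linarith [ht.2])] at h3
      have h4 : S.K * ((1 - t) * ‖b - a‖) ≤ S.K * (1 * ‖b - a‖) := by
        have := S.K_pos; gcongr; linarith [ht.1]
      have h5 : ‖(S.B (ev n t (a, b)) - S.B b) w‖ ≤ S.K * ‖b - a‖ * ‖w‖ :=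
        h2.trans (by have := S.K_pos; gcongr; linarith)
      have h6 : |⟪b - a, (S.B (ev n t (a, b)) - S.B b) w⟫| ≤ S.K * ‖b - a‖ ^ 2 * ‖w‖ := by
        nlinarith [norm_nonneg (b - a)]
      nlinarith [abs_nonneg ⟪b - a, (S.B (ev n t (a, b)) - S.B b) w⟫, ht.1, ht.2])
  simpa using this

end Mag
end Torb

namespace Torb
open MeasureTheory Set Metric Filter Topology
open scoped RealInnerProductSpace ContDiff

/-- discrete loops -/
abbrev Lp (N n : ℕ) := ZMod N → Eu n

theorem sum_range_zmod {N : ℕ} [NeZero N] {A : Type*} [AddCommMonoid A] (f : ZMod N → A) :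
    ∑ j ∈ Finset.range N, f (j : ZMod N) = ∑ i, f i := by
  refine Finset.sum_nbij' (fun j => (j : ZMod N)) ZMod.val ?_ ?_ ?_ ?_ ?_
  · simp
  · intro i _; simpa using ZMod.val_lt i
  · intro j hj; simp only [Finset.mem_range] at hj; exact ZMod.val_cast_of_lt hj
  · intro i _; exact ZMod.natCast_zmod_val i
  · simp

theorem sum_shift {N : ℕ} [NeZero N] {A : Type*} [AddCommMonoid A] (f : ZMod N → A) :
    ∑ i, f (i + 1) = ∑ i, f i :=
  Equiv.sum_comp (Equiv.addRight (1 : ZMod N)) f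

noncomputable def len {N n : ℕ} [NeZero N] (x : Lp N n) : ℝ := ∑ i, ‖x (i + 1) - x i‖

theorem len_nonneg {N n : ℕ} [NeZero N] (x : Lp N n) : 0 ≤ len x :=
  Finset.sum_nonneg fun _ _ => norm_nonneg _

theorem dist_zero_le_len {N n : ℕ} [NeZero N] (x : Lp N n) (i : ZMod N) : ‖x i - x 0‖ ≤ len x := by
  have h : ∀ k : ℕ, ‖x (k : ZMod N) - x 0‖ ≤ ∑ j ∈ Finset.range k, ‖x ((j : ZMod N) + 1) - x (j : ZMod N)‖ := by
    intro k
    induction k with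
    | zero => simp
    | succ k ih =>
      rw [Finset.sum_range_succ]
      have : x ((k + 1 : ℕ) : ZMod N) - x 0 = (x (k : ZMod N) - x 0) + (x ((k : ZMod N) + 1) - x (k : ZMod N)) := by
        push_cast; abel
      rw [this]
      exact (norm_add_le _ _).trans (by linarith)
  have h1 := h i.val
  rw [ZMod.natCast_zmod_val] at h1
  refine h1.trans ?_
  rw [len, ← sum_range_zmod]
  exact Finset.sum_le_sum_of_subset_of_nonneg
    (Finset.range_mono (ZMod.val_lt i).le) fun _ _ _ => norm_nonneg _

noncomputable def pr (N n : ℕ) (i : ZMod N) : Lp N n →L[ℝ] Eu n × Eu n :=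
  (ContinuousLinearMap.proj i).prod (ContinuousLinearMap.proj (i + 1))

@[simp] theorem pr_apply {N n : ℕ} (i : ZMod N) (x : Lp N n) : pr N n i x = (x i, x (i + 1)) := rfl

namespace Mag
variable {n : ℕ} (S : Mag n) {N : ℕ} [NeZero N]

noncomputable def alpha (x : Lp N n) : Lp N n →L[ℝ] ℝ := ∑ i, (S.beta (x i, x (i + 1))).comp (pr N n i)

theorem alpha_apply (x ξ : Lp N n) : S.alpha x ξ = ∑ i, S.beta (x i, x (i + 1)) (ξ i, ξ (i + 1)) := by
  simp [alpha, sum_apply]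

theorem hasFDerivAt_alpha (x : Lp N n) : HasFDerivAt (S.alpha (N := N))
    (∑ i, ((ContinuousLinearMap.compL ℝ (Lp N n) (Eu n × Eu n) ℝ).flip (pr N n i)).comp
      ((S.dbeta (x i, x (i + 1))).comp (pr N n i))) x := by
  have : S.alpha (N := N) = fun x => ∑ i, ((ContinuousLinearMap.compL ℝ (Lp N n) (Eu n × Eu n) ℝ).flip (pr N n i))
      (S.beta (pr N n i x)) := by
    funext x; rfl
  rw [this]
  refine HasFDerivAt.fun_sum fun i _ => ?_
  exact (ContinuousLinearMap.hasFDerivAt _).comp x ((S.hasFDerivAt_beta (pr N n i x)).comp x (pr N n i).hasFDerivAt)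

theorem alpha_symm (x ξ η : Lp N n) : fderiv ℝ (S.alpha (N := N)) x ξ η = fderiv ℝ (S.alpha (N := N)) x η ξ := by
  rw [(S.hasFDerivAt_alpha x).fderiv, ← sub_eq_zero]
  simp only [sum_apply, ContinuousLinearMap.comp_apply, ContinuousLinearMap.flip_apply,
    ContinuousLinearMap.compL_apply, pr_apply]
  rw [← Finset.sum_sub_distrib]
  simp only [dbeta_antisym]
  rw [Finset.sum_sub_distrib, sum_shift (fun i => ⟪S.B (x i) (ξ i), η i⟫), sub_self]

theorem exists_M : ∃ f : Lp N n → ℝ, ∀ x, HasFDerivAt f (S.alpha x) x := by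
  obtain ⟨f, hf⟩ := convex_univ.exists_forall_hasFDerivAt_of_fderiv_symmetric isOpen_univ
    (fun x _ => (S.hasFDerivAt_alpha (N := N) x).differentiableAt.differentiableWithinAt)
    (fun a _ x y => S.alpha_symm a x y)
  exact ⟨f, fun x => hf x (mem_univ x)⟩

noncomputable def M (x : Lp N n) : ℝ := (S.exists_M (N := N)).choose x - (S.exists_M (N := N)).choose 0

theorem hasFDerivAt_M (x : Lp N n) : HasFDerivAt (S.M (N := N)) (S.alpha x) x :=
  ((S.exists_M (N := N)).choose_spec x).sub_const _

theorem M_zero : S.M (0 : Lp N n) = 0 := sub_self _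

theorem beta_diag (a : Eu n) : S.beta (a, a) = 0 := by
  ext ζ <;> simp [← abs_nonpos_iff] <;>
  exact (S.beta_le _ _).trans (by simp)

theorem M_const (a : Eu n) : S.M (fun _ : ZMod N => a) = 0 := by
  have hd : ∀ s : ℝ, HasDerivAt (fun s : ℝ => S.M (s • (fun _ : ZMod N => a))) 0 s := by
    intro s
    have := (S.hasFDerivAt_M (s • (fun _ : ZMod N => a))).comp_hasDerivAt s
      ((hasDerivAt_id s).smul_const (fun _ : ZMod N => a))
    refine this.congr_deriv ?_
    rw [alpha_apply]
    simp [beta_diag]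
  have := is_const_of_deriv_eq_zero (fun s => (hd s).differentiableAt) (fun s => (hd s).deriv) 1 0
  simpa [M_zero] using this

theorem beta_per (m : Fin n → ℤ) (a b : Eu n) : S.beta (a + lat m, b + lat m) = S.beta (a, b) := by
  refine ContinuousLinearMap.ext fun ζ => ?_
  rw [beta_apply, beta_apply]
  congr 1; funext t
  have : ev n t (a + lat m, b + lat m) = ev n t (a, b) + lat m := by
    simp only [ev_apply]; module
  rw [this, S.per]; simp

theorem M_per (m : Fin n → ℤ) (x : Lp N n) : S.M (fun i => x i + lat m) = S.M x := by
  have hd : ∀ x : Lp N n, HasFDerivAt (fun x : Lp N n => S.M (x + fun _ => lat m) - S.M x) (0 : Lp N n →L[ℝ] ℝ) x := by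
    intro x
    have h := ((S.hasFDerivAt_M (x + fun _ => lat m)).comp x ((hasFDerivAt_id x).add_const _)).sub (S.hasFDerivAt_M x)
    refine h.congr_fderiv ?_
    refine ContinuousLinearMap.ext fun ξ => ?_
    rw [sub_apply]
    simp only [ContinuousLinearMap.comp_apply, ContinuousLinearMap.id_apply, alpha_apply, Pi.add_apply, beta_per,
      sub_self, zero_apply]
  have := is_const_of_fderiv_eq_zero (𝕜 := ℝ) (fun x => (hd x).differentiableAt) (fun x => (hd x).fderiv) x 0
  simp only [zero_add, M_const, M_zero, sub_self] at this
  linarith [show S.M (fun i => x i + lat m) = S.M (x + fun _ => lat m) from rfl]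

theorem M_le (x : Lp N n) : |S.M x| ≤ S.K * len x ^ 2 := by
  set c : Lp N n := fun _ => x 0 with hc
  have hx : ‖x - c‖ ≤ len x := (pi_norm_le_iff_of_nonneg (len_nonneg x)).2 fun i => dist_zero_le_len x i
  have hd : ∀ s : ℝ, HasDerivAt (fun s : ℝ => S.M (c + s • (x - c))) (S.alpha (c + s • (x - c)) (x - c)) s := by
    intro s
    have hl : HasDerivAt (fun s : ℝ => c + s • (x - c)) (x - c) s := by
      simpa using ((hasDerivAt_id s).smul_const (x - c)).const_add c
    exact (S.hasFDerivAt_M (c + s • (x - c))).comp_hasDerivAt s hl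
  have hb : ∀ s ∈ Icc (0:ℝ) 1, ‖S.alpha (c + s • (x - c)) (x - c)‖ ≤ S.K * len x ^ 2 := by
    intro s hs
    rw [alpha_apply, Real.norm_eq_abs]
    refine (Finset.abs_sum_le_sum_abs _ _).trans ?_
    have : ∀ i, |S.beta ((c + s • (x - c)) i, (c + s • (x - c)) (i + 1)) ((x - c) i, (x - c) (i + 1))|
        ≤ S.K * ‖x (i + 1) - x i‖ * len x := by
      intro i
      refine (S.beta_le _ _).trans ?_
      have h1 : ‖(((x - c) i, (x - c) (i + 1)) : Eu n × Eu n)‖ ≤ len x :=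
        (max_le (norm_le_pi_norm (x - c) i) (norm_le_pi_norm (x - c) (i + 1))).trans hx
      have h2 : (c + s • (x - c)) (i + 1) - (c + s • (x - c)) i = s • (x (i + 1) - x i) := by
        simp only [hc, Pi.add_apply, Pi.smul_apply, Pi.sub_apply]; module
      have h3 : ‖s • (x (i + 1) - x i)‖ ≤ ‖x (i + 1) - x i‖ := by
        rw [norm_smul, Real.norm_eq_abs, abs_of_nonneg hs.1]
        exact mul_le_of_le_one_left (norm_nonneg _) hs.2
      have := S.K_pos
      simp only [h2]
      gcongr
    refine (Finset.sum_le_sum fun i _ => this i).trans ?_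
    rw [← Finset.sum_mul, ← Finset.mul_sum, ← len]
    exact (by ring : S.K * len x * len x = S.K * len x ^ 2).le
  have := (convex_Icc (0:ℝ) 1).norm_image_sub_le_of_norm_hasDerivWithin_le
    (fun s _ => (hd s).hasDerivWithinAt) hb (left_mem_Icc.2 zero_le_one) (right_mem_Icc.2 zero_le_one)
  simpa [hc, M_const] using this

end Mag
end Torb

set_option linter.unusedSectionVars false
namespace Torb
open MeasureTheory Set Metric Filter Topology
open scoped RealInnerProductSpace ContDiff

abbrev XX (N n : ℕ) := Lp N n × ℝ

section
variable {n N : ℕ} [NeZero N]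

noncomputable def vel (z : XX N n) (i : ZMod N) : Eu n :=
  ((N : ℝ) * Real.exp (-z.2)) • (z.1 (i + 1) - z.1 i)

noncomputable def dif (N n : ℕ) (i : ZMod N) : XX N n →L[ℝ] Eu n :=
  ((ContinuousLinearMap.proj (i + 1) : Lp N n →L[ℝ] Eu n) - (ContinuousLinearMap.proj i : Lp N n →L[ℝ] Eu n)).comp (ContinuousLinearMap.fst ℝ _ _)

noncomputable def pj (N n : ℕ) (i : ZMod N) : XX N n →L[ℝ] Eu n :=
  (ContinuousLinearMap.proj i : Lp N n →L[ℝ] Eu n).comp (ContinuousLinearMap.fst ℝ _ _)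

theorem dif_apply (i : ZMod N) (ζ : XX N n) : dif N n i ζ = ζ.1 (i + 1) - ζ.1 i := rfl
theorem pj_apply (i : ZMod N) (ζ : XX N n) : pj N n i ζ = ζ.1 i := rfl

theorem hasFDerivAt_vel (z : XX N n) (i : ZMod N) : HasFDerivAt (fun z : XX N n => vel z i)
    (((N : ℝ) * Real.exp (-z.2)) • dif N n i - (ContinuousLinearMap.snd ℝ (Lp N n) ℝ).smulRight (vel z i)) z := by
  have h1 : HasFDerivAt (fun z : XX N n => (N : ℝ) * Real.exp (-z.2))
      ((-((N : ℝ) * Real.exp (-z.2))) • ContinuousLinearMap.snd ℝ (Lp N n) ℝ) z := by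
    have h := (hasFDerivAt_snd (𝕜 := ℝ) (E := Lp N n) (F := ℝ) (p := z)).neg.exp.const_mul (N : ℝ)
    refine h.congr_fderiv ?_
    refine ContinuousLinearMap.ext fun ζ => ?_
    simp [mul_assoc]
  have h2 : HasFDerivAt (fun z : XX N n => z.1 (i + 1) - z.1 i) (dif N n i) z := (dif N n i).hasFDerivAt
  refine (h1.smul h2).congr_fderiv ?_
  refine ContinuousLinearMap.ext fun ζ => ?_
  simp only [add_apply, smul_apply, sub_apply, ContinuousLinearMap.smulRight_apply,
    ContinuousLinearMap.coe_snd', vel]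
  module

end

section
variable {n : ℕ} (S : Ham n) (G : Mag n) {N : ℕ} [NeZero N]

noncomputable def act (z : XX N n) : ℝ := ∑ i, Real.exp z.2 / N * S.L (z.1 i, vel z i) + G.M z.1

noncomputable def Fn (k : ℝ) (z : XX N n) : ℝ := act S G z + k * Real.exp z.2

noncomputable def dterm (z : XX N n) (i : ZMod N) : XX N n →L[ℝ] ℝ :=
  (innerSL ℝ (S.P (z.1 i, vel z i))).comp (dif N n i)
   - (Real.exp z.2 / N) • (innerSL ℝ (S.Hq (z.1 i, S.P (z.1 i, vel z i)))).comp (pj N n i)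
   - (Real.exp z.2 / N * S.En (z.1 i, vel z i)) • ContinuousLinearMap.snd ℝ (Lp N n) ℝ

noncomputable def dFn (k : ℝ) (z : XX N n) : XX N n →L[ℝ] ℝ :=
  ∑ i, dterm S z i + (G.alpha z.1).comp (ContinuousLinearMap.fst ℝ _ _) +
    (k * Real.exp z.2) • ContinuousLinearMap.snd ℝ (Lp N n) ℝ

theorem dterm_apply (z ζ : XX N n) (i : ZMod N) : dterm S z i ζ =
    ⟪S.P (z.1 i, vel z i), ζ.1 (i + 1) - ζ.1 i⟫
     - Real.exp z.2 / N * ⟪S.Hq (z.1 i, S.P (z.1 i, vel z i)), ζ.1 i⟫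
     - Real.exp z.2 / N * S.En (z.1 i, vel z i) * ζ.2 := by
  simp only [dterm, sub_apply, smul_apply, ContinuousLinearMap.comp_apply, innerSL_apply_apply, dif_apply, pj_apply,
    ContinuousLinearMap.coe_snd', smul_eq_mul]

theorem dFn_apply (k : ℝ) (z ζ : XX N n) : dFn S G k z ζ =
    ∑ i, dterm S z i ζ + G.alpha z.1 ζ.1 + k * Real.exp z.2 * ζ.2 := by
  simp only [dFn, add_apply, sum_apply, smul_apply, ContinuousLinearMap.comp_apply,
    ContinuousLinearMap.coe_snd', ContinuousLinearMap.coe_fst', smul_eq_mul]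

theorem hasFDerivAt_term (z : XX N n) (i : ZMod N) :
    HasFDerivAt (fun z : XX N n => Real.exp z.2 / N * S.L (z.1 i, vel z i)) (dterm S z i) z := by
  have hN : (N : ℝ) ≠ 0 := Nat.cast_ne_zero.2 (NeZero.ne N)
  have h1 : HasFDerivAt (fun z : XX N n => Real.exp z.2 / N)
      ((Real.exp z.2 / N) • ContinuousLinearMap.snd ℝ (Lp N n) ℝ) z := by
    have h := ((hasFDerivAt_snd (𝕜 := ℝ) (E := Lp N n) (F := ℝ) (p := z)).exp).mul_const ((N : ℝ)⁻¹)
    refine h.congr_fderiv ?_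
    refine ContinuousLinearMap.ext fun ζ => ?_
    simp only [smul_apply, ContinuousLinearMap.coe_snd', smul_eq_mul]
    ring
  have h2 : HasFDerivAt (fun z : XX N n => S.L (z.1 i, vel z i)) _ z :=
    (S.hasFDerivAt_L (z.1 i) (vel z i)).comp (f := fun z : XX N n => (z.1 i, vel z i)) z (((pj N n i).hasFDerivAt).prodMk (hasFDerivAt_vel z i))
  refine (h1.mul h2).congr_fderiv ?_
  refine ContinuousLinearMap.ext fun ζ => ?_
  rw [dterm_apply]
  simp only [add_apply, smul_apply, ContinuousLinearMap.comp_apply, ContinuousLinearMap.prod_apply,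
    ContinuousLinearMap.coe_fst', ContinuousLinearMap.coe_snd', neg_apply, innerSL_apply_apply, sub_apply,
    ContinuousLinearMap.smulRight_apply, dif_apply, pj_apply, smul_eq_mul, inner_sub_right, inner_smul_right]
  have hL : S.L (z.1 i, vel z i) = ⟪S.P (z.1 i, vel z i), vel z i⟫ - S.En (z.1 i, vel z i) := rfl
  have he : Real.exp z.2 * Real.exp (-z.2) = 1 := by rw [← Real.exp_add]; simp
  have he2 : Real.exp z.2 / N * (N * Real.exp (-z.2)) = 1 := by
    rw [← he]; field_simp
  rw [hL]
  linear_combination (⟪S.P (z.1 i, vel z i), ζ.1 (i + 1)⟫ - ⟪S.P (z.1 i, vel z i), ζ.1 i⟫) * he2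

theorem hasFDerivAt_Fn (k : ℝ) (z : XX N n) : HasFDerivAt (Fn S G k) (dFn S G k z) z := by
  have h1 : HasFDerivAt (fun z : XX N n => k * Real.exp z.2)
      ((k * Real.exp z.2) • ContinuousLinearMap.snd ℝ (Lp N n) ℝ) z := by
    have h := ((hasFDerivAt_snd (𝕜 := ℝ) (E := Lp N n) (F := ℝ) (p := z)).exp).const_mul k
    refine h.congr_fderiv ?_
    refine ContinuousLinearMap.ext fun ζ => ?_
    simp [mul_assoc]
  have h2 : HasFDerivAt (fun z : XX N n => G.M z.1) ((G.alpha z.1).comp (ContinuousLinearMap.fst ℝ _ _)) z :=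
    (G.hasFDerivAt_M z.1).comp z hasFDerivAt_fst
  exact ((HasFDerivAt.fun_sum fun i _ => hasFDerivAt_term S z i).add h2).add h1

theorem cFn (k : ℝ) : Continuous (Fn S G k (N := N)) :=
  continuous_iff_continuousAt.2 fun z => (hasFDerivAt_Fn S G k z).continuousAt

theorem cvel (i : ZMod N) : Continuous fun z : XX N n => vel z i :=
  continuous_iff_continuousAt.2 fun z => (hasFDerivAt_vel z i).continuousAt

theorem cEn : Continuous S.En := by
  have := S.cH; have := S.cP
  unfold Ham.En; fun_prop

theorem cdFn (k : ℝ) : Continuous (dFn S G k (N := N)) := by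
  have ha : Continuous (G.alpha (N := N)) :=
    continuous_iff_continuousAt.2 fun x => (G.hasFDerivAt_alpha x).continuousAt
  have hP := S.cP
  have hq := S.cq
  have hE := cEn S
  have ht : ∀ i, Continuous fun z : XX N n => dterm S z i := by
    intro i
    have hv := cvel (N := N) (n := n) i
    have hi : Continuous fun z : XX N n => z.1 i := by fun_prop
    have hpp : Continuous fun z : XX N n => S.P (z.1 i, vel z i) := hP.comp (hi.prodMk hv)
    have hqq : Continuous fun z : XX N n => S.Hq (z.1 i, S.P (z.1 i, vel z i)) := hq.comp (hi.prodMk hpp)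
    have hee : Continuous fun z : XX N n => S.En (z.1 i, vel z i) := hE.comp (hi.prodMk hv)
    unfold dterm
    refine Continuous.sub (Continuous.sub ?_ ?_) ?_
    · exact ((innerSL ℝ).continuous.comp hpp).clm_comp continuous_const
    · exact Continuous.smul (M := ℝ) (by fun_prop) (((innerSL ℝ).continuous.comp hqq).clm_comp continuous_const)
    · exact Continuous.smul (M := ℝ) (by fun_prop) continuous_const
  unfold dFn
  refine Continuous.add (Continuous.add (continuous_finsetSum _ fun i _ => ht i) ?_) ?_
  · exact (ha.comp continuous_fst).clm_comp continuous_const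
  · exact Continuous.smul (M := ℝ) (by fun_prop) continuous_const

/-- translate by a lattice vector -/
noncomputable def tr (m : Fin n → ℤ) : XX N n := (fun _ => lat m, 0)

theorem vel_tr (m : Fin n → ℤ) (z : XX N n) (i : ZMod N) : vel (z + tr m) i = vel z i := by
  simp [vel, tr]

theorem Fn_tr (k : ℝ) (m : Fin n → ℤ) (z : XX N n) : Fn S G k (z + tr m) = Fn S G k z := by
  have h1 : G.M (z + tr m).1 = G.M z.1 := G.M_per m z.1
  have h2 : ∀ i, (z + tr m).1 i = z.1 i + lat m := fun i => rfl
  simp only [Fn, act, vel_tr, h1, h2, S.perL]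
  simp [tr]

theorem dFn_tr (k : ℝ) (m : Fin n → ℤ) (z : XX N n) : dFn S G k (z + tr m) = dFn S G k z := by
  have h : (fun z => Fn S G k (z + tr m)) = Fn S G k (N := N) := funext fun z => Fn_tr S G k m z
  have h1 := (hasFDerivAt_Fn S G k (z + tr m)).comp z ((hasFDerivAt_id z).add_const (tr m))
  have h2 : HasFDerivAt (fun z => Fn S G k (z + tr m)) _ z := h1
  rw [h] at h2
  have := h2.unique (hasFDerivAt_Fn S G k z)
  rw [← this]; rfl

end
end Torb

namespace Torb
open MeasureTheory Set Metric Filter Topology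
open scoped RealInnerProductSpace ContDiff

theorem deform {X : Type*} [NormedAddCommGroup X] [NormedSpace ℝ X] [FiniteDimensional ℝ X]
    (Λ : Set X) (F : X → ℝ) (DF : X → X →L[ℝ] ℝ) (hF : ∀ z, HasFDerivAt F (DF z) z) (hDF : Continuous DF)
    (W : X → ℝ) (hW : Continuous W) (σ : X →L[ℝ] ℝ) (e : X)
    (hFl : ∀ l ∈ Λ, ∀ z, F (z + l) = F z) (hDl : ∀ l ∈ Λ, ∀ z, DF (z + l) = DF z)
    (hWl : ∀ l ∈ Λ, ∀ z, W (z + l) = W z) (hσl : ∀ l ∈ Λ, σ l = 0)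
    (f0 f1 f2 f3 s1 K1 μ0 : ℝ) (h01 : f0 < f1) (h23 : f2 < f3) (hμ0 : 0 < μ0)
    (Ks : Set X) (hKs : IsCompact Ks)
    (ha : ∀ z, F z ∈ Icc f0 f3 → σ z ≤ s1 → W z ≤ K1 + 1 → ∃ l ∈ Λ, z + l ∈ Ks)
    (hb : ∀ z, F z ∈ Icc f0 f3 → σ z ≤ s1 → K1 ≤ W z → ∀ t ∈ Icc (0:ℝ) 1, F (z + t • e) ≤ F z - μ0 * t)
    (hc : ∀ z, F z ∈ Icc f0 f3 → σ z ≤ s1 → DF z ≠ 0) :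
    ∃ Φ : X → X, ∃ μ : ℝ, 0 < μ ∧ Continuous Φ ∧ (∀ l ∈ Λ, ∀ z, Φ (z + l) = Φ z + l) ∧
      (∀ z, F (Φ z) ≤ F z) ∧ (∀ z, F z ≤ f0 → Φ z = z) ∧
      (∀ z, F z ∈ Icc f1 f2 → σ z ≤ s1 - 1 → F (Φ z) ≤ F z - μ) := by
  have hcF : Continuous F := continuous_iff_continuousAt.2 fun z => (hF z).continuousAt
  let b := Module.finBasis ℝ X
  let g : X → X := fun z => -∑ j, (DF z (b j)) • b j
  have hg : Continuous g := by
    refine (continuous_finsetSum _ fun j _ => ?_).neg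
    exact (hDF.clm_apply continuous_const).smul continuous_const
  have hgl : ∀ l ∈ Λ, ∀ z, g (z + l) = g z := fun l hl z => by simp only [g, hDl l hl]
  have hgneg : ∀ z, DF z (g z) = -∑ j, (DF z (b j)) ^ 2 := fun z => by
    simp [g, map_sum, sq]
  have hgneg' : ∀ z, DF z ≠ 0 → DF z (g z) < 0 := fun z hz => by
    rw [hgneg, neg_lt_zero]
    have h0 : ∀ j ∈ Finset.univ, 0 ≤ (DF z (b j)) ^ 2 := fun j _ => sq_nonneg _
    refine lt_of_le_of_ne (Finset.sum_nonneg h0) fun h => hz ?_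
    have h1 := (Finset.sum_eq_zero_iff_of_nonneg h0).1 h.symm
    refine ContinuousLinearMap.coe_injective (b.ext fun j => ?_)
    simpa using h1 j (Finset.mem_univ j)
  let lam : X → ℝ := fun z => max 0 (min 1 (W z - K1))
  have hlam : Continuous lam := by fun_prop
  let Y : X → X := fun z => (1 - lam z) • g z + lam z • e
  have hY : Continuous Y := by fun_prop
  have hYl : ∀ l ∈ Λ, ∀ z, Y (z + l) = Y z := fun l hl z => by simp only [Y, lam, hgl l hl, hWl l hl]
  -- sign of derivative
  have hsign : ∀ z, F z ∈ Icc f0 f3 → σ z ≤ s1 → DF z (Y z) < 0 := by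
    intro z hz hs
    have h1 := hgneg' z (hc z hz hs)
    have hl0 : 0 ≤ lam z := le_max_left _ _
    have hl1 : lam z ≤ 1 := max_le zero_le_one (min_le_left _ _)
    simp only [Y, map_add, map_smul, smul_eq_mul]
    rcases le_or_gt K1 (W z) with h | h
    · have he : DF z e ≤ -μ0 := by
        have hd : HasDerivAt (fun t : ℝ => F (z + t • e)) (DF z e) 0 := by
          have hl : HasDerivAt (fun t : ℝ => z + t • e) e 0 := by
            simpa using ((hasDerivAt_id (0:ℝ)).smul_const e).const_add z
          have hf' : HasFDerivAt F (DF z) (z + (0:ℝ) • e) := by simpa using hF z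
          exact hf'.comp_hasDerivAt (0:ℝ) hl
        have hd2 : HasDerivAt (fun t : ℝ => F (z + t • e) + μ0 * t) (DF z e + μ0) 0 := by
          exact (hd.add ((hasDerivAt_id (0:ℝ)).const_mul μ0)).congr_deriv (by simp)
        have hlim := hd2.hasDerivWithinAt (s := Ioi 0)
        rw [hasDerivWithinAt_iff_tendsto_slope' (by simp)] at hlim
        have : DF z e + μ0 ≤ 0 := by
          refine le_of_tendsto hlim ?_
          filter_upwards [Ioo_mem_nhdsGT (zero_lt_one (α := ℝ))] with t ht
          have := hb z hz hs h t ⟨ht.1.le, ht.2.le⟩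
          rw [slope_def_field]
          refine div_nonpos_of_nonpos_of_nonneg ?_ (by linarith [ht.1])
          simp; linarith
        linarith
      rcases eq_or_lt_of_le hl0 with h2 | h2
      · rw [← h2]; linarith
      · nlinarith
    · have : lam z = 0 := max_eq_left ((min_le_right _ _).trans (by linarith))
      rw [this]; linarith
  -- tube lemma
  let A : Set X := {z | F z ∈ Icc f0 f3 ∧ σ z ≤ s1 ∧ W z ≤ K1 + 1}
  have hAcl : IsClosed A := (isClosed_Icc.preimage hcF).inter
    ((isClosed_le σ.continuous continuous_const).inter (isClosed_le hW continuous_const))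
  have hK0 : IsCompact (Ks ∩ A) := hKs.inter_right hAcl
  obtain ⟨μ1, hμ1, κ, hκ, hκ1, htube⟩ : ∃ μ1 > 0, ∃ κ > 0, κ ≤ 1 ∧ ∀ t ∈ Icc (0:ℝ) κ, ∀ z ∈ Ks ∩ A,
      DF (z + t • Y z) (Y z) ≤ -μ1 := by
    have hc0 : ContinuousOn (fun z => DF z (Y z)) (Ks ∩ A) := (hDF.clm_apply hY).continuousOn
    obtain ⟨μ1, hμ1, hm⟩ : ∃ μ1 > 0, ∀ z ∈ Ks ∩ A, DF z (Y z) ≤ -μ1 - μ1 := by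
      rcases (Ks ∩ A).eq_empty_or_nonempty with h | h
      · exact ⟨1, one_pos, by simp [h]⟩
      · obtain ⟨z0, hz0, hmax⟩ := hK0.exists_isMaxOn h hc0
        have := hsign z0 hz0.2.1 hz0.2.2.1
        refine ⟨-(DF z0 (Y z0)) / 2, by linarith, fun z hz => ?_⟩
        have := hmax hz
        simp only [mem_ofPred_eq] at this
        linarith
    have hev : ∀ᶠ t : ℝ in 𝓝 0, ∀ z ∈ Ks ∩ A, DF (z + t • Y z) (Y z) < -μ1 := by
      refine hK0.eventually_forall_of_forall_eventually fun z hz => ?_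
      have hct : Continuous fun y : ℝ × X => DF (y.2 + y.1 • Y y.2) (Y y.2) :=
        (hDF.comp (by fun_prop)).clm_apply (by fun_prop)
      refine hct.continuousAt.eventually_lt continuousAt_const ?_
      simp only [zero_smul, add_zero]
      linarith [hm z hz]
    obtain ⟨ε, hε, hball⟩ := Metric.eventually_nhds_iff.1 hev
    refine ⟨μ1, hμ1, min 1 (ε / 2), by positivity, min_le_left _ _, fun t ht z hz => (hball ?_ z hz).le⟩
    rw [Real.dist_eq, sub_zero, abs_of_nonneg ht.1]
    linarith [ht.2, min_le_right 1 (ε / 2)]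
  have htube' : ∀ t ∈ Icc (0:ℝ) κ, ∀ z ∈ A, DF (z + t • Y z) (Y z) ≤ -μ1 := by
    intro t ht z hz
    obtain ⟨l, hl, hlk⟩ := ha z hz.1 hz.2.1 hz.2.2
    have h := htube t ht (z + l) ⟨hlk, by
      refine ⟨?_, ?_, ?_⟩
      · rw [hFl l hl]; exact hz.1
      · rw [map_add, hσl l hl, add_zero]; exact hz.2.1
      · rw [hWl l hl]; exact hz.2.2⟩
    rw [hYl l hl, show z + l + t • Y z = (z + t • Y z) + l by abel, hDl l hl] at h
    exact h
  have hdec1 : ∀ t ∈ Icc (0:ℝ) κ, ∀ z ∈ A, F (z + t • Y z) ≤ F z - μ1 * t := by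
    intro t ht z hz
    have hder : ∀ s : ℝ, HasDerivAt (fun s : ℝ => F (z + s • Y z)) (DF (z + s • Y z) (Y z)) s := by
      intro s
      have hl : HasDerivAt (fun t : ℝ => z + t • Y z) (Y z) s := by
        simpa using ((hasDerivAt_id s).smul_const (Y z)).const_add z
      exact (hF _).comp_hasDerivAt s hl
    have := (convex_Icc (0:ℝ) κ).image_sub_le_mul_sub_of_deriv_le (C := -μ1)
      (fun s _ => (hder s).continuousAt.continuousWithinAt)
      (fun s _ => (hder s).differentiableAt.differentiableWithinAt)
      (fun s hs => by rw [(hder s).deriv]; exact htube' s (interior_subset hs) z hz) 0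
      (left_mem_Icc.2 hκ.le) t ht ht.1
    simp at this
    linarith
  -- the cut-off
  let χ : X → ℝ := fun z => max 0 (min 1 (min ((F z - f0) / (f1 - f0)) ((f3 - F z) / (f3 - f2)))) *
    max 0 (min 1 (s1 - σ z))
  have hχ : Continuous χ := by fun_prop
  have hχ0 : ∀ z, 0 ≤ χ z := fun z => mul_nonneg (le_max_left _ _) (le_max_left _ _)
  have hχ1 : ∀ z, χ z ≤ 1 := fun z => mul_le_one₀ (max_le zero_le_one (min_le_left _ _)) (le_max_left _ _)
    (max_le zero_le_one (min_le_left _ _))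
  have hχs : ∀ z, χ z ≠ 0 → F z ∈ Ioo f0 f3 ∧ σ z ≤ s1 := by
    intro z hz
    have h1 := left_ne_zero_of_mul hz
    have h2 := right_ne_zero_of_mul hz
    refine ⟨⟨?_, ?_⟩, ?_⟩
    · by_contra h; push Not at h
      exact h1 (max_eq_left ((min_le_right _ _).trans ((min_le_left _ _).trans
        (div_nonpos_of_nonpos_of_nonneg (by linarith) (by linarith)))))
    · by_contra h; push Not at h
      exact h1 (max_eq_left ((min_le_right _ _).trans ((min_le_right _ _).trans
        (div_nonpos_of_nonpos_of_nonneg (by linarith) (by linarith)))))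
    · by_contra h; push Not at h
      exact h2 (max_eq_left ((min_le_right _ _).trans (by linarith)))
  have hχe : ∀ z, F z ∈ Icc f1 f2 → σ z ≤ s1 - 1 → χ z = 1 := by
    intro z hz hs
    have e1 : 1 ≤ (F z - f0) / (f1 - f0) := by rw [le_div_iff₀ (by linarith)]; linarith [hz.1]
    have e2 : 1 ≤ (f3 - F z) / (f3 - f2) := by rw [le_div_iff₀ (by linarith)]; linarith [hz.2]
    simp only [χ]
    rw [min_eq_left (le_min e1 e2), min_eq_left (by linarith)]
    norm_num
  have hmain : ∀ z, F (z + (κ * χ z) • Y z) ≤ F z - min μ0 μ1 * (κ * χ z) := by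
    intro z
    rcases eq_or_ne (χ z) 0 with h | h
    · simp [h]
    · obtain ⟨h1, h2⟩ := hχs z h
      have ht : κ * χ z ∈ Icc (0:ℝ) κ := ⟨mul_nonneg hκ.le (hχ0 z), mul_le_of_le_one_right hκ.le (hχ1 z)⟩
      rcases le_or_gt (W z) (K1 + 1) with h3 | h3
      · refine (hdec1 _ ht z ⟨Ioo_subset_Icc_self h1, h2, h3⟩).trans ?_
        have := mul_le_mul_of_nonneg_right (min_le_right μ0 μ1) ht.1
        linarith
      · have hl : lam z = 1 := by
          simp only [lam]; rw [min_eq_left (by linarith)]; norm_num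
        have hYe : Y z = e := by simp [Y, hl]
        rw [hYe]
        refine (hb z (Ioo_subset_Icc_self h1) h2 (by linarith) _ ⟨ht.1, ht.2.trans hκ1⟩).trans ?_
        have := mul_le_mul_of_nonneg_right (min_le_left μ0 μ1) ht.1
        linarith
  have hμ : 0 < min μ0 μ1 := lt_min hμ0 hμ1
  refine ⟨fun z => z + (κ * χ z) • Y z, min μ0 μ1 * κ, by positivity, by fun_prop, ?_, ?_, ?_, ?_⟩
  · intro l hl z
    have : χ (z + l) = χ z := by simp only [χ, hFl l hl, map_add, hσl l hl, add_zero]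
    simp only [this, hYl l hl]; abel
  · intro z
    have := mul_nonneg hμ.le (mul_nonneg hκ.le (hχ0 z))
    exact (hmain z).trans (by linarith)
  · intro z hz
    have : χ z = 0 := by
      by_contra h
      exact absurd (hχs z h).1.1 (not_lt.2 hz)
    simp [this]
  · intro z hz hs
    have := hmain z
    rw [hχe z hz hs, mul_one] at this
    simpa [hχe z hz hs] using this

end Torb

set_option linter.unusedSectionVars false
namespace Torb
open MeasureTheory Set Metric Filter Topology
open scoped RealInnerProductSpace ContDiff

section
variable {n N : ℕ} [NeZero N]

noncomputable def Wn (z : XX N n) : ℝ := (∑ i, ‖vel z i‖ ^ 2) / N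

theorem N_pos : (0:ℝ) < (N : ℝ) := Nat.cast_pos.2 (Nat.pos_of_ne_zero (NeZero.ne N))

theorem cWn : Continuous (Wn : XX N n → ℝ) := by
  have h := fun i => cvel (N := N) (n := n) i
  unfold Wn
  exact (continuous_finsetSum _ fun i _ => ((h i).norm.pow 2)).div_const _

theorem Wn_nonneg (z : XX N n) : 0 ≤ Wn z :=
  div_nonneg (Finset.sum_nonneg fun _ _ => sq_nonneg _) (Nat.cast_nonneg _)

theorem norm_dif (z : XX N n) (i : ZMod N) : ‖z.1 (i + 1) - z.1 i‖ = Real.exp z.2 / N * ‖vel z i‖ := by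
  have hN := N_pos (N := N)
  rw [vel, norm_smul, Real.norm_eq_abs, abs_of_pos (by positivity), Real.exp_neg]
  have := Real.exp_pos z.2
  field_simp

theorem dif_eq (z : XX N n) (i : ZMod N) : z.1 (i + 1) - z.1 i = (Real.exp z.2 / N) • vel z i := by
  have hN := N_pos (N := N)
  rw [vel, smul_smul, Real.exp_neg]
  have := Real.exp_pos z.2
  rw [show Real.exp z.2 / N * (N * (Real.exp z.2)⁻¹) = 1 by field_simp, one_smul]

theorem len_sq_le (z : XX N n) : len z.1 ^ 2 ≤ Real.exp z.2 ^ 2 * Wn z := by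
  have hN := N_pos (N := N)
  have h1 : len z.1 = Real.exp z.2 / N * ∑ i, ‖vel z i‖ := by
    rw [len, Finset.mul_sum]; exact Finset.sum_congr rfl fun i _ => norm_dif z i
  have h2 : (∑ i, ‖vel z i‖) ^ 2 ≤ N * ∑ i, ‖vel z i‖ ^ 2 := by
    have := sq_sum_le_card_mul_sum_sq (s := (Finset.univ : Finset (ZMod N))) (f := fun i => ‖vel z i‖)
    simpa [ZMod.card] using this
  rw [h1, Wn, mul_pow, div_pow]
  calc Real.exp z.2 ^ 2 / N ^ 2 * (∑ i, ‖vel z i‖) ^ 2 ≤ Real.exp z.2 ^ 2 / N ^ 2 * (N * ∑ i, ‖vel z i‖ ^ 2) := by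
        gcongr
    _ = _ := by field_simp

variable (S : Ham n) (G : Mag n)

theorem sum_const_div (a : ℝ) : ∑ _i : ZMod N, a / N = a := by
  have hN := N_pos (N := N)
  rw [Finset.sum_const, Finset.card_univ, ZMod.card, nsmul_eq_mul]; field_simp

/-- upper Lagrangian constant -/
noncomputable def CL : ℝ := S.C + (1 + S.C) / S.c
theorem CL_pos : 0 < CL S := by
  have := S.c_pos; have := S.C_pos; unfold CL; positivity

theorem sum_tau (z : XX N n) (a b : ℝ) :
    ∑ i, Real.exp z.2 / N * (a + b * ‖vel z i‖ ^ 2) = Real.exp z.2 * (a + b * Wn z) := by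
  have hN := N_pos (N := N)
  rw [← Finset.mul_sum, Finset.sum_add_distrib, ← Finset.mul_sum, Finset.sum_const, Finset.card_univ, ZMod.card,
    nsmul_eq_mul, Wn]
  field_simp

theorem act_le (z : XX N n) : act S G z ≤ Real.exp z.2 * (CL S * (1 + Wn z)) + G.K * Real.exp z.2 ^ 2 * Wn z := by
  have hN := N_pos (N := N)
  have h1 : ∑ i, Real.exp z.2 / N * S.L (z.1 i, vel z i) ≤ ∑ i, Real.exp z.2 / N * (CL S + CL S * ‖vel z i‖ ^ 2) := by
    refine Finset.sum_le_sum fun i _ => ?_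
    have := S.L_le (z.1 i) (vel z i)
    gcongr
    unfold CL; linarith
  rw [sum_tau] at h1
  have h2 := le_of_abs_le (G.M_le z.1)
  have h3 := mul_le_mul_of_nonneg_left (len_sq_le z) G.K_pos.le
  unfold act
  nlinarith

theorem act_ge (z : XX N n) :
    Real.exp z.2 * (-S.C + 1 / (4 * S.C) * Wn z) - G.K * Real.exp z.2 ^ 2 * Wn z ≤ act S G z := by
  have hN := N_pos (N := N)
  have h1 : ∑ i, Real.exp z.2 / N * (-S.C + 1 / (4 * S.C) * ‖vel z i‖ ^ 2) ≤
      ∑ i, Real.exp z.2 / N * S.L (z.1 i, vel z i) := by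
    refine Finset.sum_le_sum fun i _ => ?_
    have := S.L_low (z.1 i) (vel z i)
    gcongr
    linarith
  rw [sum_tau] at h1
  have h2 := neg_le_of_abs_le (G.M_le z.1)
  have h3 := mul_le_mul_of_nonneg_left (len_sq_le z) G.K_pos.le
  unfold act
  nlinarith

/-- the period direction -/
noncomputable def eσ : XX N n := (0, 1)

theorem dFn_eσ (k : ℝ) (z : XX N n) :
    dFn S G k z eσ = Real.exp z.2 * (k - (∑ i, S.En (z.1 i, vel z i)) / N) := by
  have hN := N_pos (N := N)
  rw [dFn_apply]
  simp only [dterm_apply, eσ, Pi.zero_apply, sub_self, inner_zero_right, mul_zero, mul_one, zero_sub, map_zero, add_zero,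
    Finset.sum_neg_distrib]
  rw [← Finset.mul_sum]
  ring

theorem vel_shift (z : XX N n) (t : ℝ) (i : ZMod N) : vel (z + t • eσ) i = Real.exp (-t) • vel z i := by
  simp only [vel, eσ, Prod.fst_add, Prod.snd_add, Prod.smul_fst, Prod.smul_snd, smul_zero, add_zero, smul_eq_mul, mul_one,
    smul_smul]
  congr 1
  rw [neg_add, Real.exp_add]; ring

theorem meanEn_ge (z : XX N n) (t : ℝ) (ht : t ∈ Icc (0:ℝ) 1) :
    S.c / (2 * S.C ^ 2) * Real.exp (-2) * Wn z - (S.c + S.C) ≤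
      (∑ i, S.En ((z + t • eσ).1 i, vel (z + t • eσ) i)) / N := by
  have hN := N_pos (N := N)
  have hc := S.c_pos
  have hC := S.C_pos
  have h1 : ∀ i, S.c / (2 * S.C ^ 2) * Real.exp (-2) * ‖vel z i‖ ^ 2 - (S.c + S.C) ≤
      S.En ((z + t • eσ).1 i, vel (z + t • eσ) i) := by
    intro i
    refine le_trans ?_ (S.En_low _ _)
    rw [vel_shift, norm_smul, Real.norm_eq_abs, abs_of_pos (Real.exp_pos _), mul_pow, ← Real.exp_nat_mul]
    have : Real.exp (-2) ≤ Real.exp ((2:ℕ) * -t) := Real.exp_le_exp.2 (by push_cast; linarith [ht.2])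
    rw [mul_assoc]
    gcongr
  have h2 := Finset.sum_le_sum fun i (_ : i ∈ (Finset.univ : Finset (ZMod N))) => h1 i
  rw [Finset.sum_sub_distrib, ← Finset.mul_sum, Finset.sum_const, Finset.card_univ, ZMod.card, nsmul_eq_mul] at h2
  rw [le_div_iff₀ hN, Wn]
  refine le_trans (le_of_eq ?_) h2
  field_simp

theorem deform_Fn (k f0 f1 f2 f3 s1 : ℝ) (hf0 : 0 < f0) (h01 : f0 < f1) (h23 : f2 < f3)
    (hc : ∀ z : XX N n, Fn S G k z ∈ Icc f0 f3 → z.2 ≤ s1 → dFn S G k z ≠ 0) :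
    ∃ Φ : XX N n → XX N n, ∃ μ : ℝ, 0 < μ ∧ Continuous Φ ∧ (∀ m z, Φ (z + tr m) = Φ z + tr m) ∧
      (∀ z, Fn S G k (Φ z) ≤ Fn S G k z) ∧ (∀ z, Fn S G k z ≤ f0 → Φ z = z) ∧
      (∀ z, Fn S G k z ∈ Icc f1 f2 → z.2 ≤ s1 - 1 → Fn S G k (Φ z) ≤ Fn S G k z - μ) := by
  have hN := N_pos (N := N)
  have hSc := S.c_pos
  have hSC := S.C_pos
  have hCL := CL_pos S
  have hK := G.K_pos
  set a := S.c / (2 * S.C ^ 2) * Real.exp (-2) with ha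
  have ha0 : 0 < a := by positivity
  set K1 : ℝ := max 1 (2 * (|k| + (S.c + S.C)) / a) with hK1
  have hK1' : 1 ≤ K1 := le_max_left _ _
  have hK1a : |k| + (S.c + S.C) ≤ a * K1 / 2 := by
    have : 2 * (|k| + (S.c + S.C)) / a ≤ K1 := le_max_right _ _
    rw [div_le_iff₀ ha0] at this
    linarith
  set Q : ℝ := 2 * CL S + G.K * Real.exp s1 + |k| with hQ
  have hQ0 : 0 < Q := by positivity
  have hup : ∀ z : XX N n, z.2 ≤ s1 → ∀ w, 1 ≤ w → Wn z ≤ w → Fn S G k z ≤ Real.exp z.2 * (Q * w) := by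
    intro z hz w hw1 hw
    have h1 := act_le S G z
    have hT := Real.exp_pos z.2
    have hTs : Real.exp z.2 ≤ Real.exp s1 := Real.exp_le_exp.2 hz
    have hW := Wn_nonneg z
    have e1 : G.K * Real.exp z.2 ^ 2 * Wn z ≤ Real.exp z.2 * (G.K * Real.exp s1 * w) := by
      calc G.K * Real.exp z.2 ^ 2 * Wn z = Real.exp z.2 * (G.K * Real.exp z.2 * Wn z) := by ring
        _ ≤ _ := by gcongr
    have e2 : Real.exp z.2 * (CL S * (1 + Wn z)) ≤ Real.exp z.2 * (2 * CL S * w) := by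
      gcongr ?_ * ?_
      nlinarith
    have e3 : k * Real.exp z.2 ≤ Real.exp z.2 * (|k| * w) := by
      rw [mul_comm]
      gcongr ?_ * ?_
      have := le_abs_self k
      nlinarith [abs_nonneg k]
    unfold Fn
    have : Real.exp z.2 * (Q * w) = Real.exp z.2 * (2 * CL S * w) + Real.exp z.2 * (G.K * Real.exp s1 * w)
      + Real.exp z.2 * (|k| * w) := by rw [hQ]; ring
    linarith
  obtain ⟨ρ, hρ, hred⟩ := lat_reduce n
  set R := Real.exp s1 * Real.sqrt (K1 + 1) with hR
  have hR0 : 0 ≤ R := by positivity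
  have key := deform (range (tr : (Fin n → ℤ) → XX N n)) (Fn S G k) (dFn S G k)
    (hasFDerivAt_Fn S G k) (cdFn S G k) Wn cWn (ContinuousLinearMap.snd ℝ (Lp N n) ℝ) eσ
    (by rintro _ ⟨m, rfl⟩ z; exact Fn_tr S G k m z) (by rintro _ ⟨m, rfl⟩ z; exact dFn_tr S G k m z)
    (by rintro _ ⟨m, rfl⟩ z; simp only [Wn, vel_tr]) (by rintro _ ⟨m, rfl⟩; rfl)
    f0 f1 f2 f3 s1 K1 (a / 2 * (f0 / Q)) h01 h23 (by positivity)
    (closedBall 0 (ρ + R) ×ˢ Icc (Real.log (f0 / (Q * (K1 + 1)))) s1)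
    ((isCompact_closedBall _ _).prod isCompact_Icc) ?_ ?_ hc
  · obtain ⟨Φ, μ, hμ, hΦ, hl, h1, h2, h3⟩ := key
    refine ⟨Φ, μ, hμ, hΦ, fun m z => hl _ ⟨m, rfl⟩ z, h1, h2, h3⟩
  · intro z hz hs hW
    obtain ⟨m, hm⟩ := hred (z.1 0)
    refine ⟨tr m, ⟨m, rfl⟩, ?_, ?_, ?_⟩
    · rw [mem_closedBall_zero_iff, pi_norm_le_iff_of_nonneg (by positivity)]
      intro i
      have e1 : (z + tr m).1 i = (z.1 0 + lat m) + (z.1 i - z.1 0) := by simp [tr]; abel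
      rw [e1]
      refine (norm_add_le _ _).trans (add_le_add hm ((dist_zero_le_len z.1 i).trans ?_))
      refine Real.le_sqrt_of_sq_le (len_sq_le z) |>.trans ?_
      rw [Real.sqrt_mul (by positivity), Real.sqrt_sq (Real.exp_pos _).le]
      have : Real.exp z.2 ≤ Real.exp s1 := Real.exp_le_exp.2 hs
      rw [hR]; gcongr
    · have h := hup z hs (K1 + 1) (by linarith) hW
      have : (z + tr m).2 = z.2 := by simp [tr]
      rw [this, Real.log_le_iff_le_exp (by positivity), div_le_iff₀ (by positivity)]
      exact hz.1.trans h
    · have : (z + tr m).2 = z.2 := by simp [tr]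
      rw [this]; exact hs
  · intro z hz hs hW t ht
    have hs' : z.2 ≤ s1 := hs
    have hTW : f0 / Q ≤ Real.exp z.2 * Wn z := by
      have h := hup z hs (Wn z) (by linarith) le_rfl
      rw [div_le_iff₀ hQ0]
      refine hz.1.trans (h.trans (le_of_eq (by ring)))
    have hder : ∀ s : ℝ, HasDerivAt (fun s : ℝ => Fn S G k (z + s • eσ)) (dFn S G k (z + s • eσ) eσ) s := by
      intro s
      have hl : HasDerivAt (fun t : ℝ => z + t • eσ) eσ s := by
        simpa using ((hasDerivAt_id s).smul_const eσ).const_add z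
      exact (hasFDerivAt_Fn S G k _).comp_hasDerivAt s hl
    have := (convex_Icc (0:ℝ) 1).image_sub_le_mul_sub_of_deriv_le (C := -(a / 2 * (f0 / Q)))
      (fun s _ => (hder s).continuousAt.continuousWithinAt)
      (fun s _ => (hder s).differentiableAt.differentiableWithinAt)
      (fun s hs => by
        have hs := interior_subset hs
        rw [(hder s).deriv, dFn_eσ]
        have h1 := meanEn_ge S z s hs
        rw [← ha] at h1
        have h2 : k - (∑ i, S.En ((z + s • eσ).1 i, vel (z + s • eσ) i)) / N ≤ -(a / 2 * Wn z) := by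
          have := le_abs_self k
          nlinarith
        have hT : Real.exp z.2 ≤ Real.exp (z + s • eσ).2 := by
          refine Real.exp_le_exp.2 ?_
          simp [eσ]; exact hs.1
        have hW0 : 0 ≤ a / 2 * Wn z := mul_nonneg (by positivity) (Wn_nonneg z)
        have := Real.exp_pos z.2
        calc Real.exp (z + s • eσ).2 * (k - (∑ i, S.En ((z + s • eσ).1 i, vel (z + s • eσ) i)) / N) ≤
            Real.exp (z + s • eσ).2 * (-(a / 2 * Wn z)) := by gcongr
          _ ≤ Real.exp z.2 * (-(a / 2 * Wn z)) := by nlinarith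
          _ ≤ _ := by nlinarith)
      0 (left_mem_Icc.2 zero_le_one) t ht ht.1
    simp at this
    linarith

end
end Torb

set_option linter.unusedSectionVars false
namespace Torb
open MeasureTheory Set Metric Filter Topology
open scoped RealInnerProductSpace ContDiff

section
variable {n N : ℕ} [NeZero N]

structure Fam (S : Ham n) (G : Mag n) (Γ0 : Eu n × ℝ → XX N n) (q0 : Eu n) (sδ a b d0 A : ℝ) : Prop where
  cont : Continuous Γ0
  equi : ∀ m q s, Γ0 (q + lat m, s) = Γ0 (q, s) + tr m
  lo : ∀ q, (Γ0 (q, 0)).2 < sδ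
  hi : ∀ q, sδ < (Γ0 (q, 1)).2
  d0_pos : 0 < d0
  bd0 : ∀ k ∈ Icc a b, ∀ q, Fn S G k (Γ0 (q, 0)) ≤ d0 / 2
  bd1 : ∀ k ∈ Icc a b, ∀ q, Fn S G k (Γ0 (q, 1)) ≤ d0 / 2
  up : ∀ k ∈ Icc a b, ∀ q, ∀ s ∈ Icc (0:ℝ) 1, Fn S G k (Γ0 (q, s)) ≤ A
  wall : ∀ k ∈ Icc a b, ∀ z : XX N n, z.1 0 = q0 → z.2 = sδ → d0 ≤ Fn S G k z

/-- admissible families -/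
def Adm (Γ0 Γ : Eu n × ℝ → XX N n) : Prop :=
  Continuous Γ ∧ (∀ m q s, Γ (q + lat m, s) = Γ (q, s) + tr m) ∧ (∀ q, Γ (q, 0) = Γ0 (q, 0)) ∧
    (∀ q, Γ (q, 1) = Γ0 (q, 1))

variable (S : Ham n) (G : Mag n)

def lev (Γ0 : Eu n × ℝ → XX N n) (k : ℝ) : Set ℝ :=
  {α | ∃ Γ, Adm Γ0 Γ ∧ ∀ q, ∀ s ∈ Icc (0:ℝ) 1, Fn S G k (Γ (q, s)) ≤ α}

noncomputable def cc (Γ0 : Eu n × ℝ → XX N n) (k : ℝ) : ℝ := sInf (lev S G Γ0 k)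

variable {S G} {Γ0 : Eu n × ℝ → XX N n} {q0 : Eu n} {sδ a b d0 A : ℝ}

theorem Fam.meets (h : Fam S G Γ0 q0 sδ a b d0 A) {Γ : Eu n × ℝ → XX N n} (hΓ : Adm Γ0 Γ) :
    ∃ q, ∃ s ∈ Icc (0:ℝ) 1, (Γ (q, s)).1 0 = q0 ∧ (Γ (q, s)).2 = sδ := by
  obtain ⟨hc, he, h0, h1⟩ := hΓ
  have hx : Continuous fun z : Eu n × ℝ => (Γ z).1 0 := (continuous_apply (0 : ZMod N)).comp hc.fst
  obtain ⟨ρ, hρ, hred⟩ := lat_reduce n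
  obtain ⟨C, hC⟩ := ((isCompact_closedBall (0 : Eu n) ρ).prod (isCompact_Icc (a := (0:ℝ)) (b := 1))).exists_bound_of_continuousOn
    (f := fun z : Eu n × ℝ => (Γ z).1 0 - z.1) (hx.sub continuous_fst).continuousOn
  obtain ⟨q, s, hs, e1, e2⟩ := linking (fun q s => (Γ (q, s)).1 0) (fun q s => (Γ (q, s)).2)
    hx.continuousOn hc.snd.continuousOn C (by
      intro q s hs
      obtain ⟨m, hm⟩ := hred q
      have := hC (q + lat m, s) ⟨mem_closedBall_zero_iff.2 hm, hs⟩
      simp only [he, tr] at this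
      simpa using this) q0 sδ (fun q => by rw [h0]; exact h.lo q) (fun q => by rw [h1]; exact h.hi q)
  exact ⟨q, s, hs, e1, e2⟩

theorem Fam.adm (h : Fam S G Γ0 q0 sδ a b d0 A) : Adm Γ0 Γ0 := ⟨h.cont, h.equi, fun _ => rfl, fun _ => rfl⟩

theorem Fam.lower (h : Fam S G Γ0 q0 sδ a b d0 A) {k : ℝ} (hk : k ∈ Icc a b) : ∀ α ∈ lev S G Γ0 k, d0 ≤ α := by
  rintro α ⟨Γ, hΓ, hα⟩
  obtain ⟨q, s, hs, e1, e2⟩ := h.meets hΓ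
  exact (h.wall k hk _ e1 e2).trans (hα q s hs)

theorem Fam.A_mem (h : Fam S G Γ0 q0 sδ a b d0 A) {k : ℝ} (hk : k ∈ Icc a b) : A ∈ lev S G Γ0 k :=
  ⟨Γ0, h.adm, h.up k hk⟩

theorem Fam.bdd (h : Fam S G Γ0 q0 sδ a b d0 A) {k : ℝ} (hk : k ∈ Icc a b) : BddBelow (lev S G Γ0 k) :=
  ⟨d0, fun α hα => h.lower hk α hα⟩

theorem Fam.le_cc (h : Fam S G Γ0 q0 sδ a b d0 A) {k : ℝ} (hk : k ∈ Icc a b) : d0 ≤ cc S G Γ0 k :=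
  le_csInf ⟨A, h.A_mem hk⟩ (h.lower hk)

theorem Fam.cc_le (h : Fam S G Γ0 q0 sδ a b d0 A) {k : ℝ} (hk : k ∈ Icc a b) : cc S G Γ0 k ≤ A :=
  csInf_le (h.bdd hk) (h.A_mem hk)

theorem Fam.mono (h : Fam S G Γ0 q0 sδ a b d0 A) : MonotoneOn (cc S G Γ0) (Icc a b) := by
  intro k hk k' hk' hkk
  refine csInf_le_csInf (h.bdd hk) ⟨A, h.A_mem hk'⟩ ?_
  rintro α ⟨Γ, hΓ, hα⟩
  refine ⟨Γ, hΓ, fun q s hs => le_trans ?_ (hα q s hs)⟩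
  unfold Fn
  have := Real.exp_pos (Γ (q, s)).2
  gcongr

theorem Fam.crit (h : Fam S G Γ0 q0 sδ a b d0 A) {k : ℝ} (hk : k ∈ Ioo a b) {Mb : ℝ} (hMb : 0 < Mb)
    (hsl : ∀ ε > 0, ∃ t, 0 < t ∧ t < ε ∧ cc S G Γ0 (k + t) - cc S G Γ0 k ≤ Mb * t) :
    ∃ z : XX N n, d0 / 2 ≤ Fn S G k z ∧ z.2 ≤ Real.log (Mb + 2) + 1 ∧ dFn S G k z = 0 := by
  by_contra hcon
  push Not at hcon
  have hd := h.d0_pos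
  have hk' : k ∈ Icc a b := Ioo_subset_Icc_self hk
  obtain ⟨Φ, μ, hμ, hΦ, hl, h1, h2, h3⟩ := deform_Fn S G (N := N) k (d0 / 2) (3 * d0 / 4) (A + 1 / 2) (A + 1)
    (Real.log (Mb + 2) + 1) (by linarith) (by linarith) (by linarith)
    (fun z hz hs => hcon z hz.1 hs)
  obtain ⟨t, ht0, ht, hct⟩ := hsl (min (min (d0 / 4) (b - k)) (min (μ / (Mb + 2)) (1 / (2 * (Mb + 1)))))
    (by have := sub_pos.2 hk.2; positivity)
  have t1 : t < d0 / 4 := ht.trans_le ((min_le_left _ _).trans (min_le_left _ _))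
  have t2 : t < b - k := ht.trans_le ((min_le_left _ _).trans (min_le_right _ _))
  have t3 : t < μ / (Mb + 2) := ht.trans_le ((min_le_right _ _).trans (min_le_left _ _))
  have t4 : t < 1 / (2 * (Mb + 1)) := ht.trans_le ((min_le_right _ _).trans (min_le_right _ _))
  rw [lt_div_iff₀ (by positivity)] at t3 t4
  have hkt : k + t ∈ Icc a b := ⟨by linarith [hk.1], by linarith⟩
  obtain ⟨α, ⟨Γ, hΓ, hα⟩, hαlt⟩ := exists_lt_of_csInf_lt ⟨A, h.A_mem hkt⟩
    (show sInf (lev S G Γ0 (k + t)) < cc S G Γ0 (k + t) + t by change cc S G Γ0 (k + t) < _; linarith)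
  have hcA := h.cc_le hk'
  have hcd := h.le_cc hk'
  have hmem : cc S G Γ0 k - t ∈ lev S G Γ0 k := by
    refine ⟨fun y => Φ (Γ y), ⟨hΦ.comp hΓ.1, fun m q s => ?_, fun q => ?_, fun q => ?_⟩, fun q s hs => ?_⟩
    · beta_reduce; rw [hΓ.2.1, hl]
    · beta_reduce; rw [hΓ.2.2.1]; exact h2 _ (h.bd0 k hk' q)
    · beta_reduce; rw [hΓ.2.2.2]; exact h2 _ (h.bd1 k hk' q)
    · set z := Γ (q, s) with hz
      rcases le_or_gt (Fn S G k z) (cc S G Γ0 k - t) with hle | hgt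
      · exact (h1 z).trans hle
      · have e1 := hα q s hs
        rw [← hz] at e1
        have e2 : Fn S G (k + t) z = Fn S G k z + t * Real.exp z.2 := by unfold Fn; ring
        have hT := Real.exp_pos z.2
        have e3 : t * Real.exp z.2 ≤ t * (Mb + 2) := by linarith
        have e4 : Real.exp z.2 ≤ Mb + 2 := le_of_mul_le_mul_left e3 ht0
        have e5 : z.2 ≤ Real.log (Mb + 2) := (Real.le_log_iff_exp_le (by positivity)).2 e4
        have e6 : 0 < t * Real.exp z.2 := by positivity
        have := h3 z ⟨by linarith, by linarith⟩ (by linarith)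
        linarith
  have := csInf_le (h.bdd hk') hmem
  change cc S G Γ0 k ≤ _ at this
  linarith

end
end Torb

set_option linter.unusedSectionVars false
namespace Torb
open MeasureTheory Set Metric Filter Topology
open scoped RealInnerProductSpace ContDiff ENNReal

theorem ae_slope (f : ℕ → ℝ → ℝ) (a b A : ℝ) (hab : a ≤ b) (hf : ∀ N, MonotoneOn (f N) (Icc a b))
    (hA : ∀ N, f N b - f N a ≤ A) :
    ∀ᵐ k ∂(volume : Measure ℝ), k ∈ Ioo a b → ∃ Mb > 0, ∃ᶠ N in atTop, ∀ ε > 0, ∃ t, 0 < t ∧ t < ε ∧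
      f N (k + t) - f N k ≤ Mb * t := by
  have hd : ∀ᵐ k ∂(volume : Measure ℝ), ∀ N, k ∈ Icc a b → DifferentiableWithinAt ℝ (f N) (Icc a b) k :=
    ae_all_iff.2 fun N => (hf N).ae_differentiableWithinAt_of_mem
  set μ := (volume : Measure ℝ).restrict (Ioc a b) with hμ
  let g : ℕ → ℝ → ℝ≥0∞ := fun N x => ENNReal.ofReal (deriv (f N) x)
  have hg : ∀ N, Measurable (g N) := fun N => (measurable_deriv _).ennreal_ofReal
  have hintg : ∀ N, ∫⁻ x, g N x ∂μ ≤ ENNReal.ofReal A := by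
    intro N
    have hm : MonotoneOn (f N) (uIcc a b) := by rw [uIcc_of_le hab]; exact hf N
    have h1 := hm.intervalIntegrable_deriv
    have h2 := hm.intervalIntegral_deriv_mem_uIcc
    have h3 : f N a ≤ f N b := hf N (left_mem_Icc.2 hab) (right_mem_Icc.2 hab) hab
    rw [uIcc_of_le (sub_nonneg.2 h3), intervalIntegral.integral_of_le hab] at h2
    have h4 : IntegrableOn (deriv (f N)) (Ioc a b) := (intervalIntegrable_iff_integrableOn_Ioc_of_le hab).1 h1
    have hpos : 0 ≤ᵐ[μ] deriv (f N) := by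
      have hne : ∀ᵐ x ∂μ, x ≠ b := by
        refine ae_restrict_of_ae ?_
        exact Measure.ae_ne volume b
      filter_upwards [ae_restrict_mem measurableSet_Ioc, hne] with x hx hxb
      have hxI : x ∈ Ioo a b := ⟨hx.1, lt_of_le_of_ne hx.2 hxb⟩
      have := (hf N).derivWithin_nonneg (x := x)
      rw [derivWithin_of_mem_nhds (Icc_mem_nhds hxI.1 hxI.2)] at this
      exact this
    rw [← ofReal_integral_eq_lintegral_ofReal h4 hpos]
    exact ENNReal.ofReal_le_ofReal (h2.2.trans (hA N))
  have hfat := lintegral_liminf_le (μ := μ) (u := atTop) hg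
  have hfin : ∫⁻ x, liminf (fun N => g N x) atTop ∂μ ≠ ⊤ := by
    refine (lt_of_le_of_lt hfat ?_).ne
    refine lt_of_le_of_lt (b := ENNReal.ofReal A) ?_ ENNReal.ofReal_lt_top
    calc liminf (fun N => ∫⁻ x, g N x ∂μ) atTop ≤ liminf (fun _ : ℕ => ENNReal.ofReal A) atTop :=
          liminf_le_liminf (Eventually.of_forall hintg)
      _ = _ := liminf_const _
  have hlt := ae_lt_top (Measurable.liminf hg) hfin
  rw [hμ, ae_restrict_iff' measurableSet_Ioc] at hlt
  filter_upwards [hd, hlt] with k hk1 hk2 hk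
  have h5 := hk2 ⟨hk.1, hk.2.le⟩
  obtain ⟨M, hM1, hM2⟩ := ENNReal.lt_iff_exists_nnreal_btwn.1 h5
  refine ⟨M + 1, by positivity, ?_⟩
  refine (frequently_lt_of_liminf_lt (by isBoundedDefault) hM1).mono fun N hN => ?_
  have h6 : HasDerivAt (f N) (deriv (f N) k) k :=
    ((hk1 N ⟨hk.1.le, hk.2.le⟩).differentiableAt (Icc_mem_nhds hk.1 hk.2)).hasDerivAt
  have h7 : deriv (f N) k < M + 1 := by
    have : deriv (f N) k ≤ M := by
      by_contra hc
      push Not at hc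
      have := ENNReal.ofReal_le_ofReal hc.le
      rw [ENNReal.ofReal_coe_nnreal] at this
      exact absurd hN (not_lt.2 this)
    linarith
  intro ε hε
  have h8 := h6.hasDerivWithinAt (s := Ioi k)
  rw [hasDerivWithinAt_iff_tendsto_slope' (by simp)] at h8
  have h9 := h8.eventually (gt_mem_nhds h7)
  have h10 : ∀ᶠ y in 𝓝[>] k, y ∈ Ioo k (k + ε) := Ioo_mem_nhdsGT (by linarith)
  obtain ⟨y, hy1, hy2⟩ := (h9.and h10).exists
  refine ⟨y - k, by linarith [hy2.1], by linarith [hy2.2], ?_⟩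
  rw [slope_def_field, div_lt_iff₀ (by linarith [hy2.1])] at hy1
  rw [add_sub_cancel]; exact hy1.le

end Torb

set_option linter.unusedSectionVars false
namespace Torb
open MeasureTheory Set Metric Filter Topology
open scoped RealInnerProductSpace ContDiff

section
variable {n : ℕ} (S : Ham n) (G : Mag n)

theorem wall_L (q0 p0 : Eu n) (a : ℝ) (h : S.H (q0, p0) < a) :
    ∃ r > 0, ∃ ε > 0, ∃ κ > 0, ∀ q v : Eu n, ‖q - q0‖ ≤ r → ⟪p0, v⟫ + κ * ‖v‖ ^ 2 - a + ε ≤ S.L (q, v) := by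
  set ε := (a - S.H (q0, p0)) / 3 with hε
  have hεp : 0 < ε := by rw [hε]; linarith
  have hc : Continuous fun q => S.H (q, p0) := S.cH.comp (by fun_prop)
  have h1 : ∀ᶠ q in 𝓝 q0, S.H (q, p0) < a - 2 * ε := hc.continuousAt.eventually (gt_mem_nhds (by rw [hε]; linarith))
  obtain ⟨r, hr, hrr⟩ := Metric.eventually_nhds_iff.1 h1
  set D := S.C * (1 + ‖p0‖) with hD
  have hC := S.C_pos
  have hDp : 0 < D := by positivity
  set C2 := S.C + D ^ 2 / (4 * ε) with hC2
  have hC2p : 0 < C2 := by positivity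
  refine ⟨r / 2, by positivity, ε, hεp, 1 / (4 * C2), by positivity, fun q v hq => ?_⟩
  have h2 : S.H (q, p0) < a - 2 * ε := hrr (by rw [dist_eq_norm]; linarith)
  set w := (1 / (2 * C2)) • v with hw
  have h3 := S.convex_ineq q (p0 + w) p0
  have h4 : S.H (q, p0 + w) ≤ a - ε + C2 * ‖w‖ ^ 2 := by
    have e : p0 - (p0 + w) = -w := by abel
    rw [e, inner_neg_right] at h3
    have h5 := real_inner_le_norm (S.Hp (q, p0 + w)) w
    have h6 := S.Hp_le q (p0 + w)
    have h7 := norm_add_le p0 w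
    have h8 : ‖S.Hp (q, p0 + w)‖ * ‖w‖ ≤ (D + S.C * ‖w‖) * ‖w‖ := by
      refine mul_le_mul_of_nonneg_right ?_ (norm_nonneg _)
      rw [hD]; nlinarith
    have h9 : D * ‖w‖ ≤ ε + D ^ 2 / (4 * ε) * ‖w‖ ^ 2 := by
      have : 0 ≤ (2 * ε - D * ‖w‖) ^ 2 / (4 * ε) := by positivity
      have e2 : (2 * ε - D * ‖w‖) ^ 2 / (4 * ε) = ε - D * ‖w‖ + D ^ 2 / (4 * ε) * ‖w‖ ^ 2 := by
        field_simp; ring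
      linarith
    rw [hC2]; nlinarith
  have h5 := S.L_ge q v (p0 + w)
  have e1 : ⟪p0 + w, v⟫ = ⟪p0, v⟫ + 1 / (2 * C2) * ‖v‖ ^ 2 := by
    rw [inner_add_left, hw, real_inner_smul_left, real_inner_self_eq_norm_sq]
  have e2 : C2 * ‖w‖ ^ 2 = 1 / (4 * C2) * ‖v‖ ^ 2 := by
    rw [hw, norm_smul, Real.norm_eq_abs, abs_of_pos (by positivity)]; field_simp; ring
  have e3 : 1 / (2 * C2) * ‖v‖ ^ 2 = 2 * (1 / (4 * C2) * ‖v‖ ^ 2) := by field_simp; ring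
  linarith

theorem wall_est (q0 p0 : Eu n) (a : ℝ) (h : S.H (q0, p0) < a) :
    ∃ sδ d0 : ℝ, 0 < d0 ∧ ∀ (N : ℕ) [NeZero N] (k : ℝ) (z : XX N n), a ≤ k → z.1 0 = q0 → z.2 = sδ →
      d0 ≤ Fn S G k z := by
  obtain ⟨r, hr, ε, hε, κ, hκ, hL⟩ := wall_L S q0 p0 a h
  have hC := S.C_pos
  have hK := G.K_pos
  set D := ε + S.C + |a| with hD
  have hDp : 0 < D := by positivity
  set δ := min 1 (min (κ / G.K) (min (1 / (8 * S.C) / G.K) (r ^ 2 / (8 * S.C) / D))) with hδ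
  have hδp : 0 < δ := by positivity
  have hδ1 : δ ≤ 1 := min_le_left _ _
  have hδ2 : G.K * δ ≤ κ := by
    have : δ ≤ κ / G.K := (min_le_right _ _).trans (min_le_left _ _)
    rw [le_div_iff₀ hK] at this; linarith
  have hδ3 : G.K * δ ≤ 1 / (8 * S.C) := by
    have : δ ≤ 1 / (8 * S.C) / G.K := (min_le_right _ _).trans ((min_le_right _ _).trans (min_le_left _ _))
    rw [le_div_iff₀ hK] at this; linarith
  have hδ4 : δ * D ≤ r ^ 2 / (8 * S.C) := by
    have : δ ≤ r ^ 2 / (8 * S.C) / D := (min_le_right _ _).trans ((min_le_right _ _).trans (min_le_right _ _))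
    rwa [le_div_iff₀ hDp] at this
  refine ⟨Real.log δ, ε * δ, by positivity, fun N _ k z hk hz1 hz2 => ?_⟩
  have hN := N_pos (N := N)
  have hT : Real.exp z.2 = δ := by rw [hz2, Real.exp_log hδp]
  have hW := Wn_nonneg z
  have hls := len_sq_le z
  have hak : a * δ ≤ k * δ := by gcongr
  by_cases hall : ∀ i, ‖z.1 i - q0‖ ≤ r
  · have h1 : ∑ i, (⟪p0, z.1 (i + 1) - z.1 i⟫ + Real.exp z.2 / N * ((ε - a) + κ * ‖vel z i‖ ^ 2)) ≤
        ∑ i, Real.exp z.2 / N * S.L (z.1 i, vel z i) := by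
      refine Finset.sum_le_sum fun i _ => ?_
      rw [dif_eq, real_inner_smul_right, ← mul_add]
      refine mul_le_mul_of_nonneg_left ?_ (by positivity)
      have := hL (z.1 i) (vel z i) (hall i)
      linarith
    rw [Finset.sum_add_distrib, sum_tau, ← inner_sum, Finset.sum_sub_distrib, sum_shift, sub_self, inner_zero_right,
      zero_add] at h1
    have h2 := (abs_le.1 (G.M_le z.1)).1
    have h3 : G.K * len z.1 ^ 2 ≤ G.K * (Real.exp z.2 ^ 2 * Wn z) := by gcongr
    rw [Fn, act]
    rw [hT] at *
    have h4 : G.K * δ * (δ * Wn z) ≤ κ * (δ * Wn z) := by gcongr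
    nlinarith
  · push Not at hall
    obtain ⟨i, hi⟩ := hall
    have h1 : r ≤ len z.1 := by
      have := dist_zero_le_len z.1 i
      rw [hz1] at this; linarith
    have h2 : r ^ 2 ≤ Real.exp z.2 ^ 2 * Wn z := le_trans (by gcongr) hls
    have h3 := act_ge S G z
    rw [Fn]
    rw [hT] at *
    have h4 : G.K * δ * (δ * Wn z) ≤ 1 / (8 * S.C) * (δ * Wn z) := by gcongr
    have h5 : δ ^ 2 * Wn z ≤ δ * Wn z := by nlinarith [mul_nonneg hδp.le hW]
    have h6 : r ^ 2 / (8 * S.C) ≤ 1 / (8 * S.C) * (δ * Wn z) := by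
      rw [div_eq_mul_one_div, mul_comm]
      refine mul_le_mul_of_nonneg_left ?_ (by positivity)
      linarith
    have h7 : 1 / (4 * S.C) * Wn z * δ = 2 * (1 / (8 * S.C) * (δ * Wn z)) := by field_simp; ring
    have h8 : -|a| ≤ a := neg_abs_le a
    have h9 : -|a| * δ ≤ a * δ := by gcongr
    rw [hD] at hδ4
    nlinarith

end
end Torb

set_option linter.unusedSectionVars false
namespace Torb
open MeasureTheory Set Metric Filter Topology
open scoped RealInnerProductSpace ContDiff

theorem norm_le_card {n : ℕ} (x : Eu n) (D : ℝ) (hD : 0 ≤ D) (h : ∀ j, |x j| ≤ D) : ‖x‖ ≤ n * D := by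
  rw [EuclideanSpace.norm_eq]
  refine Real.sqrt_le_iff.2 ⟨by positivity, ?_⟩
  calc ∑ j, ‖x j‖ ^ 2 ≤ ∑ _j : Fin n, D ^ 2 := by
        refine Finset.sum_le_sum fun j _ => ?_
        have := h j
        rw [Real.norm_eq_abs]; gcongr
    _ = n * D ^ 2 := by simp
    _ ≤ (n * D) ^ 2 := by
        rw [mul_pow]
        refine mul_le_mul_of_nonneg_right ?_ (sq_nonneg _)
        rcases Nat.eq_zero_or_pos n with h0 | h0
        · simp [h0]
        · have : (1:ℝ) ≤ n := by exact_mod_cast h0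
          nlinarith

/-- one-dimensional motion -/
noncomputable def phi1 (S r t f : ℝ) : ℝ := max (min (min t S - S * max 0 (1 - f / r)) (1 - f)) 0

noncomputable def psi1 (S r c x t : ℝ) : ℝ := x + phi1 S r t (Int.fract (x - c))

section
variable {S r c : ℝ}

theorem psi1_cont (hS : 0 ≤ S) : Continuous fun y : ℝ × ℝ => psi1 S r c y.1 y.2 := by
  refine continuous_fst.add ?_
  refine ContinuousOn.comp_fract (f := fun (y : ℝ × ℝ) f => phi1 S r y.2 f) ?_ (by fun_prop) ?_
  · unfold phi1 Function.uncurry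
    refine Continuous.continuousOn ?_
    fun_prop
  · intro y
    unfold phi1
    rw [max_eq_right, max_eq_right]
    · refine (min_le_right _ _).trans (by simp)
    · refine (min_le_left _ _).trans ?_
      simp

theorem psi1_add (x t : ℝ) (m : ℤ) : psi1 S r c (x + m) t = psi1 S r c x t + m := by
  unfold psi1
  rw [show x + m - c = x - c + m by ring, Int.fract_add_intCast]
  ring

theorem psi1_zero (hS : 0 ≤ S) (x : ℝ) : psi1 S r c x 0 = x := by
  unfold psi1 phi1
  rw [max_eq_right, add_zero]
  refine (min_le_left _ _).trans ?_
  have : 0 ≤ S * max 0 (1 - Int.fract (x - c) / r) := mul_nonneg hS (le_max_left _ _)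
  have := min_le_left 0 S
  linarith

theorem psi1_lip (x t t' : ℝ) : |psi1 S r c x t - psi1 S r c x t'| ≤ |t - t'| := by
  unfold psi1 phi1
  rw [add_sub_add_left_eq_sub]
  refine (abs_max_sub_max_le_abs _ _ _).trans ((abs_min_sub_min_le_max _ _ _ _).trans ?_)
  rw [sub_self, abs_zero, max_eq_left (abs_nonneg _), sub_sub_sub_cancel_right]
  refine (abs_min_sub_min_le_max _ _ _ _).trans ?_
  rw [sub_self, abs_zero, max_eq_left (abs_nonneg _)]

theorem psi1_good (hS : 0 ≤ S) (hr : 0 < r) (x : ℝ) : ∃ d : ℝ, (∀ t, 0 ≤ t → t ≤ S → t < d →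
      psi1 S r c x t = x ∧ ∃ m : ℤ, |x - c - m| ≤ r) ∧
    ∃ m : ℤ, ∀ t, t ≤ S → d + 1 ≤ t → psi1 S r c x t = c + m := by
  set f := Int.fract (x - c) with hf
  have hf0 : 0 ≤ f := Int.fract_nonneg _
  have hf1 : f < 1 := Int.fract_lt_one _
  refine ⟨S * max 0 (1 - f / r), ?_, ⌊x - c⌋ + 1, ?_⟩
  · intro t ht0 htS htd
    constructor
    · unfold psi1 phi1
      rw [max_eq_right, add_zero]
      refine (min_le_left _ _).trans ?_
      rw [min_eq_left htS]; linarith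
    · have h1 : 0 < max 0 (1 - f / r) := by
        by_contra hc
        push Not at hc
        nlinarith
      have h2 : 0 < 1 - f / r := by
        rcases lt_max_iff.1 h1 with h | h
        · exact absurd h (lt_irrefl _)
        · exact h
      have h3 : f < r := by
        rw [sub_pos, div_lt_one hr] at h2; exact h2
      refine ⟨⌊x - c⌋, ?_⟩
      rw [show x - c - ⌊x - c⌋ = f from rfl, abs_of_nonneg hf0]; exact h3.le
  · intro t htS htd
    unfold psi1 phi1
    rw [← hf, min_eq_left htS, min_eq_right (by linarith), max_eq_left (by linarith)]
    have := Int.floor_add_fract (x - c)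
    push_cast
    rw [← hf] at this
    linarith
end

section
variable {N : ℕ} [NeZero N]

/-- tent function on indices -/
noncomputable def tent (i : ZMod N) : ℝ := min (i.val : ℝ) (N - i.val)

theorem val_succ (i : ZMod N) : (i + 1).val = i.val + 1 ∨ (i.val + 1 = N ∧ (i + 1).val = 0) := by
  have h : (i + 1).val = (i.val + 1) % N := by
    rw [ZMod.val_add, ZMod.val_one_eq_one_mod, Nat.add_mod_mod]
  have h2 := ZMod.val_lt i
  rcases Nat.lt_or_ge (i.val + 1) N with h3 | h3
  · left; rw [h, Nat.mod_eq_of_lt h3]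
  · right
    have : i.val + 1 = N := by omega
    exact ⟨this, by rw [h, this, Nat.mod_self]⟩

theorem tent_nonneg (i : ZMod N) : 0 ≤ tent i := by
  have h2 : (i.val : ℝ) < N := by exact_mod_cast ZMod.val_lt i
  exact le_min (by positivity) (by linarith)

theorem tent_le (i : ZMod N) : tent i ≤ N / 2 := by
  unfold tent
  rcases le_total (i.val : ℝ) (N / 2) with h | h
  · exact (min_le_left _ _).trans h
  · exact (min_le_right _ _).trans (by linarith)

theorem tent_lip (i : ZMod N) : |tent (i + 1) - tent i| ≤ 1 := by
  unfold tent
  rcases val_succ i with h | ⟨h1, h2⟩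
  · rw [h]
    push_cast
    refine (abs_min_sub_min_le_max _ _ _ _).trans (max_le ?_ ?_)
    · simp
    · rw [show (N : ℝ) - (i.val + 1) - (N - i.val) = -1 by ring]; simp
  · rw [h2]
    have h3 : (N : ℝ) = i.val + 1 := by exact_mod_cast h1.symm
    rw [h3, show (i.val : ℝ) + 1 - i.val = 1 by ring, Nat.cast_zero, min_eq_left (by linarith [Nat.cast_nonneg (α := ℝ) i.val]), zero_sub, abs_neg]
    rw [abs_of_nonneg (le_min (by positivity) (by norm_num))]
    exact min_le_right _ _

/-- time spent in a window -/
theorem window_aux (τ α : ℝ) (hτ : 0 ≤ τ) (hτ1 : τ ≤ 1) (M : ℕ) :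
    ∑ j ∈ Finset.range M, (if τ * j ∈ Ioo α (α + 3) then τ else 0) ≤ 4 := by
  set g : ℝ → ℝ := fun t => max α (min t (α + 4)) with hg
  have h1 : ∀ j ∈ Finset.range M, (if τ * (j:ℝ) ∈ Ioo α (α + 3) then τ else 0) ≤ g (τ * ((j + 1 : ℕ) : ℝ)) - g (τ * (j:ℝ)) := by
    intro j _
    push_cast
    split_ifs with h
    · obtain ⟨h2, h3⟩ := h
      simp only [hg]
      rw [min_eq_left (by linarith), min_eq_left (by linarith), max_eq_right (by linarith), max_eq_right (by linarith)]
      linarith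
    · refine sub_nonneg.2 ?_
      simp only [hg]
      refine max_le_max le_rfl (min_le_min ?_ le_rfl)
      linarith
  refine (Finset.sum_le_sum h1).trans ?_
  rw [Finset.sum_range_sub (fun j : ℕ => g (τ * (j:ℝ)))]
  have h2 : g (τ * (M:ℝ)) ≤ α + 4 := max_le (by linarith) (min_le_right _ _)
  have h3 : α ≤ g (τ * ((0:ℕ):ℝ)) := le_max_left _ _
  linarith

theorem window (τ α : ℝ) (hτ : 0 ≤ τ) (hτ1 : τ ≤ 1) :
    ∑ i : ZMod N, (if τ * tent i ∈ Ioo α (α + 3) then τ else 0) ≤ 8 := by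
  have h1 : ∀ i : ZMod N, (if τ * tent i ∈ Ioo α (α + 3) then τ else 0) ≤
      (if τ * i.val ∈ Ioo α (α + 3) then τ else 0) +
        (if τ * i.val ∈ Ioo (τ * N - α - 3) (τ * N - α - 3 + 3) then τ else 0) := by
    intro i
    have hn1 : 0 ≤ (if τ * i.val ∈ Ioo α (α + 3) then τ else 0) := by split_ifs <;> simp [hτ]
    have hn2 : 0 ≤ (if τ * i.val ∈ Ioo (τ * N - α - 3) (τ * N - α - 3 + 3) then τ else 0) := by
      split_ifs <;> simp [hτ]
    by_cases h : τ * tent i ∈ Ioo α (α + 3)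
    · rw [if_pos h]
      rcases min_choice (i.val : ℝ) (N - i.val) with e | e
      · rw [tent, e] at h
        rw [if_pos h]; linarith
      · rw [tent, e] at h
        rw [if_pos (c := τ * i.val ∈ Ioo (τ * N - α - 3) (τ * N - α - 3 + 3))]
        · linarith
        · obtain ⟨h2, h3⟩ := h
          constructor <;> nlinarith
    · rw [if_neg h]; positivity
  refine (Finset.sum_le_sum fun i _ => h1 i).trans ?_
  rw [Finset.sum_add_distrib]
  have h2 : ∀ β : ℝ, ∑ i : ZMod N, (if τ * i.val ∈ Ioo β (β + 3) then τ else 0) ≤ 4 := by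
    intro β
    rw [← sum_range_zmod]
    refine le_trans (le_of_eq ?_) (window_aux τ β hτ hτ1 N)
    refine Finset.sum_congr rfl fun j hj => ?_
    rw [ZMod.val_cast_of_lt (Finset.mem_range.1 hj)]
  linarith [h2 α, h2 (τ * N - α - 3)]

end
end Torb

set_option linter.unusedSectionVars false
namespace Torb
open MeasureTheory Set Metric Filter Topology
open scoped RealInnerProductSpace ContDiff

section
variable {n : ℕ}

noncomputable def Gam (N : ℕ) (q1 : Eu n) (r s0 s1 : ℝ) (y : Eu n × ℝ) : XX N n :=
  (fun i => WithLp.toLp 2 (fun j => psi1 (Real.exp s1 / 2) r (q1 j) (y.1 j) (y.2 * (Real.exp s1 / N) * tent i)),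
    s0 + y.2 * (s1 - s0))

variable {N : ℕ} [NeZero N] {q1 : Eu n} {r s0 s1 : ℝ}

theorem Gam_cont : Continuous (Gam N q1 r s0 s1) := by
  unfold Gam
  refine Continuous.prodMk (continuous_pi fun i => ?_) (by fun_prop)
  refine (PiLp.continuous_toLp 2 _).comp (continuous_pi fun j => ?_)
  exact (psi1_cont (S := Real.exp s1 / 2) (r := r) (c := q1 j) (by positivity)).comp
    (g := fun y : ℝ × ℝ => psi1 (Real.exp s1 / 2) r (q1 j) y.1 y.2)
    (f := fun y : Eu n × ℝ => (y.1 j, y.2 * (Real.exp s1 / N) * tent i)) (by fun_prop)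

theorem Gam_equi (m : Fin n → ℤ) (q : Eu n) (s : ℝ) :
    Gam N q1 r s0 s1 (q + lat m, s) = Gam N q1 r s0 s1 (q, s) + tr m := by
  unfold Gam tr
  refine Prod.ext ?_ (by simp)
  funext i
  ext j
  simp [lat_apply, psi1_add]

theorem Gam_zero (q : Eu n) : Gam N q1 r s0 s1 (q, 0) = (fun _ => q, s0) := by
  unfold Gam
  refine Prod.ext ?_ (by simp)
  funext i
  ext j
  simp [psi1_zero (S := Real.exp s1 / 2) (r := r) (c := q1 j) (by positivity)]

theorem Gam_dif (q : Eu n) (s : ℝ) (hs : 0 ≤ s) (i : ZMod N) :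
    ‖(Gam N q1 r s0 s1 (q, s)).1 (i + 1) - (Gam N q1 r s0 s1 (q, s)).1 i‖ ≤ n * (s * (Real.exp s1 / N)) := by
  have hN := N_pos (N := N)
  refine norm_le_card _ _ (by positivity) fun j => ?_
  simp only [Gam, PiLp.sub_apply]
  refine (psi1_lip _ _ _).trans ?_
  rw [← mul_sub, abs_mul, abs_of_nonneg (by positivity)]
  have := tent_lip i
  have h2 : 0 ≤ s * (Real.exp s1 / N) := by positivity
  nlinarith

theorem Gam_vel (q : Eu n) (s : ℝ) (hs : 0 ≤ s) (i : ZMod N) :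
    ‖vel (Gam N q1 r s0 s1 (q, s)) i‖ ≤ n * (s * Real.exp (s1 - (s0 + s * (s1 - s0)))) := by
  have hN := N_pos (N := N)
  have h := Gam_dif (N := N) (q1 := q1) (r := r) (s0 := s0) (s1 := s1) q s hs i
  rw [norm_dif] at h
  have e : (Gam N q1 r s0 s1 (q, s)).2 = s0 + s * (s1 - s0) := rfl
  rw [e] at h
  rw [Real.exp_sub]
  have hp := Real.exp_pos (s0 + s * (s1 - s0))
  rw [← mul_div_assoc, ← mul_div_assoc, le_div_iff₀ hp]
  have h2 := mul_le_mul_of_nonneg_right h hN.le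
  have e1 : Real.exp (s0 + s * (s1 - s0)) / N * ‖vel (Gam N q1 r s0 s1 (q, s)) i‖ * N =
    ‖vel (Gam N q1 r s0 s1 (q, s)) i‖ * Real.exp (s0 + s * (s1 - s0)) := by field_simp
  have e2 : (n:ℝ) * (s * (Real.exp s1 / N)) * N = n * (s * Real.exp s1) := by field_simp
  linarith

theorem Wn_le (z : XX N n) (D : ℝ) (h : ∀ i, ‖vel z i‖ ≤ D) : Wn z ≤ D ^ 2 := by
  have hN := N_pos (N := N)
  rw [Wn, div_le_iff₀ hN]
  calc ∑ i, ‖vel z i‖ ^ 2 ≤ ∑ _i : ZMod N, D ^ 2 := by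
        refine Finset.sum_le_sum fun i _ => ?_
        have := h i
        gcongr
    _ = D ^ 2 * N := by rw [Finset.sum_const, Finset.card_univ, ZMod.card, nsmul_eq_mul]; ring

variable (S : Ham n) (G : Mag n)

theorem near_L (q1 : Eu n) (b : ℝ) (h : ∀ p, b < S.H (q1, p)) : ∃ r > 0, ∃ η > 0, ∀ q : Eu n, ∀ m : Fin n → ℤ,
    (∀ j, |q j - q1 j - m j| ≤ r) → S.L (q, 0) + b ≤ -η := by
  have h1 : S.L (q1, 0) + b < 0 := by
    have := h (S.P (q1, 0))
    simp only [Ham.L, inner_zero_right]; linarith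
  set η := -(S.L (q1, 0) + b) / 2 with hη
  have hc : Continuous fun q => S.L (q, 0) + b := (S.cL.comp (by fun_prop)).add continuous_const
  have h2 : ∀ᶠ q in 𝓝 q1, S.L (q, 0) + b < -η := hc.continuousAt.eventually (gt_mem_nhds (by rw [hη]; linarith))
  obtain ⟨r, hr, hrr⟩ := Metric.eventually_nhds_iff.1 h2
  refine ⟨r / (n + 1), by positivity, η, by rw [hη]; linarith, fun q m hm => ?_⟩
  have h3 : ‖q - lat m - q1‖ ≤ n * (r / (n + 1)) := by
    refine norm_le_card _ _ (by positivity) fun j => ?_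
    have := hm j
    simp only [PiLp.sub_apply, lat_apply]
    rwa [sub_right_comm]
  have h4 : (n:ℝ) * (r / (n + 1)) < r := by
    rw [← mul_div_assoc, div_lt_iff₀ (by positivity)]; nlinarith
  have h5 := hrr (y := q - lat m) (by rw [dist_eq_norm]; linarith)
  have h6 := S.perL m (q - lat m) 0
  rw [sub_add_cancel] at h6
  rw [h6]; exact h5.le

theorem Gam_one (q1 : Eu n) (r η s0 s1 b D k : ℝ) (hr : 0 < r) (hη : 0 < η) (hD : 0 ≤ D)
    (hL : ∀ q : Eu n, ∀ m : Fin n → ℤ, (∀ j, |q j - q1 j - m j| ≤ r) → S.L (q, 0) + b ≤ -η)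
    (hk : k ≤ b) (hDk : CL S * (1 + n ^ 2) + k ≤ D) (hN1 : Real.exp s1 < N) (q : Eu n) :
    Fn S G k (Gam N q1 r s0 s1 (q, 1)) ≤ -(Real.exp s1 * η) + (D + η) * (8 * n) + G.K * (n * (8 * n)) ^ 2 := by
  classical
  have hN := N_pos (N := N)
  set τ := Real.exp s1 / N with hτ
  have hτ0 : 0 < τ := by positivity
  have hτ1 : τ < 1 := by rwa [hτ, div_lt_one hN]
  set z := Gam N q1 r s0 s1 (q, 1) with hz
  have hz2 : z.2 = s1 := by rw [hz]; simp [Gam]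
  have hzx : ∀ i j, z.1 i j = psi1 (Real.exp s1 / 2) r (q1 j) (q j) (τ * tent i) := by
    intro i j; rw [hz]; simp [Gam, hτ]
  have ht0 : ∀ i : ZMod N, 0 ≤ τ * tent i := fun i => mul_nonneg hτ0.le (tent_nonneg i)
  have ht1 : ∀ i : ZMod N, τ * tent i ≤ Real.exp s1 / 2 := by
    intro i
    have := mul_le_mul_of_nonneg_left (tent_le i) hτ0.le
    rwa [hτ, show Real.exp s1 / N * (N / 2) = Real.exp s1 / 2 by field_simp, ← hτ] at this
  have htl : ∀ i : ZMod N, |τ * tent (i + 1) - τ * tent i| ≤ τ := by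
    intro i
    rw [← mul_sub, abs_mul, abs_of_pos hτ0]
    have := tent_lip i
    nlinarith
  have hgood := fun j => psi1_good (S := Real.exp s1 / 2) (r := r) (c := q1 j) (by positivity) hr (q j)
  choose d hd1 hd2 using hgood
  choose m hm using hd2
  set w : ZMod N → ℝ := fun i => ∑ j, if τ * tent i ∈ Ioo (d j - 1) (d j - 1 + 3) then τ else 0 with hw
  have hw0 : ∀ i, 0 ≤ w i := fun i => Finset.sum_nonneg fun j _ => by split_ifs <;> linarith
  have hwsum : ∑ i, w i ≤ 8 * n := by
    rw [hw, Finset.sum_comm]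
    calc _ ≤ ∑ _j : Fin n, (8:ℝ) := Finset.sum_le_sum fun j _ => window τ (d j - 1) hτ0.le hτ1.le
      _ = 8 * n := by simp [mul_comm]
  have key : ∀ i, ‖z.1 (i + 1) - z.1 i‖ ≤ n * w i ∧
      τ * (S.L (z.1 i, vel z i) + k) ≤ -(τ * η) + (D + η) * w i := by
    intro i
    by_cases hb : ∃ j, τ * tent i ∈ Ioo (d j - 1) (d j - 1 + 3)
    · obtain ⟨j, hj⟩ := hb
      have hwi : τ ≤ w i := by
        have := Finset.single_le_sum (f := fun j => if τ * tent i ∈ Ioo (d j - 1) (d j - 1 + 3) then τ else 0)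
          (fun j _ => by split_ifs <;> linarith) (Finset.mem_univ j)
        simp only [if_pos hj] at this
        exact this
      have hdif := Gam_dif (N := N) (q1 := q1) (r := r) (s0 := s0) (s1 := s1) q 1 zero_le_one i
      have hv := Gam_vel (N := N) (q1 := q1) (r := r) (s0 := s0) (s1 := s1) q 1 zero_le_one i
      rw [← hz, ← hτ, one_mul] at hdif
      rw [← hz, show s1 - (s0 + 1 * (s1 - s0)) = 0 by ring, Real.exp_zero, mul_one, mul_one] at hv
      constructor
      · refine hdif.trans ?_
        gcongr
      · have h1 := S.L_le (z.1 i) (vel z i)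
        have h2 : S.L (z.1 i, vel z i) + k ≤ D := by
          have : CL S * (1 + ‖vel z i‖ ^ 2) ≤ CL S * (1 + n ^ 2) := by
            have := CL_pos S
            gcongr
          unfold CL at *
          linarith
        have h3 : τ * (S.L (z.1 i, vel z i) + k) ≤ τ * D := by gcongr
        have h4 : (D + η) * τ ≤ (D + η) * w i := by gcongr
        linarith
    · push Not at hb
      have hcase : ∀ j, z.1 (i + 1) j = z.1 i j ∧ ∃ mm : ℤ, |z.1 i j - q1 j - mm| ≤ r := by
        intro j
        rw [hzx, hzx]
        have hl := abs_le.1 (htl i)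
        have hbj := hb j
        rw [mem_Ioo, not_and_or] at hbj
        rcases hbj with h | h
        · have e1 := hd1 j _ (ht0 i) (ht1 i) (by linarith)
          have e2 := hd1 j _ (ht0 (i + 1)) (ht1 (i + 1)) (by linarith)
          rw [e1.1, e2.1]
          exact ⟨rfl, e1.2⟩
        · have e1 := hm j _ (ht1 i) (by linarith)
          have e2 := hm j _ (ht1 (i + 1)) (by linarith)
          rw [e1, e2]
          refine ⟨rfl, m j, ?_⟩
          rw [show q1 j + m j - q1 j - m j = 0 by ring, abs_zero]; exact hr.le
      have hx : z.1 (i + 1) = z.1 i := by ext j; exact (hcase j).1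
      have hv : vel z i = 0 := by rw [vel, hx, sub_self, smul_zero]
      choose mm hmm using fun j => (hcase j).2
      have h1 := hL (z.1 i) mm hmm
      constructor
      · rw [hx, sub_self, norm_zero]
        exact mul_nonneg (Nat.cast_nonneg _) (hw0 i)
      · rw [hv]
        have h2 : τ * (S.L (z.1 i, 0) + k) ≤ τ * (-η) := by gcongr; linarith
        have h3 : 0 ≤ (D + η) * w i := mul_nonneg (by positivity) (hw0 i)
        linarith
  have hlen : len z.1 ≤ n * (8 * n) := by
    calc len z.1 ≤ ∑ i, n * w i := Finset.sum_le_sum fun i _ => (key i).1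
      _ = n * ∑ i, w i := by rw [Finset.mul_sum]
      _ ≤ _ := by gcongr
  have hM := (abs_le.1 (G.M_le z.1)).2
  have hM2 : G.K * len z.1 ^ 2 ≤ G.K * (n * (8 * n)) ^ 2 := by
    have := G.K_pos
    have := len_nonneg z.1
    gcongr
  have hsum : ∑ i, τ * (S.L (z.1 i, vel z i) + k) ≤ ∑ i, (-(τ * η) + (D + η) * w i) :=
    Finset.sum_le_sum fun i _ => (key i).2
  have e1 : ∑ i, τ * (S.L (z.1 i, vel z i) + k) = (∑ i, τ * S.L (z.1 i, vel z i)) + Real.exp s1 * k := by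
    simp only [mul_add, Finset.sum_add_distrib]
    rw [Finset.sum_const, Finset.card_univ, ZMod.card, nsmul_eq_mul, hτ]
    field_simp
  have e2 : ∑ i, (-(τ * η) + (D + η) * w i) = -(Real.exp s1 * η) + (D + η) * ∑ i, w i := by
    rw [Finset.sum_add_distrib, ← Finset.mul_sum, Finset.sum_const, Finset.card_univ, ZMod.card, nsmul_eq_mul, hτ]
    field_simp
  have h8 : (D + η) * ∑ i, w i ≤ (D + η) * (8 * n) := by gcongr
  rw [Fn, act, hz2, ← hτ]
  linarith

theorem exists_fam (q0 p0 q1 : Eu n) (a b : ℝ) (h0 : S.H (q0, p0) < a) (h1 : ∀ p, b < S.H (q1, p)) :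
    ∃ (sδ d0 A : ℝ) (N0 : ℕ) (Γ : ∀ N : ℕ, Eu n × ℝ → XX N n), ∀ (N : ℕ) [NeZero N], N0 ≤ N →
      Fam S G (Γ N) q0 sδ a b d0 A := by
  obtain ⟨sδ, d0, hd0, hwall⟩ := wall_est S G q0 p0 a h0
  obtain ⟨r, hr, η, hη, hL⟩ := near_L S q1 b h1
  have hCL := CL_pos S
  have hK := G.K_pos
  set E := CL S + |a| + |b| with hE
  have hEp : 0 < E := by positivity
  set s0 := min (sδ - 1) (Real.log (d0 / 2 / E)) with hs0
  set D := CL S * (1 + n ^ 2) + |b| with hD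
  have hDp : 0 ≤ D := by positivity
  set Q := ((D + η) * (8 * n) + G.K * (n * (8 * n)) ^ 2) / η + 1 with hQ
  have hQp : 0 < Q := by positivity
  set s1 := max (sδ + 1) (Real.log Q) with hs1
  have hs0δ : s0 < sδ := (min_le_left _ _).trans_lt (by linarith)
  have hs1δ : sδ < s1 := lt_of_lt_of_le (by linarith) (le_max_left _ _)
  obtain ⟨N0, hN0⟩ := exists_nat_gt (Real.exp s1)
  set V := (n:ℝ) * Real.exp (s1 - s0) with hV
  set A := Real.exp s1 * (CL S * (1 + V ^ 2)) + G.K * Real.exp s1 ^ 2 * V ^ 2 + |b| * Real.exp s1 with hA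
  refine ⟨sδ, d0, A, N0, fun N => Gam N q1 r s0 s1, fun N hNe hN => ?_⟩
  beta_reduce
  have hNN : Real.exp s1 < N := lt_of_lt_of_le hN0 (by exact_mod_cast hN)
  refine ⟨Gam_cont, Gam_equi, fun q => ?_, fun q => ?_, hd0, fun k hk q => ?_, fun k hk q => ?_, fun k hk q s hs => ?_,
    fun k hk z => hwall N k z hk.1⟩
  · rw [Gam_zero]; exact hs0δ
  · simp only [Gam]
    rw [one_mul, add_sub_cancel]; exact hs1δ
  · rw [Gam_zero]
    have h3 := act_le S G ((fun _ => q, s0) : XX N n)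
    have h4 : Wn ((fun _ => q, s0) : XX N n) = 0 := by simp [Wn, vel]
    rw [h4] at h3
    have h5 : Real.exp s0 ≤ d0 / 2 / E := by
      rw [← Real.exp_log (show 0 < d0 / 2 / E by positivity)]
      exact Real.exp_le_exp.2 (min_le_right _ _)
    rw [le_div_iff₀ hEp] at h5
    rw [Fn]
    have h6 : k ≤ |a| + |b| := by linarith [hk.2, le_abs_self b, abs_nonneg a]
    have h7 : k * Real.exp s0 ≤ (|a| + |b|) * Real.exp s0 := by gcongr
    simp only at *
    rw [hE] at h5
    nlinarith
  · refine (Gam_one S G q1 r η s0 s1 b D k hr hη hDp hL hk.2 ?_ hNN q).trans ?_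
    · rw [hD]; linarith [hk.2, le_abs_self b]
    · have h5 : Q ≤ Real.exp s1 := by
        rw [← Real.exp_log hQp]
        exact Real.exp_le_exp.2 (le_max_right _ _)
      have h6 : ((D + η) * (8 * n) + G.K * (n * (8 * n)) ^ 2) / η ≤ Real.exp s1 := by linarith
      rw [div_le_iff₀ hη] at h6
      linarith
  · set z := Gam N q1 r s0 s1 (q, s) with hz
    have hv : ∀ i, ‖vel z i‖ ≤ V := by
      intro i
      refine (Gam_vel q s hs.1 i).trans ?_
      rw [hV]
      have : Real.exp (s1 - (s0 + s * (s1 - s0))) ≤ Real.exp (s1 - s0) := by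
        refine Real.exp_le_exp.2 ?_
        nlinarith [mul_nonneg hs.1 (show 0 ≤ s1 - s0 by linarith)]
      have h3 : s * Real.exp (s1 - (s0 + s * (s1 - s0))) ≤ 1 * Real.exp (s1 - s0) :=
        mul_le_mul hs.2 this (Real.exp_pos _).le zero_le_one
      rw [one_mul] at h3
      gcongr
    have hW := Wn_le z V hv
    have hW0 := Wn_nonneg z
    have h3 := act_le S G z
    have h4 : Real.exp z.2 ≤ Real.exp s1 := by
      refine Real.exp_le_exp.2 ?_
      simp only [hz, Gam]
      nlinarith [hs.2]
    have h5 : Real.exp z.2 * (CL S * (1 + Wn z)) + G.K * Real.exp z.2 ^ 2 * Wn z ≤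
      Real.exp s1 * (CL S * (1 + V ^ 2)) + G.K * Real.exp s1 ^ 2 * V ^ 2 := by gcongr
    have h6 : k * Real.exp z.2 ≤ |b| * Real.exp s1 :=
      mul_le_mul (by linarith [hk.2, le_abs_self b]) h4 (Real.exp_pos _).le (abs_nonneg _)
    rw [Fn, hA]
    linarith

end
end Torb

set_option linter.unusedSectionVars false
namespace Torb
open MeasureTheory Set Metric Filter Topology
open scoped RealInnerProductSpace ContDiff

section
variable {Y : Type*} [NormedAddCommGroup Y] [NormedSpace ℝ Y]

theorem tele_nat (y : ℤ → Y) (f : Y) (τ ε : ℝ) (a : ℤ) (m : ℕ)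
    (h : ∀ i : ℤ, a ≤ i → i < a + m → ‖y (i + 1) - y i - τ • f‖ ≤ ε * τ) :
    ‖y (a + m) - y a - ((m:ℝ) * τ) • f‖ ≤ m * (ε * τ) := by
  induction m with
  | zero => simp
  | succ m ih =>
    have h1 := ih fun i hi1 hi2 => h i hi1 (by push_cast; omega)
    have h2 := h (a + m) (by omega) (by push_cast; omega)
    have e : y (a + (m + 1 : ℕ)) - y a - (((m + 1 : ℕ) : ℝ) * τ) • f =
        (y (a + m) - y a - ((m:ℝ) * τ) • f) + (y (a + m + 1) - y (a + m) - τ • f) := by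
      push_cast
      rw [add_mul, one_mul, add_smul, add_assoc a]
      abel
    rw [e]
    refine (norm_add_le _ _).trans ?_
    push_cast
    linarith

theorem tele_int (y : ℤ → Y) (f : Y) (τ ε : ℝ) (a b : ℤ)
    (h : ∀ i : ℤ, |i - a| ≤ |b - a| → ‖y (i + 1) - y i - τ • f‖ ≤ ε * τ) :
    ‖y b - y a - (((b:ℝ) - a) * τ) • f‖ ≤ |(b:ℝ) - a| * (ε * τ) := by
  rcases le_total a b with hab | hab
  · obtain ⟨m, rfl⟩ := Int.le.dest hab
    have := tele_nat y f τ ε a m fun i h1 h2 => h i (by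
      rw [abs_of_nonneg (by omega), abs_of_nonneg (by omega)]; omega)
    push_cast
    rw [add_sub_cancel_left, abs_of_nonneg (by positivity)]
    exact this
  · obtain ⟨m, rfl⟩ := Int.le.dest hab
    have := tele_nat y f τ ε b m fun i h1 h2 => h i (by
      rw [abs_of_nonpos (by omega), abs_of_nonpos (by omega)]; omega)
    push_cast
    rw [show (b:ℝ) - (b + m) = -m by ring, abs_neg, abs_of_nonneg (by positivity)]
    refine le_trans (le_of_eq ?_) this
    rw [← norm_neg]
    congr 1
    rw [neg_mul, neg_smul]; abel

theorem floor_dist (x y : ℝ) : |((⌊x⌋ : ℤ) : ℝ) - ⌊y⌋| ≤ |x - y| + 1 := by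
  have h1 := Int.floor_le x
  have h2 := Int.lt_floor_add_one x
  have h3 := Int.floor_le y
  have h4 := Int.lt_floor_add_one y
  rw [abs_le]
  constructor <;> linarith [le_abs_self (x - y), neg_abs_le (x - y)]

theorem limit_orbit [ProperSpace Y] (g : Y → Y) (hg : Continuous g) (N : ℕ → ℕ) (hN : ∀ j, 0 < N j)
    (hN' : Tendsto N atTop atTop) (y : ℕ → ℤ → Y) (T : ℕ → ℝ) (Tmin Tmax R : ℝ) (hT0 : 0 < Tmin)
    (hT : ∀ j, T j ∈ Icc Tmin Tmax) (per : ∀ j i, y j (i + N j) = y j i) (hb : ∀ j i, ‖y j i‖ ≤ R)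
    (heq : ∀ ε > 0, ∀ᶠ j in atTop, ∀ i, ‖y j (i + 1) - y j i - (T j / N j) • g (y j i)‖ ≤ ε * (T j / N j)) :
    ∃ U : Ultrafilter ℕ, (U : Filter ℕ) ≤ atTop ∧ ∃ T0 ∈ Icc Tmin Tmax, ∃ Yl : ℝ → Y, Function.Periodic Yl T0 ∧
      (∀ t, HasDerivAt Yl (g (Yl t)) t) ∧
      ∀ i : ℕ → ℤ, (∀ j, 0 ≤ i j ∧ i j ≤ N j) → ∃ t, Tendsto (fun j => y j (i j)) U (𝓝 (Yl t)) := by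
  set τ : ℕ → ℝ := fun j => T j / N j with hτ
  have hNp : ∀ j, (0:ℝ) < N j := fun j => Nat.cast_pos.2 (hN j)
  have hTp : ∀ j, 0 < T j := fun j => lt_of_lt_of_le hT0 (hT j).1
  have hτp : ∀ j, 0 < τ j := fun j => div_pos (hTp j) (hNp j)
  have hτ0 : Tendsto τ atTop (𝓝 0) := by
    have h1 : Tendsto (fun j => Tmax / (N j : ℝ)) atTop (𝓝 0) :=
      (tendsto_const_div_atTop_nhds_zero_nat Tmax).comp hN'
    refine squeeze_zero (fun j => (hτp j).le) (fun j => ?_) h1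
    exact div_le_div_of_nonneg_right (hT j).2 (hNp j).le
  obtain ⟨U, hU⟩ : ∃ U : Ultrafilter ℕ, (U : Filter ℕ) ≤ atTop := ⟨Ultrafilter.of atTop, Ultrafilter.of_le _⟩
  have hτU : Tendsto τ U (𝓝 0) := hτ0.mono_left hU
  -- bound on the field
  obtain ⟨V0, hV0⟩ := (isCompact_closedBall (0 : Y) R).exists_bound_of_continuousOn hg.continuousOn
  set V := |V0| + 1 with hV
  have hVp : 0 < V := by positivity
  have hlip : ∀ᶠ j in U, ∀ a b : ℤ, ‖y j b - y j a‖ ≤ V * (|(b:ℝ) - a| * τ j) := by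
    filter_upwards [hU (heq 1 one_pos)] with j hj a b
    have h := tele_int (y j) 0 (τ j) V a b fun i _ => by
      have h1 := hj i
      have h2 := hV0 (y j i) (mem_closedBall_zero_iff.2 (hb j i))
      have e : y j (i + 1) - y j i - (τ j) • (0 : Y) = (y j (i + 1) - y j i - (τ j) • g (y j i)) + (τ j) • g (y j i) := by
        rw [smul_zero]; abel
      rw [e]
      refine (norm_add_le _ _).trans ?_
      rw [norm_smul, Real.norm_eq_abs, abs_of_pos (hτp j)]
      have h3 : τ j * ‖g (y j i)‖ ≤ τ j * |V0| := mul_le_mul_of_nonneg_left (h2.trans (le_abs_self _)) (hτp j).le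
      rw [hV]
      simp only [hτ] at *
      linarith
    rw [smul_zero, sub_zero] at h
    linarith
  -- the limits
  have hlim : ∀ t : ℝ, ∃ z, Tendsto (fun j => y j ⌊t / τ j⌋) U (𝓝 z) := by
    intro t
    obtain ⟨z, -, hz⟩ := (isCompact_closedBall (0 : Y) R).ultrafilter_le_nhds (U.map fun j => y j ⌊t / τ j⌋) (by
      rw [le_principal_iff]
      refine mem_map.2 (univ_mem' fun j => ?_)
      exact mem_closedBall_zero_iff.2 (hb j _))
    exact ⟨z, hz⟩
  choose Yl hYl using hlim
  obtain ⟨T0, hT0m, hT0l⟩ := (isCompact_Icc (a := Tmin) (b := Tmax)).ultrafilter_le_nhds (U.map T) (by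
      rw [le_principal_iff]
      exact mem_map.2 (univ_mem' fun j => hT j))
  have hTU : Tendsto T U (𝓝 T0) := hT0l
  have hfl : ∀ j (s t : ℝ), |((⌊s / τ j⌋ : ℤ) : ℝ) - ⌊t / τ j⌋| * τ j ≤ |s - t| + τ j := by
    intro j s t
    have h1 := floor_dist (s / τ j) (t / τ j)
    have h2 := mul_le_mul_of_nonneg_right h1 (hτp j).le
    rw [add_mul, one_mul, ← sub_div, abs_div, abs_of_pos (hτp j), div_mul_cancel₀ _ (hτp j).ne'] at h2
    exact h2
  refine ⟨U, hU, T0, hT0m, Yl, ?_, ?_, ?_⟩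
  · intro t
    refine tendsto_nhds_unique (hYl (t + T0)) ?_
    have h1 : Tendsto (fun j => y j ⌊(t + T0) / τ j⌋ - y j ⌊t / τ j⌋) U (𝓝 0) := by
      have h2 : Tendsto (fun j => V * (|T0 - T j| + τ j)) U (𝓝 0) := by
        have : Tendsto (fun j => V * (|T0 - T j| + τ j)) U (𝓝 (V * (|T0 - T0| + 0))) :=
          ((tendsto_const_nhds.sub hTU).abs.add hτU).const_mul V
        simpa using this
      refine squeeze_zero_norm' ?_ h2
      filter_upwards [hlip] with j hj
      have e : y j ⌊t / τ j⌋ = y j ⌊(t + T j) / τ j⌋ := by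
        rw [add_div, show T j / τ j = ((N j : ℤ) : ℝ) by
          simp only [hτ]; have := hNp j; have := (hTp j).ne'; push_cast; field_simp, Int.floor_add_intCast, per]
      rw [e]
      refine (hj _ _).trans ?_
      refine mul_le_mul_of_nonneg_left ?_ hVp.le
      have := hfl j (t + T0) (t + T j)
      rwa [add_sub_add_left_eq_sub] at this
    have := h1.add (hYl t)
    simpa using this
  · intro t0
    set f := g (Yl t0) with hf
    rw [hasDerivAt_iff_isLittleO, Asymptotics.isLittleO_iff]
    intro ε hε
    obtain ⟨δ, hδ, hδg⟩ := Metric.continuousAt_iff.1 (hg.continuousAt (x := Yl t0)) (ε / 2) (by positivity)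
    rw [Metric.eventually_nhds_iff]
    refine ⟨δ / (3 * V), by positivity, fun t ht => ?_⟩
    rw [Real.dist_eq, lt_div_iff₀ (by positivity)] at ht
    have h1 : ∀ᶠ j in (U : Filter ℕ), ‖y j ⌊t / τ j⌋ - y j ⌊t0 / τ j⌋ - (t - t0) • f‖ ≤ (|t - t0| + τ j) * ε + 2 * τ j * ‖f‖ := by
      have hc : ∀ᶠ j in (U : Filter ℕ), dist (y j ⌊t0 / τ j⌋) (Yl t0) < δ / 3 :=
        (hYl t0).eventually (Metric.ball_mem_nhds _ (by positivity))
      have hc2 : ∀ᶠ j in (U : Filter ℕ), τ j < δ / (3 * V) := hτU.eventually (gt_mem_nhds (by positivity))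
      filter_upwards [hlip, hc, hc2, hU (heq (ε / 2) (by positivity))] with j hj1 hj2 hj3 hj4
      rw [lt_div_iff₀ (by positivity)] at hj3
      set a := ⌊t0 / τ j⌋ with ha
      set b := ⌊t / τ j⌋ with hb'
      have hba : |(b:ℝ) - a| * τ j ≤ |t - t0| + τ j := hfl j t t0
      have h := tele_int (y j) f (τ j) ε a b fun i hi => by
        have hi' : |(i:ℝ) - a| ≤ |(b:ℝ) - a| := by exact_mod_cast hi
        have k1 := hj1 a i
        have k2 : V * (|(i:ℝ) - a| * τ j) ≤ V * (|(b:ℝ) - a| * τ j) := by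
          have := (hτp j).le
          gcongr
        have k3 : V * (|(b:ℝ) - a| * τ j) ≤ V * (|t - t0| + τ j) := by gcongr
        have k4 : dist (y j i) (Yl t0) < δ := by
          have := dist_triangle (y j i) (y j a) (Yl t0)
          rw [dist_eq_norm (y j i) (y j a)] at this
          nlinarith
        have k5 := (hδg k4).le
        rw [dist_eq_norm] at k5
        have e : y j (i + 1) - y j i - τ j • f = (y j (i + 1) - y j i - τ j • g (y j i)) + τ j • (g (y j i) - f) := by
          rw [smul_sub]; abel
        rw [e]
        refine (norm_add_le _ _).trans ?_
        rw [norm_smul, Real.norm_eq_abs, abs_of_pos (hτp j)]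
        have k6 := hj4 i
        have k7 : τ j * ‖g (y j i) - f‖ ≤ τ j * (ε / 2) := mul_le_mul_of_nonneg_left k5 (hτp j).le
        simp only [hτ] at *
        linarith
      have e : y j b - y j a - (t - t0) • f = (y j b - y j a - (((b:ℝ) - a) * τ j) • f) +
          ((((b:ℝ) - a) * τ j) - (t - t0)) • f := by rw [sub_smul (((b:ℝ) - a) * τ j)]; abel
      rw [e]
      refine (norm_add_le _ _).trans ?_
      rw [norm_smul, Real.norm_eq_abs]
      have k1 : |((b:ℝ) - a) * τ j - (t - t0)| ≤ 2 * τ j := by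
        have e1 := Int.floor_le (t / τ j)
        have e2 := (Int.lt_floor_add_one (t / τ j)).le
        have e3 := Int.floor_le (t0 / τ j)
        have e4 := (Int.lt_floor_add_one (t0 / τ j)).le
        rw [← ha] at e3 e4
        rw [← hb'] at e1 e2
        rw [le_div_iff₀ (hτp j)] at e1 e3
        rw [div_le_iff₀ (hτp j)] at e2 e4
        have := hτp j
        rw [abs_le]; constructor <;> nlinarith
      have k2 : |((b:ℝ) - a) * τ j - (t - t0)| * ‖f‖ ≤ 2 * τ j * ‖f‖ := by gcongr
      have k3 : |(b:ℝ) - a| * (ε * τ j) ≤ (|t - t0| + τ j) * ε := by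
        have := mul_le_mul_of_nonneg_right hba hε.le
        linarith
      linarith
    have h2 : Tendsto (fun j => ‖y j ⌊t / τ j⌋ - y j ⌊t0 / τ j⌋ - (t - t0) • f‖) U
        (𝓝 ‖Yl t - Yl t0 - (t - t0) • f‖) := (((hYl t).sub (hYl t0)).sub tendsto_const_nhds).norm
    have h3 : Tendsto (fun j => (|t - t0| + τ j) * ε + 2 * τ j * ‖f‖) U (𝓝 ((|t - t0| + 0) * ε + 2 * 0 * ‖f‖)) :=
      ((tendsto_const_nhds.add hτU).mul_const ε).add ((hτU.const_mul 2).mul_const _)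
    have h4 := le_of_tendsto_of_tendsto h2 h3 h1
    rw [Real.norm_eq_abs]
    linarith
  · intro i hi
    obtain ⟨ts, -, hts⟩ := (isCompact_Icc (a := (0:ℝ)) (b := Tmax)).ultrafilter_le_nhds (U.map fun j => τ j * i j) (by
      rw [le_principal_iff]
      refine mem_map.2 (univ_mem' fun j => ?_)
      have h1 : (0:ℝ) ≤ i j := by exact_mod_cast (hi j).1
      have h2 : (i j : ℝ) ≤ N j := by exact_mod_cast (hi j).2
      refine ⟨mul_nonneg (hτp j).le h1, ?_⟩
      have h3 := mul_le_mul_of_nonneg_left h2 (hτp j).le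
      have h4 : τ j * N j = T j := by simp only [hτ]; have := hNp j; field_simp
      have := (hT j).2
      change τ j * i j ≤ Tmax
      linarith)
    have hts' : Tendsto (fun j => τ j * i j) U (𝓝 ts) := hts
    refine ⟨ts, ?_⟩
    have h1 : Tendsto (fun j => y j (i j) - y j ⌊ts / τ j⌋) U (𝓝 0) := by
      have h2 : Tendsto (fun j => V * (|τ j * i j - ts| + τ j)) U (𝓝 0) := by
        have : Tendsto (fun j => V * (|τ j * i j - ts| + τ j)) U (𝓝 (V * (|ts - ts| + 0))) :=
          ((hts'.sub tendsto_const_nhds).abs.add hτU).const_mul V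
        simpa using this
      refine squeeze_zero_norm' ?_ h2
      filter_upwards [hlip] with j hj
      refine (hj _ _).trans ?_
      refine mul_le_mul_of_nonneg_left ?_ hVp.le
      have := hfl j (τ j * i j) ts
      rwa [mul_div_cancel_left₀ _ (hτp j).ne', Int.floor_intCast] at this
    have := h1.add (hYl ts)
    simpa using this

end
end Torb

set_option linter.unusedSectionVars false
namespace Torb
open MeasureTheory Set Metric Filter Topology
open scoped RealInnerProductSpace ContDiff

section
variable {n : ℕ} (S : Ham n) (G : Mag n)

theorem ae_crit (q0 p0 q1 : Eu n) (a b : ℝ) (hab : a ≤ b) (h0 : S.H (q0, p0) < a) (h1 : ∀ p, b < S.H (q1, p)) :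
    ∀ᵐ k : ℝ, k ∈ Ioo a b → ∃ d > 0, ∃ s : ℝ, ∃ ν : ℕ → ℕ, StrictMono ν ∧ ∀ j, ∃ z : XX (ν j + 1) n,
      d ≤ Fn S G k z ∧ z.2 ≤ s ∧ dFn S G k z = 0 := by
  obtain ⟨sδ, d0, A, N0, Γ, hΓ⟩ := exists_fam S G q0 p0 q1 a b h0 h1
  have hF : ∀ j : ℕ, Fam S G (Γ (N0 + j + 1)) q0 sδ a b d0 A := fun j => hΓ (N0 + j + 1) (by omega)
  have key := ae_slope (fun j k => cc S G (Γ (N0 + j + 1)) k) a b A hab (fun j => (hF j).mono) (fun j => by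
    have h1 := (hF j).cc_le (right_mem_Icc.2 hab)
    have h2 := (hF j).le_cc (left_mem_Icc.2 hab)
    have h3 := (hF j).d0_pos
    linarith)
  filter_upwards [key] with k hk hkab
  obtain ⟨Mb, hMb, hfr⟩ := hk hkab
  obtain ⟨φ, hφ, hφ'⟩ := extraction_of_frequently_atTop hfr
  refine ⟨d0 / 2, half_pos (hF 0).d0_pos, Real.log (Mb + 2) + 1, fun j => N0 + φ j, fun i j hij => ?_, fun j => ?_⟩
  · have := hφ hij; show N0 + φ i < N0 + φ j; omega
  · exact (hF (φ j)).crit hkab hMb (hφ' j)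

end
end Torb

set_option linter.unusedSectionVars false
namespace Torb
open MeasureTheory Set Metric Filter Topology
open scoped RealInnerProductSpace ContDiff

section
variable {n N : ℕ} [NeZero N] (S : Ham n) (G : Mag n)

theorem sum_single0 (f : ZMod N → Eu n → ℝ) (hf : ∀ j, f j 0 = 0) (i : ZMod N) (w : Eu n) :
    ∑ j, f j ((Pi.single i w : Lp N n) j) = f i w := by
  rw [Finset.sum_eq_single i]
  · rw [Pi.single_eq_same]
  · intro j _ hj
    rw [Pi.single_eq_of_ne hj, hf]
  · intro h; exact absurd (Finset.mem_univ _) h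

theorem sum_single1 (f : ZMod N → Eu n → ℝ) (hf : ∀ j, f j 0 = 0) (i : ZMod N) (w : Eu n) :
    ∑ j, f j ((Pi.single (i + 1) w : Lp N n) (j + 1)) = f i w := by
  rw [Finset.sum_eq_single i]
  · rw [Pi.single_eq_same]
  · intro j _ hj
    rw [Pi.single_eq_of_ne (fun h => hj (add_right_cancel h)), hf]
  · intro h; exact absurd (Finset.mem_univ _) h

/-- momentum at a vertex -/
noncomputable def mom (z : XX N n) (i : ZMod N) : Eu n := S.P (z.1 i, vel z i)

variable {S G} {k : ℝ} {z : XX N n}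

theorem crit_eq (hz : dFn S G k z = 0) (i : ZMod N) (w : Eu n) :
    ⟪mom S z (i + 1) - mom S z i, w⟫ = -(Real.exp z.2 / N) * ⟪S.Hq (z.1 (i + 1), mom S z (i + 1)), w⟫ +
      G.beta (z.1 (i + 1), z.1 (i + 1 + 1)) (w, 0) + G.beta (z.1 i, z.1 (i + 1)) (0, w) := by
  have h := dFn_apply S G k z (Pi.single (i + 1) w, 0)
  rw [hz] at h
  simp only [dterm_apply, mul_zero, add_zero, sub_zero, G.alpha_apply, zero_apply, Finset.sum_sub_distrib,
    inner_sub_right] at h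
  rw [sum_single0 (fun j v => ⟪S.P (z.1 j, vel z j), v⟫) (by simp), sum_single1 (fun j v => ⟪S.P (z.1 j, vel z j), v⟫) (by simp),
    sum_single0 (fun j v => Real.exp z.2 / N * ⟪S.Hq (z.1 j, S.P (z.1 j, vel z j)), v⟫) (by simp)] at h
  have h2 : ∀ j, G.beta (z.1 j, z.1 (j + 1)) ((Pi.single (i + 1) w : Lp N n) j, (Pi.single (i + 1) w : Lp N n) (j + 1))
     = G.beta (z.1 j, z.1 (j + 1)) ((Pi.single (i + 1) w : Lp N n) j, 0) +
       G.beta (z.1 j, z.1 (j + 1)) (0, (Pi.single (i + 1) w : Lp N n) (j + 1)) := by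
    intro j
    rw [← map_add, Prod.mk_add_mk, zero_add, add_zero]
  simp only [h2, Finset.sum_add_distrib] at h
  rw [sum_single0 (fun j v => G.beta (z.1 j, z.1 (j + 1)) (v, 0)) (by intro j; exact map_zero _),
    sum_single1 (fun j v => G.beta (z.1 j, z.1 (j + 1)) (0, v)) (by intro j; exact map_zero _)] at h
  unfold mom
  rw [inner_sub_left]
  linarith

theorem crit_mean (hz : dFn S G k z = 0) : ∑ i, S.H (z.1 i, mom S z i) = N * k := by
  have hN := N_pos (N := N)
  have h := dFn_eσ S G k z
  rw [hz] at h
  have h1 : k - (∑ i, S.En (z.1 i, vel z i)) / N = 0 := by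
    rcases mul_eq_zero.1 h.symm with h | h
    · exact absurd h (Real.exp_pos _).ne'
    · exact h
  have h2 : (∑ i, S.En (z.1 i, vel z i)) = N * k := by
    field_simp at h1; linarith
  exact h2

theorem vel_mom (z : XX N n) (i : ZMod N) : S.Hp (z.1 i, mom S z i) = vel z i := S.Hp_P _ _

theorem crit_lo (hz : dFn S G k z = 0) : ∃ i, S.H (z.1 i, mom S z i) ≤ k := by
  by_contra hcon
  push Not at hcon
  have h := Finset.sum_lt_sum_of_nonempty (s := (Finset.univ : Finset (ZMod N))) Finset.univ_nonempty fun i _ => hcon i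
  rw [crit_mean hz] at h
  simp [ZMod.card] at h

theorem crit_hi (hz : dFn S G k z = 0) : ∃ i, k ≤ S.H (z.1 i, mom S z i) := by
  by_contra hcon
  push Not at hcon
  have h := Finset.sum_lt_sum_of_nonempty (s := (Finset.univ : Finset (ZMod N))) Finset.univ_nonempty fun i _ => hcon i
  rw [crit_mean hz] at h
  simp [ZMod.card] at h

end
end Torb

set_option linter.unusedSectionVars false
namespace Torb
open MeasureTheory Set Metric Filter Topology
open scoped RealInnerProductSpace ContDiff

section
variable {n : ℕ} (S : Ham n) (G : Mag n)

noncomputable def DD : ℝ := S.C * (1 + G.K)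

theorem DD_pos : 0 < DD S G := by
  have := S.C_pos; have := G.K_pos; unfold DD; positivity

noncomputable def R1 (k Tm : ℝ) : ℝ := Real.exp (4 * DD S G * Tm) * (1 + ((|k| + S.C) / S.c + 1))

/-- the Hamiltonian vector field -/
noncomputable def gS (y : Eu n × Eu n) : Eu n × Eu n := (S.Hp y, -S.Hq y - G.B y.1 (S.Hp y))

theorem cgS : Continuous (gS S G) := by
  have h1 := S.cq
  have h2 := S.cp
  have h3 := G.smooth.continuous
  unfold gS
  exact h2.prodMk (h1.neg.sub ((h3.comp continuous_fst).clm_apply h2))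

noncomputable def PhiS (y : (Eu n × Eu n) × (Eu n × Eu n)) : Eu n :=
  -S.Hq y.2 - (1 / 2 : ℝ) • G.B y.2.1 (S.Hp y.2 + S.Hp y.1)

theorem cPhiS : Continuous (PhiS S G) := by
  have h1 := S.cq
  have h2 := S.cp
  have h3 := G.smooth.continuous
  unfold PhiS
  have h4 : Continuous fun y : (Eu n × Eu n) × (Eu n × Eu n) => G.B y.2.1 (S.Hp y.2 + S.Hp y.1) :=
    (h3.comp (continuous_fst.comp continuous_snd)).clm_apply ((h2.comp continuous_snd).add (h2.comp continuous_fst))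
  have h5 := h1.comp (continuous_snd (X := Eu n × Eu n) (Y := Eu n × Eu n))
  exact h5.neg.sub (Continuous.smul (M := ℝ) continuous_const h4)

theorem PhiS_diag (y : Eu n × Eu n) : PhiS S G (y, y) = (gS S G y).2 := by
  simp only [PhiS, gS, ← two_smul ℝ, map_smul, smul_smul]
  norm_num

variable {S G} {k : ℝ} {N : ℕ} [NeZero N] {z : XX N n}

theorem vel_le (z : XX N n) (i : ZMod N) : ‖vel z i‖ ≤ S.C * (1 + ‖mom S z i‖) := by
  rw [← vel_mom (S := S)]; exact S.Hp_le _ _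

theorem mom_step (hz : dFn S G k z = 0) (i : ZMod N) :
    ‖mom S z (i + 1) - mom S z i‖ ≤ Real.exp z.2 / N * DD S G * ((1 + ‖mom S z i‖) + (1 + ‖mom S z (i + 1)‖)) := by
  have hN := N_pos (N := N)
  have hC := S.C_pos
  have hK := G.K_pos
  set τ := Real.exp z.2 / N with hτ
  have hτ0 : 0 < τ := by have := Real.exp_pos z.2; positivity
  set d := mom S z (i + 1) - mom S z i with hd
  have h := crit_eq hz i d
  rw [real_inner_self_eq_norm_sq] at h
  have h1 : |⟪S.Hq (z.1 (i + 1), mom S z (i + 1)), d⟫| ≤ S.C * ‖d‖ :=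
    (abs_real_inner_le_norm _ _).trans (by gcongr; exact S.Hq_le _ _)
  have h2 := G.beta_le (z.1 (i + 1), z.1 (i + 1 + 1)) (d, 0)
  have h3 := G.beta_le (z.1 i, z.1 (i + 1)) (0, d)
  have n2 : ‖((d, 0) : Eu n × Eu n)‖ = ‖d‖ := by simp [Prod.norm_def]
  have n3 : ‖((0, d) : Eu n × Eu n)‖ = ‖d‖ := by simp [Prod.norm_def]
  rw [n2] at h2
  rw [n3] at h3
  simp only [norm_dif, ← hτ] at h2 h3
  have v1 := vel_le (S := S) z i
  have v2 := vel_le (S := S) z (i + 1)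
  have h2' : G.K * (τ * ‖vel z (i + 1)‖) * ‖d‖ ≤ G.K * (τ * (S.C * (1 + ‖mom S z (i + 1)‖))) * ‖d‖ := by gcongr
  have h3' : G.K * (τ * ‖vel z i‖) * ‖d‖ ≤ G.K * (τ * (S.C * (1 + ‖mom S z i‖))) * ‖d‖ := by gcongr
  have h1' : -τ * ⟪S.Hq (z.1 (i + 1), mom S z (i + 1)), d⟫ ≤ τ * (S.C * ‖d‖) := by
    have := (abs_le.1 h1).1
    nlinarith
  have h4 := (abs_le.1 h2).2
  have h5 := (abs_le.1 h3).2
  rcases (norm_nonneg d).eq_or_lt with h0 | h0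
  · rw [← h0]
    have := DD_pos S G
    positivity
  · refine le_of_mul_le_mul_right ?_ h0
    have e1 : 0 ≤ τ * S.C * ‖d‖ := by positivity
    have e2 : 0 ≤ τ * S.C * ‖d‖ * ‖mom S z i‖ := by positivity
    have e3 : 0 ≤ τ * S.C * ‖d‖ * ‖mom S z (i + 1)‖ := by positivity
    unfold DD
    nlinarith

theorem mom_bound (hz : dFn S G k z = 0) {Tm : ℝ} (hT : Real.exp z.2 ≤ Tm)
    (hD : Real.exp z.2 / N * DD S G ≤ 1 / 2) (i : ZMod N) : ‖mom S z i‖ ≤ R1 S G k Tm := by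
  have hN := N_pos (N := N)
  have hc := S.c_pos
  have hC := S.C_pos
  have hDp := DD_pos S G
  obtain ⟨i0, hi0⟩ := crit_lo hz
  have hp0 : ‖mom S z i0‖ ≤ (|k| + S.C) / S.c + 1 := by
    have h1 := S.low (z.1 i0) (mom S z i0)
    have h2 : ‖mom S z i0‖ ^ 2 ≤ (|k| + S.C) / S.c := by
      rw [le_div_iff₀ hc]; linarith [le_abs_self k]
    nlinarith [sq_nonneg (‖mom S z i0‖ - 1)]
  set τ := Real.exp z.2 / N with hτ
  have hτ0 : 0 < τ := by have := Real.exp_pos z.2; positivity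
  have hstep : ∀ j, 1 + ‖mom S z (j + 1)‖ ≤ Real.exp (4 * (τ * DD S G)) * (1 + ‖mom S z j‖) := by
    intro j
    have h1 := mom_step hz j
    rw [← hτ] at h1
    have h2 : ‖mom S z (j + 1)‖ ≤ ‖mom S z j‖ + ‖mom S z (j + 1) - mom S z j‖ := norm_le_insert' _ _
    set x := τ * DD S G with hx
    have hx0 : 0 < x := by positivity
    set u := 1 + ‖mom S z j‖ with hu
    set u' := 1 + ‖mom S z (j + 1)‖ with hu'
    have hup : 0 < u := by positivity
    have h3 : u' * (1 - x) ≤ (1 + 4 * x) * u * (1 - x) := by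
      have : 0 ≤ u * (x * (1 - 2 * x)) := mul_nonneg hup.le (mul_nonneg hx0.le (by linarith))
      nlinarith
    have h4 : u' ≤ (1 + 4 * x) * u := le_of_mul_le_mul_right h3 (by linarith)
    refine h4.trans ?_
    gcongr
    linarith [Real.add_one_le_exp (4 * x)]
  have hit : ∀ m : ℕ, 1 + ‖mom S z (i0 + m)‖ ≤ Real.exp (4 * (τ * DD S G) * m) * (1 + ‖mom S z i0‖) := by
    intro m
    induction m with
    | zero => simp
    | succ m ih =>
      have h1 := hstep (i0 + m)
      push_cast
      rw [← add_assoc]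
      refine h1.trans ?_
      have e : Real.exp (4 * (τ * DD S G) * (m + 1)) = Real.exp (4 * (τ * DD S G)) * Real.exp (4 * (τ * DD S G) * m) := by
        rw [← Real.exp_add]; congr 1; ring
      rw [e, mul_assoc]
      gcongr
  have h := hit (i - i0).val
  rw [ZMod.natCast_val, ZMod.cast_id, add_sub_cancel] at h
  have hv : ((i - i0).val : ℝ) ≤ N := by exact_mod_cast (ZMod.val_lt (i - i0)).le
  have h5 : 4 * (τ * DD S G) * ((i - i0).val : ℝ) ≤ 4 * DD S G * Tm := by
    have : τ * ((i - i0).val : ℝ) ≤ Tm := by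
      refine le_trans ?_ hT
      calc τ * ((i - i0).val : ℝ) ≤ τ * N := by gcongr
        _ = _ := by rw [hτ]; field_simp
    nlinarith
  have h6 : Real.exp (4 * (τ * DD S G) * ((i - i0).val : ℝ)) * (1 + ‖mom S z i0‖) ≤ R1 S G k Tm := by
    unfold R1
    gcongr
  linarith

theorem phi_step (hz : dFn S G k z = 0) {V : ℝ} (hV : ∀ i, ‖vel z i‖ ≤ V) (i : ZMod N) :
    ‖mom S z (i + 1) - mom S z i - (Real.exp z.2 / N) • PhiS S G ((z.1 i, mom S z i), (z.1 (i + 1), mom S z (i + 1)))‖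
      ≤ 2 * G.K * (Real.exp z.2 / N) ^ 2 * V ^ 2 := by
  have hN := N_pos (N := N)
  have hK := G.K_pos
  set τ := Real.exp z.2 / N with hτ
  have hτ0 : 0 < τ := by have := Real.exp_pos z.2; positivity
  have hV0 : 0 ≤ V := (norm_nonneg _).trans (hV i)
  set e := mom S z (i + 1) - mom S z i - τ • PhiS S G ((z.1 i, mom S z i), (z.1 (i + 1), mom S z (i + 1))) with he
  have h := crit_eq hz i e
  have h1 := G.beta_left (z.1 (i + 1)) (z.1 (i + 1 + 1)) e
  have h2 := G.beta_right (z.1 i) (z.1 (i + 1)) e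
  rw [norm_dif, ← hτ] at h1 h2
  have d1 : ‖vel z (i + 1)‖ ^ 2 ≤ V ^ 2 := by gcongr; exact hV _
  have d2 : ‖vel z i‖ ^ 2 ≤ V ^ 2 := by gcongr; exact hV _
  have h1' : G.K * (τ * ‖vel z (i + 1)‖) ^ 2 * ‖e‖ ≤ G.K * (τ ^ 2 * V ^ 2) * ‖e‖ := by
    rw [mul_pow]; gcongr
  have h2' : G.K * (τ * ‖vel z i‖) ^ 2 * ‖e‖ ≤ G.K * (τ ^ 2 * V ^ 2) * ‖e‖ := by
    rw [mul_pow]; gcongr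
  have s1 : ⟪z.1 (i + 1 + 1) - z.1 (i + 1), G.B (z.1 (i + 1)) e⟫ = -(τ * ⟪G.B (z.1 (i + 1)) (vel z (i + 1)), e⟫) := by
    rw [dif_eq, ← hτ, inner_smul_left, real_inner_comm, G.skew]; simp
  have s2 : ⟪z.1 (i + 1) - z.1 i, G.B (z.1 (i + 1)) e⟫ = -(τ * ⟪G.B (z.1 (i + 1)) (vel z i), e⟫) := by
    rw [dif_eq, ← hτ, inner_smul_left, real_inner_comm, G.skew]; simp
  rw [s1] at h1
  rw [s2] at h2
  have h3 : ⟪e, e⟫ = ⟪mom S z (i + 1) - mom S z i, e⟫ + τ * ⟪S.Hq (z.1 (i + 1), mom S z (i + 1)), e⟫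
      + τ * (1 / 2) * ⟪G.B (z.1 (i + 1)) (vel z (i + 1)), e⟫ + τ * (1 / 2) * ⟪G.B (z.1 (i + 1)) (vel z i), e⟫ := by
    have : ⟪e, e⟫ = ⟪mom S z (i + 1) - mom S z i - τ • PhiS S G ((z.1 i, mom S z i), (z.1 (i + 1), mom S z (i + 1))), e⟫ := by
      rw [← he]
    rw [this]
    simp only [PhiS, vel_mom, map_add, smul_add, smul_sub, smul_neg, smul_smul, inner_sub_left, inner_add_left, inner_neg_left,
      real_inner_smul_left]
    ring
  rw [real_inner_self_eq_norm_sq, h] at h3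
  have h4 := (abs_le.1 h1).2
  have h5 := (abs_le.1 h2).2
  rcases (norm_nonneg e).eq_or_lt with h0 | h0
  · rw [← h0]; positivity
  · refine le_of_mul_le_mul_right ?_ h0
    nlinarith

variable (S G)

theorem step_le (k R ε : ℝ) (hε : 0 < ε) : ∃ δ > 0, ∀ (N : ℕ) [NeZero N] (z : XX N n), dFn S G k z = 0 →
    (∀ i, ‖z.1 i‖ ≤ R) → (∀ i, ‖mom S z i‖ ≤ R) → Real.exp z.2 / N ≤ δ → ∀ i : ZMod N,
    ‖((z.1 (i + 1), mom S z (i + 1)) : Eu n × Eu n) - (z.1 i, mom S z i) - (Real.exp z.2 / N) • gS S G (z.1 i, mom S z i)‖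
      ≤ ε * (Real.exp z.2 / N) := by
  have hC := S.C_pos
  have hK := G.K_pos
  have hDp := DD_pos S G
  by_cases hR : R < 0
  · refine ⟨1, one_pos, fun N _ z _ h1 _ _ i => ?_⟩
    exact absurd ((norm_nonneg _).trans (h1 i)) (not_le.2 hR)
  push Not at hR
  set Q : Set (Eu n × Eu n) := closedBall 0 R
  have hQ : IsCompact (Q ×ˢ Q) := (isCompact_closedBall _ _).prod (isCompact_closedBall _ _)
  have huc := hQ.uniformContinuousOn_of_continuous (cPhiS S G).continuousOn
  rw [Metric.uniformContinuousOn_iff_le] at huc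
  obtain ⟨δ1, hδ1, huc⟩ := huc (ε / 2) (by positivity)
  set V := S.C * (1 + R) with hV
  set E := V + DD S G * (2 * (1 + R)) with hE
  have hV0 : 0 < V := by positivity
  have hE0 : 0 < E := by positivity
  refine ⟨min (δ1 / E) (ε / 2 / (2 * G.K * V ^ 2)), by positivity, fun N _ z hz h1 h2 hτ i => ?_⟩
  have hN := N_pos (N := N)
  set τ := Real.exp z.2 / N with hτd
  have hτ0 : 0 < τ := by have := Real.exp_pos z.2; positivity
  have t1 : τ * E ≤ δ1 := by
    have := hτ.trans (min_le_left _ _)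
    rwa [le_div_iff₀ hE0] at this
  have t2 : τ * (2 * G.K * V ^ 2) ≤ ε / 2 := by
    have := hτ.trans (min_le_right _ _)
    rwa [le_div_iff₀ (by positivity)] at this
  have hv : ∀ i, ‖vel z i‖ ≤ V := fun i => (vel_le (S := S) z i).trans (by rw [hV]; gcongr; exact h2 i)
  have hm := mom_step hz i
  rw [← hτd] at hm
  have hm' : ‖mom S z (i + 1) - mom S z i‖ ≤ τ * (DD S G * (2 * (1 + R))) := by
    refine hm.trans ?_
    rw [mul_assoc]
    have a1 := h2 i
    have a2 := h2 (i + 1)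
    gcongr
    linarith
  have hx : ‖z.1 (i + 1) - z.1 i‖ ≤ τ * V := by
    rw [norm_dif]; gcongr; exact hv i
  have hmem : ∀ i, ((z.1 i, mom S z i) : Eu n × Eu n) ∈ Q := fun i =>
    mem_closedBall_zero_iff.2 (norm_prod_le_iff.2 ⟨h1 i, h2 i⟩)
  have hdist : dist (z.1 (i + 1), mom S z (i + 1)) (z.1 i, mom S z i) ≤ δ1 := by
    rw [dist_eq_norm, Prod.mk_sub_mk]
    refine le_trans (norm_prod_le_iff.2 ⟨hx.trans ?_, hm'.trans ?_⟩) t1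
    · rw [hE]; gcongr; linarith [show 0 ≤ DD S G * (2 * (1 + R)) by positivity]
    · rw [hE]; gcongr; linarith
  have hu := huc ((z.1 i, mom S z i), (z.1 (i + 1), mom S z (i + 1))) ⟨hmem _, hmem _⟩
    ((z.1 i, mom S z i), (z.1 i, mom S z i)) ⟨hmem _, hmem _⟩ (by
      rw [Prod.dist_eq]
      exact max_le (by simpa using hδ1.le) hdist)
  rw [PhiS_diag, dist_eq_norm] at hu
  have hp := phi_step hz hv i
  rw [← hτd] at hp
  refine norm_prod_le_iff.2 ⟨?_, ?_⟩
  · simp only [Prod.fst_sub, Prod.smul_fst, gS, vel_mom, dif_eq, ← hτd, sub_self, norm_zero]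
    positivity
  · simp only [Prod.snd_sub, Prod.smul_snd]
    set Ph := PhiS S G ((z.1 i, mom S z i), (z.1 (i + 1), mom S z (i + 1)))
    set g2 := (gS S G (z.1 i, mom S z i)).2
    calc ‖mom S z (i + 1) - mom S z i - τ • g2‖ = ‖(mom S z (i + 1) - mom S z i - τ • Ph) + τ • (Ph - g2)‖ := by
          congr 1; module
      _ ≤ 2 * G.K * τ ^ 2 * V ^ 2 + τ * (ε / 2) := by
          refine (norm_add_le _ _).trans (add_le_add hp ?_)
          rw [norm_smul, Real.norm_eq_abs, abs_of_pos hτ0]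
          gcongr
      _ ≤ ε * τ := by nlinarith

end
end Torb

set_option linter.unusedSectionVars false
namespace Torb
open MeasureTheory Set Metric Filter Topology
open scoped RealInnerProductSpace ContDiff

section
variable {n : ℕ} (S : Ham n) (G : Mag n)

noncomputable def phiS (k Tm : ℝ) (y : Eu n × Eu n) : ℝ := ⟪y.2, S.Hp y⟫ - S.H y + k + G.K * Tm * ‖S.Hp y‖ ^ 2

theorem cphiS (k Tm : ℝ) : Continuous (phiS S G k Tm) := by
  have h1 := S.cH
  have h2 := S.cp
  unfold phiS
  exact (((continuous_snd.inner h2).sub h1).add continuous_const).add (continuous_const.mul (h2.norm.pow 2))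

variable {S G}

theorem crit_phi {N : ℕ} [NeZero N] {z : XX N n} {k d Tm : ℝ} (hd : d ≤ Fn S G k z) (hd0 : 0 < d) (hT : Real.exp z.2 ≤ Tm) :
    ∃ i, d / Tm ≤ phiS S G k Tm (z.1 i, mom S z i) := by
  have hN := N_pos (N := N)
  have hK := G.K_pos
  have hT0 := Real.exp_pos z.2
  have hW := Wn_nonneg z
  have hTm : 0 < Tm := hT0.trans_le hT
  by_contra hcon
  push Not at hcon
  set τ := Real.exp z.2 / N with hτ
  have hτ0 : 0 < τ := by positivity
  have h1 : ∑ i, τ * phiS S G k Tm (z.1 i, mom S z i) < ∑ _i : ZMod N, τ * (d / Tm) :=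
    Finset.sum_lt_sum_of_nonempty Finset.univ_nonempty fun i _ => mul_lt_mul_of_pos_left (hcon i) hτ0
  have h2 : ∑ _i : ZMod N, τ * (d / Tm) ≤ d := by
    rw [Finset.sum_const, Finset.card_univ, ZMod.card, nsmul_eq_mul, hτ]
    have e : (N : ℝ) * (Real.exp z.2 / N * (d / Tm)) = Real.exp z.2 * d / Tm := by field_simp
    rw [e, div_le_iff₀ hTm]
    nlinarith
  have h3 : ∀ i, τ * phiS S G k Tm (z.1 i, mom S z i) = τ * S.L (z.1 i, vel z i) + τ * (k + G.K * Tm * ‖vel z i‖ ^ 2) := by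
    intro i
    have : S.L (z.1 i, vel z i) = ⟪mom S z i, vel z i⟫ - S.H (z.1 i, mom S z i) := rfl
    simp only [phiS, vel_mom]
    rw [this]; ring
  simp only [h3, Finset.sum_add_distrib] at h1
  rw [sum_tau z k (G.K * Tm)] at h1
  have h4 := (abs_le.1 (G.M_le z.1)).2
  have h5 := len_sq_le z
  have h6 : G.M z.1 ≤ Real.exp z.2 * (G.K * Tm * Wn z) := by
    calc G.M z.1 ≤ G.K * (Real.exp z.2 ^ 2 * Wn z) := h4.trans (by gcongr)
      _ = Real.exp z.2 * (G.K * Real.exp z.2 * Wn z) := by ring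
      _ ≤ _ := by gcongr
  rw [Fn, act, ← hτ] at hd
  linarith

theorem energy_const {Y : ℝ → Eu n × Eu n} (hY : ∀ t, HasDerivAt Y (gS S G (Y t)) t) (t s : ℝ) : S.H (Y t) = S.H (Y s) := by
  have h : ∀ t, HasDerivAt (fun t => S.H (Y t)) 0 t := by
    intro t
    have h1 := (S.hd (Y t).1 (Y t).2).comp_hasDerivAt t (hY t)
    refine h1.congr_deriv ?_
    have hs := G.skew (Y t).1 (S.Hp (Y t)) (S.Hp (Y t))
    have hs0 : ⟪G.B (Y t).1 (S.Hp (Y t)), S.Hp (Y t)⟫ = 0 := by linarith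
    rw [real_inner_comm] at hs0
    simp only [gS, add_apply, ContinuousLinearMap.comp_apply, ContinuousLinearMap.coe_fst', ContinuousLinearMap.coe_snd',
      innerSL_apply_apply, inner_sub_right, inner_neg_right, Prod.mk.eta, hs0, real_inner_comm (S.Hp (Y t)) (S.Hq (Y t))]
    ring
  exact is_const_of_deriv_eq_zero (fun t => (h t).differentiableAt) (fun t => (h t).deriv) t s

theorem prep {k : ℝ} (hcr : ∃ d > 0, ∃ s : ℝ, ∃ ν : ℕ → ℕ, StrictMono ν ∧ ∀ j, ∃ z : XX (ν j + 1) n,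
      d ≤ Fn S G k z ∧ z.2 ≤ s ∧ dFn S G k z = 0) :
    ∃ d Tmin Tm R : ℝ, 0 < d ∧ 0 < Tmin ∧ 0 < Tm ∧ ∃ ν : ℕ → ℕ, StrictMono ν ∧ ∀ j, ∃ z : XX (ν j + 1) n,
      d ≤ Fn S G k z ∧ dFn S G k z = 0 ∧ Tmin ≤ Real.exp z.2 ∧ Real.exp z.2 ≤ Tm ∧ (∀ i, ‖z.1 i‖ ≤ R) ∧
      (∀ i, ‖mom S z i‖ ≤ R) := by
  obtain ⟨d, hd, s, ν, hν, hz⟩ := hcr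
  have hDp := DD_pos S G
  have hK := G.K_pos
  have hCL := CL_pos S
  have hC := S.C_pos
  have hc := S.c_pos
  obtain ⟨ρ, hρ, hred⟩ := lat_reduce n
  set Tm := Real.exp s with hTm
  have hTm0 : 0 < Tm := Real.exp_pos s
  set V := S.C * (1 + R1 S G k Tm) with hV
  have hR1 : 0 < R1 S G k Tm := by unfold R1; positivity
  have hV0 : 0 < V := by positivity
  set Q := CL S * (1 + V ^ 2) + G.K * Tm * V ^ 2 + |k| with hQ
  have hQ0 : 0 < Q := by positivity
  obtain ⟨J, hJ⟩ := exists_nat_ge (2 * (Tm * DD S G))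
  refine ⟨d, d / Q, Tm, max (ρ + Tm * V) (R1 S G k Tm), hd, by positivity, hTm0, fun j => ν (J + j),
    fun i j hij => hν (by omega), fun j => ?_⟩
  obtain ⟨z, hz1, hz2, hz3⟩ := hz (J + j)
  obtain ⟨m, hm⟩ := hred (z.1 0)
  have hT : Real.exp z.2 ≤ Tm := Real.exp_le_exp.2 hz2
  have hT0 := Real.exp_pos z.2
  have hN : (J : ℝ) ≤ ((ν (J + j) + 1 : ℕ) : ℝ) := by
    have := hν.id_le (J + j)
    simp only [id] at this
    exact_mod_cast (by omega : J ≤ ν (J + j) + 1)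
  have hNp : (0:ℝ) < ((ν (J + j) + 1 : ℕ) : ℝ) := by positivity
  have hD : Real.exp z.2 / ((ν (J + j) + 1 : ℕ) : ℝ) * DD S G ≤ 1 / 2 := by
    rw [div_mul_eq_mul_div, div_le_iff₀ hNp]
    nlinarith
  have hmom := mom_bound hz3 hT hD
  have hv : ∀ i, ‖vel z i‖ ≤ V := fun i => (vel_le (S := S) z i).trans (by rw [hV]; gcongr; exact hmom i)
  have hW := Wn_le z V hv
  have hW0 := Wn_nonneg z
  have hlen : len z.1 ≤ Tm * V := by
    refine abs_le_of_sq_le_sq' ?_ (by positivity) |>.2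
    refine (len_sq_le z).trans ?_
    rw [mul_pow]
    gcongr
  have hmt : ∀ i, mom S (z + tr m) i = mom S z i := by
    intro i
    simp only [mom, vel_tr]
    exact S.perP _ _ _
  have ht2 : (z + tr m).2 = z.2 := by simp [tr]
  refine ⟨z + tr m, by rwa [Fn_tr], by rwa [dFn_tr], ?_, by rwa [ht2], fun i => ?_, fun i => ?_⟩
  · rw [ht2, div_le_iff₀ hQ0]
    have h1 := act_le S G z
    rw [Fn] at hz1
    have h2 : Real.exp z.2 * (CL S * (1 + Wn z)) + G.K * Real.exp z.2 ^ 2 * Wn z ≤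
        Real.exp z.2 * (CL S * (1 + V ^ 2)) + Real.exp z.2 * (G.K * Tm * V ^ 2) := by
      have : G.K * Real.exp z.2 ^ 2 * Wn z = Real.exp z.2 * (G.K * Real.exp z.2 * Wn z) := by ring
      rw [this]
      gcongr
    have h3 : k * Real.exp z.2 ≤ |k| * Real.exp z.2 := by gcongr; exact le_abs_self k
    rw [hQ]
    linarith
  · refine le_trans ?_ (le_max_left _ _)
    have e : (z + tr m).1 i = (z.1 0 + lat m) + (z.1 i - z.1 0) := by
      simp only [Prod.fst_add, Pi.add_apply, tr]; abel
    rw [e]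
    exact (norm_add_le _ _).trans (add_le_add hm ((dist_zero_le_len _ _).trans hlen))
  · rw [hmt]; exact (hmom i).trans (le_max_right _ _)

theorem exists_orbit {k : ℝ} (hcr : ∃ d > 0, ∃ s : ℝ, ∃ ν : ℕ → ℕ, StrictMono ν ∧ ∀ j, ∃ z : XX (ν j + 1) n,
      d ≤ Fn S G k z ∧ z.2 ≤ s ∧ dFn S G k z = 0) :
    ∃ T > 0, ∃ Y : ℝ → Eu n × Eu n, Function.Periodic Y T ∧ (∀ t, HasDerivAt Y (gS S G (Y t)) t) ∧ (∀ t, S.H (Y t) = k) ∧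
      ∃ t1 t2, Y t1 ≠ Y t2 := by
  obtain ⟨d, Tmin, Tm, R, hd, hTmin, hTm, ν, hν, hz⟩ := prep hcr
  choose z z1 z2 z3 z4 z5 z6 using hz
  let y : ℕ → ℤ → Eu n × Eu n := fun j i => ((z j).1 (i : ZMod (ν j + 1)), mom S (z j) (i : ZMod (ν j + 1)))
  have hνt : Tendsto (fun j => ν j + 1) atTop atTop := (tendsto_add_atTop_nat 1).comp hν.tendsto_atTop
  have key := limit_orbit (gS S G) (cgS S G) (fun j => ν j + 1) (fun j => Nat.succ_pos _) hνt y (fun j => Real.exp (z j).2)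
    Tmin Tm R hTmin (fun j => ⟨z3 j, z4 j⟩) (fun j i => by simp [y]) (fun j i => norm_prod_le_iff.2 ⟨z5 j _, z6 j _⟩) ?_
  swap
  · intro ε hε
    obtain ⟨δ, hδ, hst⟩ := step_le S G k R ε hε
    have h1 : Tendsto (fun j => Tm / ((ν j + 1 : ℕ) : ℝ)) atTop (𝓝 0) :=
      tendsto_const_nhds.div_atTop (tendsto_natCast_atTop_atTop.comp hνt)
    filter_upwards [h1.eventually (gt_mem_nhds hδ)] with j hj i
    have h2 : Real.exp (z j).2 / ((ν j + 1 : ℕ) : ℝ) ≤ δ := by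
      refine le_trans ?_ hj.le
      gcongr
      exact z4 j
    have := hst (ν j + 1) (z j) (z2 j) (z5 j) (z6 j) h2 (i : ZMod (ν j + 1))
    simpa [y] using this
  obtain ⟨U, hU, T0, hT0, Y, hper, hY, hlim⟩ := key
  have hidx : ∀ i : ∀ j, ZMod (ν j + 1), ∃ t, Tendsto (fun j => ((z j).1 (i j), mom S (z j) (i j))) U (𝓝 (Y t)) := by
    intro i
    obtain ⟨t, ht⟩ := hlim (fun j => ((i j).val : ℤ)) (fun j => ⟨by positivity, by exact_mod_cast (ZMod.val_lt (i j)).le⟩)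
    refine ⟨t, ?_⟩
    refine ht.congr fun j => ?_
    have : (((i j).val : ℤ) : ZMod (ν j + 1)) = i j := by
      rw [Int.cast_natCast, ZMod.natCast_val, ZMod.cast_id]
    simp only [y, this]
  choose ilo hlo using fun j => crit_lo (z2 j)
  choose ihi hhi using fun j => crit_hi (z2 j)
  choose iph hph using fun j => crit_phi (z1 j) hd (z4 j)
  obtain ⟨t1, ht1⟩ := hidx ilo
  obtain ⟨t2, ht2⟩ := hidx ihi
  obtain ⟨t3, ht3⟩ := hidx iph
  have e1 : S.H (Y t1) ≤ k := le_of_tendsto ((S.cH.tendsto _).comp ht1) (Eventually.of_forall hlo)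
  have e2 : k ≤ S.H (Y t2) := ge_of_tendsto ((S.cH.tendsto _).comp ht2) (Eventually.of_forall hhi)
  have e3 : d / Tm ≤ phiS S G k Tm (Y t3) := ge_of_tendsto (((cphiS S G k Tm).tendsto _).comp ht3) (Eventually.of_forall hph)
  have hE : ∀ t, S.H (Y t) = k := fun t =>
    le_antisymm ((energy_const hY t t1).le.trans e1) (e2.trans (energy_const hY t2 t).le)
  refine ⟨T0, hTmin.trans_le hT0.1, Y, hper, hY, hE, ?_⟩
  by_contra hcon
  push Not at hcon
  have hc : Y = fun _ => Y t3 := funext fun t => hcon t t3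
  have hd0 : HasDerivAt Y 0 t3 := by
    rw [hc]; exact hasDerivAt_const _ _
  have h0 : gS S G (Y t3) = 0 := (hY t3).unique hd0
  have h1 : S.Hp (Y t3) = 0 := congrArg Prod.fst h0
  simp only [phiS, h1, inner_zero_right, hE, norm_zero] at e3
  have : 0 < d / Tm := by positivity
  norm_num at e3
  linarith

end
end Torb

set_option linter.unusedSectionVars false
namespace Torb
open MeasureTheory Set Metric Filter Topology
open scoped RealInnerProductSpace ContDiff

section

theorem smooth_ode {Y : Type*} [NormedAddCommGroup Y] [NormedSpace ℝ Y] (g : Y → Y) (hg : ContDiff ℝ ∞ g) (y : ℝ → Y)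
    (hy : ∀ t, HasDerivAt y (g (y t)) t) : ContDiff ℝ ∞ y := by
  have hd : deriv y = fun t => g (y t) := funext fun t => (hy t).deriv
  rw [contDiff_infty]
  intro m
  induction m with
  | zero => exact contDiff_zero.2 (continuous_iff_continuousAt.2 fun t => (hy t).continuousAt)
  | succ m ih =>
    have h : ContDiff ℝ ((m : WithTop ℕ∞) + 1) y := by
      rw [contDiff_succ_iff_deriv]
      refine ⟨fun t => (hy t).differentiableAt, by simp, ?_⟩
      rw [hd]
      exact (hg.of_le (by exact_mod_cast le_top)).comp ih
    exact_mod_cast h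

variable {n : ℕ}

noncomputable def gradP (H : Eu n × Eu n → ℝ) (y : Eu n × Eu n) : Eu n :=
  (InnerProductSpace.toDual ℝ (Eu n)).symm ((fderiv ℝ H y).comp (ContinuousLinearMap.inr ℝ (Eu n) (Eu n)))
noncomputable def gradQ (H : Eu n × Eu n → ℝ) (y : Eu n × Eu n) : Eu n :=
  (InnerProductSpace.toDual ℝ (Eu n)).symm ((fderiv ℝ H y).comp (ContinuousLinearMap.inl ℝ (Eu n) (Eu n)))

theorem gradP_eq (H : Eu n × Eu n → ℝ) (hH : ContDiff ℝ ∞ H) (q p : Eu n) :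
    gradient (fun p' => H (q, p')) p = gradP H (q, p) := by
  have hd : Differentiable ℝ H := hH.differentiable (by simp)
  rw [gradient, gradP]
  congr 1
  exact ((hd (q, p)).hasFDerivAt.comp p (hasFDerivAt_prodMk_right q p)).fderiv

theorem gradQ_eq (H : Eu n × Eu n → ℝ) (hH : ContDiff ℝ ∞ H) (q p : Eu n) :
    gradient (fun q' => H (q', p)) q = gradQ H (q, p) := by
  have hd : Differentiable ℝ H := hH.differentiable (by simp)
  rw [gradient, gradQ]
  congr 1
  exact ((hd (q, p)).hasFDerivAt.comp q (hasFDerivAt_prodMk_left q p)).fderiv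

theorem contDiff_gradP (H : Eu n × Eu n → ℝ) (hH : ContDiff ℝ ∞ H) : ContDiff ℝ ∞ (gradP H) := by
  have h1 : ContDiff ℝ ∞ (fderiv ℝ H) := hH.fderiv_right (by simp)
  unfold gradP
  exact (InnerProductSpace.toDual ℝ (Eu n)).symm.contDiff.comp (h1.clm_comp contDiff_const)

theorem contDiff_gradQ (H : Eu n × Eu n → ℝ) (hH : ContDiff ℝ ∞ H) : ContDiff ℝ ∞ (gradQ H) := by
  have h1 : ContDiff ℝ ∞ (fderiv ℝ H) := hH.fderiv_right (by simp)
  unfold gradQ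
  exact (InnerProductSpace.toDual ℝ (Eu n)).symm.contDiff.comp (h1.clm_comp contDiff_const)

theorem grad_S (S : Ham n) (H : Eu n × Eu n → ℝ) (y : Eu n × Eu n) (h : S.H =ᶠ[𝓝 y] H) :
    gradP H y = S.Hp y ∧ gradQ H y = S.Hq y := by
  have h1 : HasFDerivAt H _ y := (S.hd y.1 y.2).congr_of_eventuallyEq h.symm
  rw [gradP, gradQ, h1.fderiv]
  constructor
  · rw [LinearIsometryEquiv.symm_apply_eq]
    refine ContinuousLinearMap.ext fun v => ?_
    simp
  · rw [LinearIsometryEquiv.symm_apply_eq]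
    refine ContinuousLinearMap.ext fun v => ?_
    simp

theorem main_level (H : Eu n × Eu n → ℝ) (G : Mag n) (hB : ContDiff ℝ ∞ G.B) (hH : ContDiff ℝ ∞ H)
    (hper : ∀ m q p, H (q + lat m, p) = H (q, p))
    (hconv : ∀ q p v : Eu n, v ≠ 0 → 0 < iteratedFDeriv ℝ 2 (fun p' => H (q, p')) p ![v, v])
    (hsup : ∀ A : ℝ, 0 < A → ∃ C : ℝ, ∀ q p, A * ‖p‖ - C ≤ H (q, p)) (a b : ℝ) (hab : a ≤ b)
    (h0 : ∃ y, H y < a) (h1 : ∃ q, ∀ p, b < H (q, p)) :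
    ∀ᵐ k ∂(volume : Measure ℝ), k ∈ Ioo a b →
      ∃ T : ℝ, 0 < T ∧ ∃ q p : ℝ → Eu n, ContDiff ℝ ∞ q ∧ ContDiff ℝ ∞ p ∧
          Function.Periodic q T ∧ Function.Periodic p T ∧
          (∃ t₁ t₂ : ℝ, (q t₁, p t₁) ≠ (q t₂, p t₂)) ∧
          (∀ t : ℝ, deriv q t = gradient (fun p' => H (q t, p')) (p t)) ∧
          (∀ t : ℝ, deriv p t =
            -gradient (fun q' => H (q', p t)) (q t)
              - G.B (q t) (gradient (fun p' => H (q t, p')) (p t))) ∧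
          (∀ t : ℝ, H (q t, p t) = k) := by
  obtain ⟨S, R, hR, hS1, hS2, hS3⟩ := modify H hH hper (fun q p v hv => by
    rw [← slice_second H hH]; exact hconv q p v hv) hsup b
  obtain ⟨⟨q0, p0⟩, h0⟩ := h0
  obtain ⟨q1, h1⟩ := h1
  have h0' : S.H (q0, p0) < a := by
    rwa [hS1 q0 p0 (hS3 q0 p0 (by linarith))]
  have h1' : ∀ p, b < S.H (q1, p) := by
    intro p
    by_contra hcon
    push Not at hcon
    have := h1 p
    rw [hS1 q1 p (hS2 q1 p hcon)] at hcon
    linarith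
  filter_upwards [ae_crit S G q0 p0 q1 a b hab h0' h1'] with k hk hkab
  obtain ⟨T, hT, Y, hYp, hY, hE, hne⟩ := exists_orbit (hk hkab)
  have hpR : ∀ t, ‖(Y t).2‖ < R := fun t => hS2 (Y t).1 (Y t).2 (by rw [Prod.mk.eta, hE]; exact hkab.2.le)
  have hev : ∀ t, S.H =ᶠ[𝓝 (Y t)] H := by
    intro t
    have ho : IsOpen {y : Eu n × Eu n | ‖y.2‖ < R} := isOpen_lt continuous_snd.norm continuous_const
    filter_upwards [ho.mem_nhds (hpR t)] with y hy
    exact hS1 y.1 y.2 hy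
  have hgP : ∀ t, gradP H (Y t) = S.Hp (Y t) := fun t => (grad_S S H (Y t) (hev t)).1
  have hgQ : ∀ t, gradQ H (Y t) = S.Hq (Y t) := fun t => (grad_S S H (Y t) (hev t)).2
  let g : Eu n × Eu n → Eu n × Eu n := fun y => (gradP H y, -gradQ H y - G.B y.1 (gradP H y))
  have hg : ContDiff ℝ ∞ g := by
    have c1 := contDiff_gradP H hH
    have c2 := contDiff_gradQ H hH
    exact c1.prodMk (c2.neg.sub ((hB.comp contDiff_fst).clm_apply c1))
  have hY' : ∀ t, HasDerivAt Y (g (Y t)) t := by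
    intro t
    have : g (Y t) = gS S G (Y t) := by simp only [g, gS, hgP, hgQ]
    rw [this]; exact hY t
  have hsm := smooth_ode g hg Y hY'
  refine ⟨T, hT, fun t => (Y t).1, fun t => (Y t).2, hsm.fst, hsm.snd, fun t => congrArg Prod.fst (hYp t),
    fun t => congrArg Prod.snd (hYp t), hne, fun t => ?_, fun t => ?_, fun t => ?_⟩
  · rw [gradP_eq H hH]
    exact ((hasFDerivAt_fst.comp_hasDerivAt t (hY' t)) : HasDerivAt (fun t => (Y t).1) _ t).deriv
  · rw [gradP_eq H hH, gradQ_eq H hH]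
    exact ((hasFDerivAt_snd.comp_hasDerivAt t (hY' t)) : HasDerivAt (fun t => (Y t).2) _ t).deriv
  · rw [← hE t]; exact ((hev t).eq_of_nhds).symm

theorem ae_levels (H : Eu n × Eu n → ℝ) (hHsuper : ∀ A : ℝ, 0 < A → ∃ C : ℝ, ∀ q p, A * ‖p‖ - C ≤ H (q, p))
    (Q : ℝ → Prop) (hQ : ∀ a b : ℝ, a ≤ b → (∃ y, H y < a) → (∃ q, ∀ p, b < H (q, p)) →
      ∀ᵐ k ∂(volume : Measure ℝ), k ∈ Ioo a b → Q k) :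
    ∀ᵐ k ∂(volume : Measure ℝ), ((⨅ qp : Eu n × Eu n, H qp) < k ∧ k < ⨆ q : Eu n, ⨅ p : Eu n, H (q, p)) → Q k := by
  have key : ∀ᵐ k ∂(volume : Measure ℝ), ∀ a b : ℚ, (a : ℝ) ≤ b → (∃ y, H y < a) → (∃ q, ∀ p, (b : ℝ) < H (q, p)) →
      k ∈ Set.Ioo (a : ℝ) b → Q k := by
    rw [ae_all_iff]; intro a
    rw [ae_all_iff]; intro b
    by_cases hab : (a : ℝ) ≤ b
    swap
    · exact Filter.Eventually.of_forall fun k h => absurd h hab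
    by_cases h0 : ∃ y, H y < a
    swap
    · exact Filter.Eventually.of_forall fun k _ h => absurd h h0
    by_cases h1 : ∃ q, ∀ p, (b : ℝ) < H (q, p)
    swap
    · exact Filter.Eventually.of_forall fun k _ _ h => absurd h h1
    have hm := hQ a b hab h0 h1
    filter_upwards [hm] with k hk _ _ _ hkab
    exact hk hkab
  filter_upwards [key] with k hk hlt
  obtain ⟨hlo, hhi⟩ := hlt
  obtain ⟨y, hy⟩ := exists_lt_of_ciInf_lt hlo
  obtain ⟨q, hq⟩ := exists_lt_of_lt_ciSup hhi
  obtain ⟨a, ha1, ha2⟩ := exists_rat_btwn hy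
  obtain ⟨b, hb1, hb2⟩ := exists_rat_btwn hq
  obtain ⟨C, hC⟩ := hHsuper 1 one_pos
  have hbdd : BddBelow (Set.range fun p => H (q, p)) := by
    refine ⟨-C, ?_⟩
    rintro _ ⟨p, rfl⟩
    have := hC q p
    have := norm_nonneg p
    simp only
    linarith
  exact hk a b (ha2.trans hb1).le ⟨y, ha1⟩ ⟨q, fun p => hb2.trans_le (ciInf_le hbdd p)⟩ ⟨ha2, hb1⟩

end
end Torb

open MeasureTheory
open scoped RealInnerProductSpace

/-- Corollary 1.5 of the paper instantiated on the flat torus `𝕋ⁿ`, in lifted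
coordinates on `ℝⁿ = EuclideanSpace ℝ (Fin n)`.

`H` is a Tonelli Hamiltonian on `𝕋ⁿ` and `B` is a magnetic field on `𝕋ⁿ`.
Then for Lebesgue-almost every `k` with `inf H < k < e₀(H)`, where
`e₀(H) = sup_q inf_p H(q,p)`, there is a nonconstant smooth periodic solution
of the twisted Hamilton equations with energy `k`. -/
theorem contractible_periodic_orbit_on_torus_below_e0
    (n : ℕ)
    (H : EuclideanSpace ℝ (Fin n) × EuclideanSpace ℝ (Fin n) → ℝ)
    (B : EuclideanSpace ℝ (Fin n) →
      EuclideanSpace ℝ (Fin n) →L[ℝ] EuclideanSpace ℝ (Fin n))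
    (hHsmooth : ContDiff ℝ (⊤ : ℕ∞) H)
    (hHper : ∀ (m : Fin n → ℤ) (q p : EuclideanSpace ℝ (Fin n)),
      H (q + (EuclideanSpace.equiv (Fin n) ℝ).symm (fun i => (m i : ℝ)), p) = H (q, p))
    (hHconv : ∀ (q p v : EuclideanSpace ℝ (Fin n)), v ≠ 0 →
      0 < iteratedFDeriv ℝ 2 (fun p' => H (q, p')) p ![v, v])
    (hHsuper : ∀ A : ℝ, 0 < A → ∃ C : ℝ, ∀ q p, A * ‖p‖ - C ≤ H (q, p))
    (hBsmooth : ContDiff ℝ (⊤ : ℕ∞) B)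
    (hBper : ∀ (m : Fin n → ℤ) (q : EuclideanSpace ℝ (Fin n)),
      B (q + (EuclideanSpace.equiv (Fin n) ℝ).symm (fun i => (m i : ℝ))) = B q)
    (hBskew : ∀ q u v : EuclideanSpace ℝ (Fin n), ⟪B q u, v⟫ = -⟪B q v, u⟫)
    (hBclosed : ∀ q u v w : EuclideanSpace ℝ (Fin n),
      ⟪(fderiv ℝ B q u) v, w⟫ + ⟪(fderiv ℝ B q v) w, u⟫ + ⟪(fderiv ℝ B q w) u, v⟫ = 0) :
    ∀ᵐ k ∂(volume : Measure ℝ),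
      ((⨅ qp : EuclideanSpace ℝ (Fin n) × EuclideanSpace ℝ (Fin n), H qp) < k ∧
        k < ⨆ q : EuclideanSpace ℝ (Fin n), ⨅ p : EuclideanSpace ℝ (Fin n), H (q, p)) →
      ∃ T : ℝ, 0 < T ∧
        ∃ q p : ℝ → EuclideanSpace ℝ (Fin n),
          ContDiff ℝ (⊤ : ℕ∞) q ∧ ContDiff ℝ (⊤ : ℕ∞) p ∧
          Function.Periodic q T ∧ Function.Periodic p T ∧
          (∃ t₁ t₂ : ℝ, (q t₁, p t₁) ≠ (q t₂, p t₂)) ∧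
          (∀ t : ℝ, deriv q t = gradient (fun p' => H (q t, p')) (p t)) ∧
          (∀ t : ℝ, deriv p t =
            -gradient (fun q' => H (q', p t)) (q t)
              - B (q t) (gradient (fun p' => H (q t, p')) (p t))) ∧
          (∀ t : ℝ, H (q t, p t) = k) := by
  let G : Torb.Mag n := ⟨B, hBsmooth.of_le (by exact_mod_cast le_top), hBper, hBskew, hBclosed⟩
  exact Torb.ae_levels H hHsuper _ fun a b hab h0 h1 =>
    Torb.main_level H G hBsmooth hHsmooth hHper hHconv hHsuper a b hab h0 h1
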